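/- For every ε > 0 there exists n₀ ∈ ℕ such that every (1/3 + ε, ee)-dense reduced hypergraph 𝒜 whose index set has size at least n₀ supports a K₅⁽³⁾. -/

import Mathlib

open Finset Classical

noncomputable section

/-- A reduced hypergraph: a finite (linearly ordered, here `ℕ`) index set `I`,
pairwise disjoint nonempty finite vertex classes `P i j` for distinct `i j ∈ I`,
and for each triple of distinct indices a tripartite 3-uniform constituent,
encoded by a symmetric edge predicate on vertices. -/
structure ReducedHG where
  I : Finset ℕ
  P : ℕ → ℕ → Finset ℕ
  Psymm : ∀ i j, P i j = P j i
  Pnonempty : ∀ i j, i ∈ I → j ∈ I → i ≠ j → (P i j).Nonempty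
  Pdisjoint : ∀ i j k l, i ≠ j → k ≠ l → ({i, j} : Finset ℕ) ≠ ({k, l} : Finset ℕ) →
      Disjoint (P i j) (P k l)
  Edge : ℕ → ℕ → ℕ → Prop
  EdgeSymm : ∀ a b c, Edge a b c → Edge b a c
  EdgeSymm' : ∀ a b c, Edge a b c → Edge a c b
  EdgeValid : ∀ a b c, Edge a b c → ∃ i j k, i ∈ I ∧ j ∈ I ∧ k ∈ I ∧
      i ≠ j ∧ i ≠ k ∧ j ≠ k ∧ a ∈ P i j ∧ b ∈ P i k ∧ c ∈ P j k

namespace ReducedHG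

variable (A : ReducedHG)

/-- The neighbourhood, inside the vertex class `P j k`, of two vertices `a`, `b`. -/
def nbhd (j k : ℕ) (a b : ℕ) : Finset ℕ := (A.P j k).filter fun c => A.Edge a b c

/-- The number of crossing edges between three vertex sets. -/
def ecount (X Y Z : Finset ℕ) : ℕ :=
  ((X ×ˢ Y ×ˢ Z).filter fun t => A.Edge t.1 t.2.1 t.2.2).card

/-- `(d, ee)`-density: every pair of vertices sharing an index has large degree. -/
def EEDense (d : ℝ) : Prop :=
  ∀ i j k, i ∈ A.I → j ∈ A.I → k ∈ A.I → i ≠ j → i ≠ k → j ≠ k →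
    ∀ a ∈ A.P i j, ∀ b ∈ A.P i k,
      d * ((A.P j k).card : ℝ) ≤ ((A.nbhd j k a b).card : ℝ)

/-- `(μ, vvv)`-density: every constituent has many edges. -/
def VVVDense (μ : ℝ) : Prop :=
  ∀ i j k, i ∈ A.I → j ∈ A.I → k ∈ A.I → i ≠ j → i ≠ k → j ≠ k →
    μ * (((A.P i j).card : ℝ) * ((A.P i k).card : ℝ) * ((A.P j k).card : ℝ)) ≤
      (A.ecount (A.P i j) (A.P i k) (A.P j k) : ℝ)

/-- The reduced hypergraph supports a `K₅⁽³⁾`. -/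
def SupportsK5 : Prop :=
  ∃ J ⊆ A.I, J.card = 5 ∧ ∃ f : ℕ → ℕ → ℕ,
    (∀ i ∈ J, ∀ j ∈ J, f i j = f j i) ∧
    (∀ i ∈ J, ∀ j ∈ J, i ≠ j → f i j ∈ A.P i j) ∧
    (∀ i ∈ J, ∀ j ∈ J, ∀ k ∈ J, i ≠ j → i ≠ k → j ≠ k →
      A.Edge (f i j) (f i k) (f j k))

/-- `ε`-wicked: `(1/3 + ε, ee)`-dense and not supporting a `K₅⁽³⁾`. -/
def Wicked (ε : ℝ) : Prop := A.EEDense (1/3 + ε) ∧ ¬ A.SupportsK5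

/-- A `J`-transversal: one vertex in each class `P i j`, `ij ∈ J⁽²⁾`. -/
def IsTransversal (J : Finset ℕ) (Q : ℕ → ℕ → ℕ) : Prop :=
  (∀ i ∈ J, ∀ j ∈ J, Q i j = Q j i) ∧ ∀ i ∈ J, ∀ j ∈ J, i ≠ j → Q i j ∈ A.P i j

/-- A `(K, L)`-transversal: one vertex in each class `P k l`, `(k, l) ∈ K × L`. -/
def IsTransversal2 (K L : Finset ℕ) (Q : ℕ → ℕ → ℕ) : Prop :=
  ∀ k ∈ K, ∀ l ∈ L, Q k l ∈ A.P k l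

/-- An inhabited triple of `J`-transversals. -/
def InhabitedTriple (J : Finset ℕ) (Q R S : ℕ → ℕ → ℕ) : Prop :=
  ∀ i ∈ J, ∀ j ∈ J, ∀ k ∈ J, i < j → j < k → A.Edge (Q i j) (R i k) (S j k)

/-- An inhabited triple consisting of a `(K,L)`-, a `(K,M)`- and an `(L,M)`-transversal. -/
def InhabitedTriple2 (K L M : Finset ℕ) (Q R S : ℕ → ℕ → ℕ) : Prop :=
  ∀ k ∈ K, ∀ l ∈ L, ∀ m ∈ M, A.Edge (Q k l) (R k m) (S l m)

/-- `Φ` is a `μ`-hole on `J`. -/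
def IsHole (μ : ℝ) (J : Finset ℕ) (Φ : Finset ℕ) : Prop :=
  (∀ i ∈ J, ∀ j ∈ J, i ≠ j → (Φ ∩ A.P i j).Nonempty) ∧
  ∀ i ∈ J, ∀ j ∈ J, ∀ k ∈ J, i ≠ j → i ≠ k → j ≠ k →
    (A.ecount (Φ ∩ A.P i j) (Φ ∩ A.P i k) (Φ ∩ A.P j k) : ℝ) ≤
      μ * (((A.P i j).card : ℝ) * ((A.P i k).card : ℝ) * ((A.P j k).card : ℝ))

/-- `Φ` is a `(μ, ϑ)`-hole on `J` (a `μ`-hole of width at least `ϑ`). -/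
def IsHoleW (μ ϑ : ℝ) (J : Finset ℕ) (Φ : Finset ℕ) : Prop :=
  A.IsHole μ J Φ ∧ ∀ i ∈ J, ∀ j ∈ J, i ≠ j →
    ϑ * ((A.P i j).card : ℝ) ≤ (((Φ ∩ A.P i j)).card : ℝ)

/-- Two holes are `ε`-intersecting on `J`. -/
def HolesIntersecting (ε : ℝ) (J : Finset ℕ) (Φ Ψ : Finset ℕ) : Prop :=
  ∀ i ∈ J, ∀ j ∈ J, i ≠ j →
    ε * ((A.P i j).card : ℝ) ≤ ((Φ ∩ Ψ ∩ A.P i j).card : ℝ)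

/-- Two holes are `ε`-disjoint on `J`. -/
def HolesDisjoint (ε : ℝ) (J : Finset ℕ) (Φ Ψ : Finset ℕ) : Prop :=
  ∀ i ∈ J, ∀ j ∈ J, i ≠ j →
    ((Φ ∩ Ψ ∩ A.P i j).card : ℝ) < ε * ((A.P i j).card : ℝ)

/-- The link on `K` of the family `k ↦ f k`, where `f k` is a vertex in a class `P k ·`:
`⋃_{k ≠ k' ∈ K} N(f k, f k')`. -/
def link (K : Finset ℕ) (f : ℕ → ℕ) : Finset ℕ :=
  ((K ×ˢ K).filter fun p => p.1 ≠ p.2).biUnion fun p => A.nbhd p.1 p.2 (f p.1) (f p.2)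

/-- The pair consisting of a transversal `T` on `Sh × B` and a transversal `U` on `Sh × C`
has `δ`-intersecting links. -/
def IntersectingLinks (δ : ℝ) (Sh B C : Finset ℕ) (T U : ℕ → ℕ → ℕ) : Prop :=
  ∀ a ∈ Sh, ∀ a' ∈ Sh, a ≠ a' → ∀ b ∈ B, ∀ c ∈ C,
    δ * ((A.P a a').card : ℝ) ≤
      (((A.nbhd a a' (T a b) (T a' b)) ∩ (A.nbhd a a' (U a c) (U a' c))).card : ℝ)

/-- The pair consisting of a transversal `T` on `Sh × B` and a transversal `U` on `Sh × C`
has `δ`-disjoint links. -/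
def DisjointLinks (δ : ℝ) (Sh B C : Finset ℕ) (T U : ℕ → ℕ → ℕ) : Prop :=
  ∀ a ∈ Sh, ∀ a' ∈ Sh, a ≠ a' → ∀ b ∈ B, ∀ c ∈ C,
    (((A.nbhd a a' (T a b) (T a' b)) ∩ (A.nbhd a a' (U a c) (U a' c))).card : ℝ) <
      δ * ((A.P a a').card : ℝ)

/-- A bicolouring of the reduced hypergraph: both colours appear in every vertex class and
no edge is monochromatic. -/
def IsBicolouring (φ : ℕ → Bool) : Prop :=
  (∀ i ∈ A.I, ∀ j ∈ A.I, i ≠ j →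
    (∃ v ∈ A.P i j, φ v = true) ∧ (∃ v ∈ A.P i j, φ v = false)) ∧
  ∀ a b c, A.Edge a b c → ¬ (φ a = φ b ∧ φ b = φ c)

/-- The minimum monochromatic codegree density is at least `x`: `τ₂(A, φ) ≥ x`. -/
def Tau2Ge (φ : ℕ → Bool) (x : ℝ) : Prop :=
  ∀ i j k, i ∈ A.I → j ∈ A.I → k ∈ A.I → i ≠ j → i ≠ k → j ≠ k →
    ∀ a ∈ A.P i j, ∀ b ∈ A.P i k, φ a = φ b →
      x * ((A.P j k).card : ℝ) ≤ ((A.nbhd j k a b).card : ℝ)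

/-- The `γ`-bad left cherries (both vertices in one hole, many neighbours outside
the other hole). -/
def badLeft (Φ Ψ : Finset ℕ) (γ : ℝ) (i j k : ℕ) : Finset (ℕ × ℕ) :=
  (A.P i j ×ˢ A.P i k).filter fun p =>
    (p.1 ∈ Φ ∧ p.2 ∈ Φ ∧ γ * ((A.P j k).card : ℝ) ≤ (((A.nbhd j k p.1 p.2) \ Ψ).card : ℝ)) ∨
    (p.1 ∈ Ψ ∧ p.2 ∈ Ψ ∧ γ * ((A.P j k).card : ℝ) ≤ (((A.nbhd j k p.1 p.2) \ Φ).card : ℝ))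

/-- The `γ`-bad middle cherries. -/
def badMid (Φ Ψ : Finset ℕ) (γ : ℝ) (i j k : ℕ) : Finset (ℕ × ℕ) :=
  (A.P i j ×ˢ A.P j k).filter fun p =>
    (p.1 ∈ Φ ∧ p.2 ∈ Φ ∧ γ * ((A.P i k).card : ℝ) ≤ (((A.nbhd i k p.1 p.2) \ Ψ).card : ℝ)) ∨
    (p.1 ∈ Ψ ∧ p.2 ∈ Ψ ∧ γ * ((A.P i k).card : ℝ) ≤ (((A.nbhd i k p.1 p.2) \ Φ).card : ℝ))

/-- The `γ`-bad right cherries. -/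
def badRight (Φ Ψ : Finset ℕ) (γ : ℝ) (i j k : ℕ) : Finset (ℕ × ℕ) :=
  (A.P i k ×ˢ A.P j k).filter fun p =>
    (p.1 ∈ Φ ∧ p.2 ∈ Φ ∧ γ * ((A.P i j).card : ℝ) ≤ (((A.nbhd i j p.1 p.2) \ Ψ).card : ℝ)) ∨
    (p.1 ∈ Ψ ∧ p.2 ∈ Ψ ∧ γ * ((A.P i j).card : ℝ) ≤ (((A.nbhd i j p.1 p.2) \ Φ).card : ℝ))

end ReducedHG



def ind (p : Prop) : ℝ := if p then 1 else 0
def ex {α : Type} [Fintype α] (f : α → ℝ) : ℝ := (∑ x, f x) / (Fintype.card α : ℝ)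
def pr {α : Type} [Fintype α] (p : α → Prop) : ℝ := ex (fun x => ind (p x))

theorem ind_t {p : Prop} (h : p) : ind p = 1 := by simp [ind, h]
theorem ind_f {p : Prop} (h : ¬ p) : ind p = 0 := by simp [ind, h]
theorem ind_nonneg (p : Prop) : 0 ≤ ind p := by unfold ind; split_ifs <;> norm_num
theorem ind_le_one (p : Prop) : ind p ≤ 1 := by unfold ind; split_ifs <;> norm_num
theorem ind_mono {p q : Prop} (h : p → q) : ind p ≤ ind q := by
  unfold ind; by_cases p <;> by_cases q <;> simp_all
theorem ind_and (p q : Prop) : ind (p ∧ q) = ind p * ind q := by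
  unfold ind; by_cases p <;> by_cases q <;> simp_all
theorem ind_or_le (p q : Prop) : ind (p ∨ q) ≤ ind p + ind q := by
  unfold ind; by_cases p <;> by_cases q <;> simp_all
theorem ind_not (p : Prop) : ind (¬ p) = 1 - ind p := by
  unfold ind; by_cases p <;> simp_all
theorem ind_congr {p q : Prop} (h : p ↔ q) : ind p = ind q := by rw [propext h]

section basics
variable {α β : Type} [Fintype α] [Fintype β]

theorem card_pos' (α : Type) [Fintype α] [Nonempty α] : (0:ℝ) < (Fintype.card α : ℝ) := by
  exact_mod_cast Fintype.card_pos

theorem ex_mono {f g : α → ℝ} (h : ∀ x, f x ≤ g x) : ex f ≤ ex g := by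
  unfold ex; gcongr with x; exact h x
theorem ex_nonneg {f : α → ℝ} (h : ∀ x, 0 ≤ f x) : 0 ≤ ex f := by
  unfold ex; exact div_nonneg (Finset.sum_nonneg fun x _ => h x) (Nat.cast_nonneg _)
theorem ex_const [Nonempty α] (c : ℝ) : ex (fun _ : α => c) = c := by
  unfold ex; have := card_pos' α; simp
theorem ex_add (f g : α → ℝ) : ex (fun x => f x + g x) = ex f + ex g := by
  unfold ex; rw [Finset.sum_add_distrib, add_div]
theorem ex_sub (f g : α → ℝ) : ex (fun x => f x - g x) = ex f - ex g := by
  unfold ex; rw [Finset.sum_sub_distrib, sub_div]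
theorem ex_mul (c : ℝ) (f : α → ℝ) : ex (fun x => c * f x) = c * ex f := by
  unfold ex; rw [← Finset.mul_sum, mul_div_assoc]
theorem ex_mul' (c : ℝ) (f : α → ℝ) : ex (fun x => f x * c) = ex f * c := by
  rw [mul_comm, ← ex_mul]; simp only [mul_comm]
theorem ex_sum {γ : Type} (s : Finset γ) (f : γ → α → ℝ) :
    ex (fun x => ∑ c ∈ s, f c x) = ∑ c ∈ s, ex (f c) := by
  unfold ex; rw [Finset.sum_comm, Finset.sum_div]
theorem ex_comm (f : α → β → ℝ) : ex (fun x => ex (f x)) = ex (fun y => ex (fun x => f x y)) := by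
  unfold ex; rw [← Finset.sum_div, ← Finset.sum_div, Finset.sum_comm, div_div, div_div, mul_comm]
theorem ex_prod (f : α × β → ℝ) : ex f = ex (fun x => ex (fun y => f (x, y))) := by
  unfold ex; rw [Fintype.sum_prod_type, Fintype.card_prod, ← Finset.sum_div, div_div]
  push_cast; rw [mul_comm]
theorem ex_equiv (e : α ≃ β) (f : β → ℝ) : ex (fun x => f (e x)) = ex f := by
  unfold ex; rw [Fintype.card_congr e, Equiv.sum_comp e f]
theorem ex_exists_le [Nonempty α] (f : α → ℝ) : ∃ x, ex f ≤ f x := by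
  by_contra h; push Not at h
  have : ∑ x, f x < ∑ x : α, ex f := Finset.sum_lt_sum_of_nonempty univ_nonempty (fun x _ => h x)
  have hc := card_pos' α
  simp only [Finset.sum_const, Finset.card_univ, nsmul_eq_mul, ex] at this
  field_simp at this; linarith
theorem ex_exists_ge [Nonempty α] (f : α → ℝ) : ∃ x, f x ≤ ex f := by
  obtain ⟨x, hx⟩ := ex_exists_le (fun x => (-1) * f x)
  rw [ex_mul] at hx; exact ⟨x, by linarith⟩
theorem ex_le_one [Nonempty α] {f : α → ℝ} (h : ∀ x, f x ≤ 1) : ex f ≤ 1 := by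
  have := ex_mono h; rwa [ex_const] at this
theorem le_ex_of [Nonempty α] {f : α → ℝ} {c : ℝ} (h : ∀ x, c ≤ f x) : c ≤ ex f := by
  have := ex_mono h; rwa [ex_const] at this
theorem ex_le_of [Nonempty α] {f : α → ℝ} {c : ℝ} (h : ∀ x, f x ≤ c) : ex f ≤ c := by
  have := ex_mono h; rwa [ex_const] at this

theorem pr_mono {p q : α → Prop} (h : ∀ x, p x → q x) : pr p ≤ pr q :=
  ex_mono fun x => ind_mono (h x)
theorem pr_nonneg (p : α → Prop) : 0 ≤ pr p := ex_nonneg fun _ => ind_nonneg _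
theorem pr_le_one [Nonempty α] (p : α → Prop) : pr p ≤ 1 := ex_le_one fun _ => ind_le_one _
theorem pr_true [Nonempty α] {p : α → Prop} (h : ∀ x, p x) : pr p = 1 := by
  unfold pr; simp only [ind_t (h _)]; exact ex_const 1
theorem pr_false {p : α → Prop} (h : ∀ x, ¬ p x) : pr p = 0 := by
  unfold pr; simp only [ind_f (h _)]; simp [ex]
theorem pr_not [Nonempty α] (p : α → Prop) : pr (fun x => ¬ p x) = 1 - pr p := by
  unfold pr; simp only [ind_not]; rw [ex_sub, ex_const]
theorem pr_or_le (p q : α → Prop) : pr (fun x => p x ∨ q x) ≤ pr p + pr q := by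
  unfold pr; rw [← ex_add]; exact ex_mono fun x => ind_or_le _ _
theorem pr_exists {p : α → Prop} (h : 0 < pr p) : ∃ x, p x := by
  by_contra hh; push Not at hh; rw [pr_false hh] at h; exact lt_irrefl _ h
theorem pr_congr {p q : α → Prop} (h : ∀ x, p x ↔ q x) : pr p = pr q := by
  have : p = q := funext fun x => propext (h x)
  rw [this]
theorem markov {f : α → ℝ} (hf : ∀ x, 0 ≤ f x) {θ : ℝ} (hθ : 0 < θ) :
    pr (fun x => θ ≤ f x) ≤ ex f / θ := by
  rw [le_div_iff₀ hθ, mul_comm]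
  unfold pr; rw [← ex_mul]
  refine ex_mono fun x => ?_
  by_cases h : θ ≤ f x
  · rw [ind_t h]; simpa using h
  · rw [ind_f h]; simpa using hf x
/-- split: pr p ≤ pr (p ∧ q) + pr (p ∧ ¬q) -/
theorem pr_split (p q : α → Prop) : pr p = pr (fun x => p x ∧ q x) + pr (fun x => p x ∧ ¬ q x) := by
  unfold pr; rw [← ex_add]; congr 1; funext x
  unfold ind; by_cases p x <;> by_cases q x <;> simp_all
theorem pr_inter_pos [Nonempty α] {p q : α → Prop} (h : 1 < pr p + pr q) : ∃ x, p x ∧ q x := by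
  by_contra hh; push Not at hh
  have : pr p ≤ pr (fun x => ¬ q x) := pr_mono hh
  rw [pr_not] at this; linarith
theorem pr_inter_pos3 [Nonempty α] {p q r : α → Prop} (h : 2 < pr p + pr q + pr r) :
    ∃ x, p x ∧ q x ∧ r x := by
  have h1 : pr p ≤ pr (fun x => p x ∧ q x) + pr (fun x => ¬ q x) := by
    rw [pr_split p q]; gcongr; exact pr_mono fun x hx => hx.2
  rw [pr_not] at h1
  obtain ⟨x, hx, h3⟩ := pr_inter_pos (p := fun x => p x ∧ q x) (q := r) (by linarith)
  exact ⟨x, hx.1, hx.2, h3⟩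
theorem inter3 [Nonempty α] (A B C : α → Prop) :
    pr A + pr B + pr C - 1 - pr (fun x => A x ∧ C x) - pr (fun x => B x ∧ C x)
      ≤ pr (fun x => A x ∧ B x) := by
  have h1 : ex (fun _ : α => (1:ℝ)) = 1 := ex_const 1
  rw [← h1]; unfold pr
  rw [← ex_add, ← ex_add, ← ex_sub, ← ex_sub, ← ex_sub]
  refine ex_mono fun x => ?_
  unfold ind
  by_cases hA : A x <;> by_cases hB : B x <;> by_cases hC : C x <;> simp [hA, hB, hC]
/-- sum of probabilities more than 1 gives two sharing a point -/
theorem two_share [Nonempty α] {γ : Type} (s : Finset γ) (p : γ → α → Prop)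
    (h : 1 < ∑ c ∈ s, pr (p c)) : ∃ x, ∃ c ∈ s, ∃ d ∈ s, c ≠ d ∧ p c x ∧ p d x := by
  unfold pr at h; rw [← ex_sum] at h
  obtain ⟨x, hx⟩ := ex_exists_le (fun x => ∑ c ∈ s, ind (p c x))
  have h1 : (1:ℝ) < ((s.filter (fun c => p c x)).card : ℝ) := by
    refine lt_of_lt_of_le h (hx.trans (le_of_eq ?_))
    unfold ind; simp
  have h2 : 1 < (s.filter (fun c => p c x)).card := by exact_mod_cast h1
  obtain ⟨c, hc, d, hd, hcd⟩ := Finset.one_lt_card.1 h2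
  simp only [Finset.mem_filter] at hc hd
  exact ⟨x, c, hc.1, d, hd.1, hcd, hc.2, hd.2⟩
end basics

theorem ex_pi_prod {γ : Type} [Fintype γ] [DecidableEq γ] {W : γ → Type} [∀ c, Fintype (W c)]
    (f : ∀ c, W c → ℝ) : ex (fun w : (∀ c, W c) => ∏ c, f c (w c)) = ∏ c, ex (f c) := by
  unfold ex
  rw [Finset.prod_div_distrib, Finset.prod_univ_sum, Fintype.card_pi, Fintype.piFinset_univ]
  push_cast; rfl

theorem ex_update {γ : Type} [Fintype γ] [DecidableEq γ] {W : γ → Type} [∀ c, Fintype (W c)]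
    (a : γ) [Nonempty (W a)] (G : (∀ c, W c) → ℝ) :
    ex (fun f => ex (fun x => G (Function.update f a x))) = ex G := by
  rw [← ex_prod (fun p : (∀ c, W c) × W a => G (Function.update p.1 a p.2))]
  let e : ((∀ c, W c) × W a) ≃ ((∀ c, W c) × W a) :=
    { toFun := fun p => (Function.update p.1 a p.2, p.1 a)
      invFun := fun p => (Function.update p.1 a p.2, p.1 a)
      left_inv := fun p => by simp
      right_inv := fun p => by simp }
  have := ex_equiv e (fun p => G p.1)
  simp only [e, Equiv.coe_fn_mk] at this
  rw [this, ex_prod]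
  simp [ex_const]

theorem ex_coord {γ : Type} [Fintype γ] [DecidableEq γ] {W : γ → Type} [∀ c, Fintype (W c)] [∀ c, Nonempty (W c)]
    (a : γ) (g : W a → ℝ) : ex (fun f : (∀ c, W c) => g (f a)) = ex g := by
  rw [← ex_update a (fun f => g (f a))]
  simp [ex_const]

theorem wselect {V κ γ : Type} [Fintype V] [Nonempty V] (C : Finset γ) (K : Finset κ)
    (S : γ → κ → V → Prop) {ρ : ℝ} (hρ : 0 ≤ ρ) (h : ∀ c ∈ C, ∀ k ∈ K, ρ ≤ pr (S c k)) :
    ∃ w : γ → V, ∃ K' ⊆ K, ρ ^ C.card * (K.card : ℝ) ≤ (K'.card : ℝ) ∧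
      ∀ k ∈ K', ∀ c ∈ C, S c k (w c) := by
  suffices hs : ∃ w : γ → V, ρ ^ C.card * (K.card : ℝ) ≤
      ((K.filter fun k => ∀ c ∈ C, S c k (w c)).card : ℝ) by
    obtain ⟨w, hw⟩ := hs
    exact ⟨w, _, Finset.filter_subset _ _, hw, fun k hk => (Finset.mem_filter.1 hk).2⟩
  have key : ρ ^ C.card * (K.card : ℝ) ≤
      ex (fun w : C → V => ∑ k ∈ K, ∏ c : C, ind (S c k (w c))) := by
    rw [ex_sum, mul_comm, ← nsmul_eq_mul, ← Finset.sum_const]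
    refine Finset.sum_le_sum fun k hk => ?_
    rw [ex_pi_prod (fun (c : C) x => ind (S c k x))]
    have : ρ ^ C.card = ∏ c : C, ρ := by simp
    rw [this]
    exact Finset.prod_le_prod (fun _ _ => hρ) fun c _ => h c c.2 k hk
  obtain ⟨w, hw⟩ := ex_exists_le (fun w : C → V => ∑ k ∈ K, ∏ c : C, ind (S c k (w c)))
  have v0 : V := Classical.arbitrary V
  refine ⟨fun c => if hc : c ∈ C then w ⟨c, hc⟩ else v0, key.trans (hw.trans (le_of_eq ?_))⟩
  rw [Finset.card_filter]; push_cast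
  refine Finset.sum_congr rfl fun k _ => ?_
  by_cases hh : ∀ c : C, S c k (w c)
  · rw [if_pos, Finset.prod_eq_one]
    · intro c _; exact ind_t (hh c)
    · intro c hc; simp [hc]; exact hh ⟨c, hc⟩
  · rw [if_neg]
    · push Not at hh; obtain ⟨c, hc⟩ := hh
      exact Finset.prod_eq_zero (Finset.mem_univ c) (ind_f hc)
    · intro h2; apply hh; intro c; have := h2 c c.2; simpa using this

/-! palettes -/
structure Pal (ι V : Type) where
  E : ι → ι → ι → V → V → V → Prop
  ne : ∀ i j k u v w, E i j k u v w → i ≠ j ∧ i ≠ k ∧ j ≠ k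
  s1 : ∀ i j k u v w, E i j k u v w → E j i k u w v
  s2 : ∀ i j k u v w, E i j k u v w → E i k j v u w

namespace Pal

theorem s1i {ι V : Type} {P : Pal ι V} {i j k u v w} : P.E i j k u v w ↔ P.E j i k u w v := ⟨P.s1 _ _ _ _ _ _, P.s1 _ _ _ _ _ _⟩
theorem s2i {ι V : Type} {P : Pal ι V} {i j k u v w} : P.E i j k u v w ↔ P.E i k j v u w := ⟨P.s2 _ _ _ _ _ _, P.s2 _ _ _ _ _ _⟩

variable {ι V : Type} [Fintype V] [Nonempty V] (P : Pal ι V)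

def Dense (d : ℝ) : Prop := ∀ i j k, i ≠ j → i ≠ k → j ≠ k → ∀ u v, d ≤ pr (P.E i j k u v)
def Free : Prop := ∀ i₁ i₂ i₃ i₄ i₅ x₁₂ x₁₃ x₁₄ x₁₅ x₂₃ x₂₄ x₂₅ x₃₄ x₃₅ x₄₅,
  P.E i₁ i₂ i₃ x₁₂ x₁₃ x₂₃ → P.E i₁ i₂ i₄ x₁₂ x₁₄ x₂₄ → P.E i₁ i₂ i₅ x₁₂ x₁₅ x₂₅ →
  P.E i₁ i₃ i₄ x₁₃ x₁₄ x₃₄ → P.E i₁ i₃ i₅ x₁₃ x₁₅ x₃₅ → P.E i₁ i₄ i₅ x₁₄ x₁₅ x₄₅ →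
  P.E i₂ i₃ i₄ x₂₃ x₂₄ x₃₄ → P.E i₂ i₃ i₅ x₂₃ x₂₅ x₃₅ → P.E i₂ i₄ i₅ x₂₄ x₂₅ x₄₅ →
  P.E i₃ i₄ i₅ x₃₄ x₃₅ x₄₅ → False

end Pal



theorem ramsey2 (n : ℕ) : ∀ s t : ℕ, s + t = n → ∃ N : ℕ, ∀ (α : Type) (S : Finset α), N ≤ S.card →
    ∀ r : α → α → Prop, (∀ x y, r x y → r y x) →
    (∃ T ⊆ S, T.card = s ∧ ∀ x ∈ T, ∀ y ∈ T, x ≠ y → r x y) ∨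
    (∃ T ⊆ S, T.card = t ∧ ∀ x ∈ T, ∀ y ∈ T, x ≠ y → ¬ r x y) := by
  induction n with
  | zero =>
    intro s t h
    exact ⟨0, fun α S _ r _ => Or.inl ⟨∅, by simp, by simp; omega, by simp⟩⟩
  | succ n ih =>
    intro s t h
    rcases Nat.eq_zero_or_pos s with hs | hs
    · exact ⟨0, fun α S _ r _ => Or.inl ⟨∅, by simp, by simp; omega, by simp⟩⟩
    rcases Nat.eq_zero_or_pos t with ht | ht
    · exact ⟨0, fun α S _ r _ => Or.inr ⟨∅, by simp, by simp; omega, by simp⟩⟩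
    obtain ⟨N1, h1⟩ := ih (s - 1) t (by omega)
    obtain ⟨N2, h2⟩ := ih s (t - 1) (by omega)
    refine ⟨N1 + N2 + 1, fun α S hS r hr => ?_⟩
    obtain ⟨x, hx⟩ : S.Nonempty := Finset.card_pos.1 (by omega)
    have hc : ((S.erase x).filter (r x)).card + ((S.erase x).filter (fun y => ¬ r x y)).card
        = S.card - 1 := by
      rw [Finset.card_filter_add_card_filter_not, Finset.card_erase_of_mem hx]
    rcases le_or_gt N1 ((S.erase x).filter (r x)).card with h | h
    · rcases h1 α _ h r hr with ⟨T, hT, hTc, hT2⟩ | ⟨T, hT, hTc, hT2⟩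
      · left
        have hxT : x ∉ T := fun hh => by have := hT hh; simp at this
        refine ⟨insert x T, ?_, ?_, ?_⟩
        · intro y hy; rcases Finset.mem_insert.1 hy with rfl | hy
          · exact hx
          · have := hT hy; simp at this; exact this.1.2
        · rw [Finset.card_insert_of_notMem hxT]; omega
        · intro y hy z hz hyz
          rcases Finset.mem_insert.1 hy with hy' | hy' <;> rcases Finset.mem_insert.1 hz with hz' | hz'
          · exact absurd (hy'.trans hz'.symm) hyz
          · have := hT hz'; simp at this; rw [hy']; exact this.2
          · have := hT hy'; simp at this; rw [hz']; exact hr _ _ this.2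
          · exact hT2 y hy' z hz' hyz
      · right; exact ⟨T, fun y hy => by have := hT hy; simp at this; exact this.1.2, hTc, hT2⟩
    · rcases h2 α ((S.erase x).filter (fun y => ¬ r x y)) (by omega) r hr with
        ⟨T, hT, hTc, hT2⟩ | ⟨T, hT, hTc, hT2⟩
      · left; exact ⟨T, fun y hy => by have := hT hy; simp at this; exact this.1.2, hTc, hT2⟩
      · right
        have hxT : x ∉ T := fun hh => by have := hT hh; simp at this
        refine ⟨insert x T, ?_, ?_, ?_⟩
        · intro y hy; rcases Finset.mem_insert.1 hy with rfl | hy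
          · exact hx
          · have := hT hy; simp at this; exact this.1.2
        · rw [Finset.card_insert_of_notMem hxT]; omega
        · intro y hy z hz hyz
          rcases Finset.mem_insert.1 hy with hy' | hy' <;> rcases Finset.mem_insert.1 hz with hz' | hz'
          · exact absurd (hy'.trans hz'.symm) hyz
          · have := hT hz'; simp at this; rw [hy']; exact this.2
          · have := hT hy'; simp at this; rw [hz']; exact fun h => this.2 (hr _ _ h)
          · exact hT2 y hy' z hz' hyz

theorem ramseyk (n0 t : ℕ) : ∀ k : ℕ, ∃ N : ℕ, ∀ (α β : Type) (S : Finset α) (B : Finset β),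
    N ≤ S.card → B.card = k → ∀ bad : β → α → α → Prop, (∀ b x y, bad b x y → bad b y x) →
    (∀ b ∈ B, ∀ S0 ⊆ S, S0.card = n0 → ∃ x ∈ S0, ∃ y ∈ S0, x ≠ y ∧ ¬ bad b x y) →
    ∃ T ⊆ S, T.card = t ∧ ∀ x ∈ T, ∀ y ∈ T, x ≠ y → ∀ b ∈ B, ¬ bad b x y := by
  intro k
  induction k with
  | zero =>
    refine ⟨t, fun α β S B hS hB bad _ _ => ?_⟩
    obtain ⟨T, hT, hTc⟩ := Finset.exists_subset_card_eq hS
    rw [Finset.card_eq_zero] at hB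
    exact ⟨T, hT, hTc, by simp [hB]⟩
  | succ k ih =>
    obtain ⟨N1, h1⟩ := ih
    obtain ⟨N, h2⟩ := ramsey2 (n0 + N1) n0 N1 rfl
    refine ⟨N, fun α β S B hS hB bad hsym hbad => ?_⟩
    obtain ⟨b, hb⟩ : B.Nonempty := Finset.card_pos.1 (by omega)
    rcases h2 α S hS (bad b) (hsym b) with ⟨T, hT, hTc, hT2⟩ | ⟨T, hT, hTc, hT2⟩
    · obtain ⟨x, hx, y, hy, hxy, hn⟩ := hbad b hb T hT hTc
      exact absurd (hT2 x hx y hy hxy) hn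
    · obtain ⟨T', hT', hc, h3⟩ := h1 α β T (B.erase b) (by omega)
        (by rw [Finset.card_erase_of_mem hb]; omega) bad hsym
        (fun b' hb' S0 hS0 h => hbad b' (Finset.mem_of_mem_erase hb') S0 (hS0.trans hT) h)
      refine ⟨T', hT'.trans hT, hc, fun x hx y hy hxy b' hb' => ?_⟩
      by_cases hbb : b' = b
      · subst hbb; exact hT2 x (hT' hx) y (hT' hy) hxy
      · exact h3 x hx y hy hxy b' (Finset.mem_erase.2 ⟨hbb, hb'⟩)

section
variable {ι V : Type} [Fintype V] [Nonempty V] {P : Pal ι V}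

theorem core2 (hf : P.Free) {α β : Type} (A : Finset α) (B : Finset β) (kk : α → ι) (ll : β → ι)
    (m : ι) (q : α → β → V) (r : α → V) (s : β → V)
    (h : ∀ a ∈ A, ∀ b ∈ B, P.E (kk a) (ll b) m (q a b) (r a) (s b)) {ρ : ℝ} (hρ : 0 ≤ ρ)
    (h2 : ∀ a ∈ A, ∀ a' ∈ A, a ≠ a' → ∀ b ∈ B, ρ ≤ pr (fun w =>
      P.E (kk a) (kk a') (ll b) w (q a b) (q a' b) ∧ P.E (kk a) (kk a') m w (r a) (r a')))
    (hB : 1 < ρ ^ A.offDiag.card * (B.card : ℝ)) :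
    ∃ b ∈ B, ∃ b' ∈ B, b ≠ b' ∧ ∑ a ∈ A, pr (fun v =>
      P.E (kk a) (ll b) (ll b') (q a b) (q a b') v ∧ P.E (ll b) (ll b') m v (s b) (s b')) ≤ 1 := by
  obtain ⟨w, K', hK', hw, hwS⟩ := wselect A.offDiag B (fun c b w =>
    P.E (kk c.1) (kk c.2) (ll b) w (q c.1 b) (q c.2 b) ∧ P.E (kk c.1) (kk c.2) m w (r c.1) (r c.2))
    hρ (by
      rintro ⟨a, a'⟩ hc b hb
      rw [Finset.mem_offDiag] at hc
      exact h2 a hc.1 a' hc.2.1 hc.2.2 b hb)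
  have h1 := hB.trans_le hw
  have h1' := Finset.one_lt_card.1 (by exact_mod_cast h1)
  obtain ⟨b, hb, b', hb', hbb⟩ := h1'
  replace hb := And.intro (hK' hb) (hwS b hb)
  replace hb' := And.intro (hK' hb') (hwS b' hb')
  refine ⟨b, hb.1, b', hb'.1, hbb, ?_⟩
  by_contra hcon; push Not at hcon
  obtain ⟨v, a, ha, a', ha', haa, ⟨hv1, hv2⟩, hv3, hv4⟩ := two_share A _ hcon
  have e := hb.2 (a, a') (Finset.mem_offDiag.2 ⟨ha, ha', haa⟩)
  have e' := hb'.2 (a, a') (Finset.mem_offDiag.2 ⟨ha, ha', haa⟩)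
  exact hf _ _ _ _ _ _ _ _ _ _ _ _ _ _ _ e.1 e'.1 e.2 hv1 (h a ha b hb.1) (h a ha b' hb'.1)
    hv3 (h a' ha' b hb.1) (h a' ha' b' hb'.1) hv2

/-- density of a triple of vertex sets -/
def tri (P : Pal ι V) (i j k : ι) (A B C : V → Prop) : ℝ :=
  ex fun u => ex fun v => ex fun w => ind (A u ∧ B v ∧ C w ∧ P.E i j k u v w)

theorem tri_eq_pr (i j k : ι) (A B C : V → Prop) :
    tri P i j k A B C = pr (fun x : V × V × V => A x.1 ∧ B x.2.1 ∧ C x.2.2 ∧ P.E i j k x.1 x.2.1 x.2.2) := by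
  unfold tri pr; rw [ex_prod]; congr 1; funext u; rw [ex_prod]

/-- link holes -/
theorem d1 (hf : P.Free) (hd : P.Dense (1/3)) {α β : Type} (L : Finset β) (K : Finset α)
    (ll : β → ι) (kk : α → ι) (hL : Set.InjOn ll L)
    (hLK : ∀ b ∈ L, ∀ a ∈ K, ll b ≠ kk a) (q : β → α → V) :
    ∃ K' ⊆ K, (1/3:ℝ) ^ L.offDiag.card * (K.card : ℝ) ≤ K'.card ∧
      ∀ a ∈ K', ∀ a' ∈ K', ∀ a'' ∈ K',
        ∑ b ∈ L, tri P (kk a) (kk a') (kk a'') (P.E (ll b) (kk a) (kk a') (q b a) (q b a'))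
          (P.E (ll b) (kk a) (kk a'') (q b a) (q b a''))
          (P.E (ll b) (kk a') (kk a'') (q b a') (q b a'')) ≤ 1 := by
  obtain ⟨w, K', hK', hw, hwS⟩ := wselect L.offDiag K (fun c a w =>
    P.E (ll c.1) (ll c.2) (kk a) w (q c.1 a) (q c.2 a)) (ρ := 1/3) (by norm_num) (by
      rintro ⟨b, b'⟩ hc a ha
      rw [Finset.mem_offDiag] at hc
      refine (hd (kk a) (ll b) (ll b') (hLK b hc.1 a ha).symm (hLK b' hc.2.1 a ha).symm
        (fun h => hc.2.2 (hL hc.1 hc.2.1 h)) (q b a) (q b' a)).trans (pr_mono fun w hw => ?_)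
      exact Pal.s2i.1 (Pal.s1i.1 (Pal.s2i.1 (Pal.s1i.1 (Pal.s2i.1 (Pal.s1i.1 (Pal.s2i.1 (Pal.s1i.1 hw))))))))
  refine ⟨K', hK', hw, ?_⟩
  intro a ha a' ha' a'' ha''
  by_contra hcon; push Not at hcon
  simp only [tri_eq_pr] at hcon
  obtain ⟨⟨x, y, z⟩, b, hb, b', hb', hbb, ⟨h1, h2, h3, h4⟩, h5, h6, h7, h8⟩ := two_share L _ hcon
  have hm : (b, b') ∈ L.offDiag := Finset.mem_offDiag.2 ⟨hb, hb', hbb⟩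
  exact hf _ _ _ _ _ _ _ _ _ _ _ _ _ _ _ (hwS a ha _ hm) (hwS a' ha' _ hm) (hwS a'' ha'' _ hm) h1 h2 h3 h5 h6 h7 h4
end



theorem ex_pow_le {α : Type} [Fintype α] [Nonempty α] {g : α → ℝ} (hg : ∀ x, 0 ≤ g x) (t : ℕ) :
    (ex g) ^ t ≤ ex (fun x => g x ^ t) := by
  have hc := card_pos' α
  have := Real.pow_arith_mean_le_arith_mean_pow (Finset.univ : Finset α)
    (fun _ => 1 / (Fintype.card α : ℝ)) g (fun _ _ => by positivity)
    (by simp) (fun x _ => hg x) t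
  simp only [one_div, ← Finset.mul_sum] at this
  simpa only [ex, div_eq_inv_mul] using this

theorem pr_all {Y : Type} [Fintype Y] (p : Y → Prop) (t : ℕ) :
    pr (fun y : Fin t → Y => ∀ c, p (y c)) = (pr p) ^ t := by
  have := ex_pi_prod (γ := Fin t) (W := fun _ => Y) (fun _ y => ind (p y))
  simp only [Finset.prod_const, Finset.card_univ, Fintype.card_fin] at this
  unfold pr; rw [← this]; congr 1; funext y
  by_cases h : ∀ c, p (y c)
  · rw [ind_t h, Finset.prod_eq_one]; intro c _; exact ind_t (h c)
  · rw [ind_f h]; push Not at h; obtain ⟨c, hc⟩ := h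
    exact (Finset.prod_eq_zero (Finset.mem_univ c) (ind_f hc)).symm

theorem blow {X Y : Type} [Fintype X] [Nonempty X] [Fintype Y] (p : X → Y → Prop) {μ : ℝ}
    (hμ : 0 ≤ μ) (h : μ ≤ ex fun x => pr (p x)) (t : ℕ) :
    μ ^ t ≤ ex fun x => pr (fun y : Fin t → Y => ∀ c, p x (y c)) := by
  simp only [pr_all]
  exact (pow_le_pow_left₀ hμ h t).trans (ex_pow_le (fun x => pr_nonneg _) t)

theorem ex_coord2 {γ W : Type} [Fintype γ] [DecidableEq γ] [Fintype W] [Nonempty W]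
    {a b : γ} (hab : a ≠ b) (G : W → W → ℝ) :
    ex (fun f : γ → W => G (f a) (f b)) = ex fun x => ex fun y => G x y := by
  rw [← ex_update (W := fun _ => W) a]
  simp only [Function.update_self, Function.update_of_ne hab.symm]
  rw [← ex_update (W := fun _ => W) b]
  simp only [Function.update_self]
  rw [ex_const, ex_comm]

theorem ex_coord3 {γ W : Type} [Fintype γ] [DecidableEq γ] [Fintype W] [Nonempty W]
    {a b c : γ} (hab : a ≠ b) (hac : a ≠ c) (hbc : b ≠ c) (G : W → W → W → ℝ) :
    ex (fun f : γ → W => G (f a) (f b) (f c)) = ex fun x => ex fun y => ex fun z => G x y z := by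
  rw [← ex_update (W := fun _ => W) a]
  simp only [Function.update_self, Function.update_of_ne hab.symm, Function.update_of_ne hac.symm]
  rw [ex_comm]; congr 1; funext x
  exact ex_coord2 hbc (G x)

theorem ex_rot {α β γ : Type} [Fintype α] [Fintype β] [Fintype γ] (f : α → β → γ → ℝ) :
    (ex fun a => ex fun b => ex fun c => f a b c) = ex fun c => ex fun a => ex fun b => f a b c := by
  rw [ex_comm (fun c a => ex fun b => f a b c)]
  congr 1; funext a; exact ex_comm _

theorem pr_eq_le {X : Type} [Fintype X] [Nonempty X] (x : X) :
    pr (fun y => x = y) = 1 / (Fintype.card X : ℝ) := by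
  unfold pr ex ind; simp

theorem pr_noninj {X : Type} [Fintype X] [Nonempty X] (t : ℕ) :
    pr (fun f : Fin t → X => ¬ Function.Injective f) ≤ (t:ℝ) ^ 2 / (Fintype.card X : ℝ) := by
  have h1 : pr (fun f : Fin t → X => ¬ Function.Injective f) ≤
      ex (fun f : Fin t → X => ∑ p ∈ (univ : Finset (Fin t)).offDiag, ind (f p.1 = f p.2)) := by
    refine ex_mono fun f => ?_
    by_cases h : Function.Injective f
    · rw [ind_f (not_not.2 h)]; exact Finset.sum_nonneg fun _ _ => ind_nonneg _
    · rw [ind_t h]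
      simp only [Function.Injective, not_forall] at h
      obtain ⟨a, b, hab, hne⟩ := h
      have := Finset.single_le_sum (f := fun p : Fin t × Fin t => ind (f p.1 = f p.2))
        (s := (univ : Finset (Fin t)).offDiag) (fun _ _ => ind_nonneg _) (a := (a, b))
        (by simp [hne])
      simp only at this
      rwa [ind_t hab] at this
  refine h1.trans ?_
  rw [ex_sum]
  have h2 : ∀ p ∈ (univ : Finset (Fin t)).offDiag,
      ex (fun f : Fin t → X => ind (f p.1 = f p.2)) = 1 / (Fintype.card X : ℝ) := by
    intro p hp
    have hp' : p.1 ≠ p.2 := by simpa using hp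
    rw [ex_coord2 hp' (fun x y => ind (x = y))]
    have : ∀ x : X, ex (fun y => ind (x = y)) = 1 / (Fintype.card X : ℝ) := fun x => pr_eq_le x
    simp only [this]; exact ex_const _
  rw [Finset.sum_congr rfl h2, Finset.sum_const, nsmul_eq_mul, div_eq_mul_one_div ((t:ℝ)^2)]
  have hc := card_pos' X
  gcongr
  rw [Finset.offDiag_card]; simp
  norm_cast; rw [sq]; omega

theorem box3 (t : ℕ) {μ : ℝ} (hμ : 0 < μ) : ∃ n : ℕ, 0 < n ∧ ∀ (X Y Z : Type) [Fintype X] [Fintype Y]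
    [Fintype Z] [Nonempty X] [Nonempty Y] [Nonempty Z], n ≤ Fintype.card X → n ≤ Fintype.card Y →
    n ≤ Fintype.card Z → ∀ p : X → Y → Z → Prop, μ ≤ (ex fun x => ex fun y => pr (p x y)) →
    ∃ (f : Fin t → X) (g : Fin t → Y) (h : Fin t → Z), Function.Injective f ∧ Function.Injective g ∧
      Function.Injective h ∧ ∀ a b c, p (f a) (g b) (h c) := by
  obtain ⟨n, hn⟩ := exists_nat_gt (3 * (t:ℝ)^2 / (((μ ^ t) ^ t) ^ t))
  have hm : 0 < ((μ ^ t) ^ t) ^ t := by positivity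
  have hn0 : (0:ℝ) < n := lt_of_le_of_lt (by positivity) hn
  refine ⟨n, by exact_mod_cast hn0, ?_⟩
  intro X Y Z _ _ _ _ _ _ hX hY hZ p hp
  have s1 := blow (X := X × Y) (Y := Z) (fun x z => p x.1 x.2 z) hμ.le
    (by rw [ex_prod]; exact hp) t
  have s2 := blow (X := X × (Fin t → Z)) (Y := Y) (fun x y => ∀ c, p x.1 y (x.2 c))
    (by positivity) (s1.trans (le_of_eq (by
      rw [ex_prod, ex_prod]; congr 1; funext x; unfold pr; rw [ex_comm]))) t
  have s3 := blow (X := (Fin t → Z) × (Fin t → Y)) (Y := X) (fun x y => ∀ b, ∀ c, p y (x.2 b) (x.1 c))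
    (by positivity) (s2.trans (le_of_eq (by
      rw [ex_prod, ex_prod, ex_comm]; congr 1; funext x; unfold pr; rw [ex_comm]))) t
  by_contra hcon
  have hle : (ex fun x : (Fin t → Z) × (Fin t → Y) =>
        pr fun y : Fin t → X => ∀ a, ∀ b, ∀ c, p (y a) (x.2 b) (x.1 c)) ≤
      pr (fun f : Fin t → X => ¬ Function.Injective f) + (pr (fun f : Fin t → Y => ¬ Function.Injective f)
        + pr (fun f : Fin t → Z => ¬ Function.Injective f)) := by
    have e1 : pr (fun f : Fin t → Y => ¬ Function.Injective f)
        + pr (fun f : Fin t → Z => ¬ Function.Injective f) = ex (fun x : (Fin t → Z) × (Fin t → Y) =>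
          ind (¬ Function.Injective x.2) + ind (¬ Function.Injective x.1)) := by
      rw [ex_add, ex_prod, ex_prod]; simp only [ex_const]; rfl
    have e2 : ∀ c : ℝ, c = ex (fun x : (Fin t → Z) × (Fin t → Y) => c) := fun c => (ex_const c).symm
    rw [e1, e2 (pr (fun f : Fin t → X => ¬ Function.Injective f)), ← ex_add]
    refine ex_mono fun x => ?_
    have e3 : ∀ c : ℝ, c = ex (fun x : (Fin t → X) => c) := fun c => (ex_const c).symm
    rw [e3 (ind (¬ Function.Injective x.2) + ind (¬ Function.Injective x.1))]
    unfold pr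
    rw [← ex_add]
    refine ex_mono fun f => ?_
    have := ind_nonneg (¬ Function.Injective f)
    have := ind_nonneg (¬ Function.Injective x.1)
    have := ind_nonneg (¬ Function.Injective x.2)
    by_cases h0 : ∀ a, ∀ b, ∀ c, p (f a) (x.2 b) (x.1 c)
    · rw [ind_t h0]
      by_cases h1 : Function.Injective f
      · by_cases h2 : Function.Injective x.1
        · by_cases h3 : Function.Injective x.2
          · exact absurd ⟨f, x.2, x.1, h1, h3, h2, h0⟩ hcon
          · rw [ind_t h3]; linarith
        · rw [ind_t h2]; linarith
      · rw [ind_t h1]; linarith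
    · rw [ind_f h0]; linarith
  have b : ∀ W : Type, ∀ [Fintype W] [Nonempty W], n ≤ Fintype.card W →
      pr (fun f : Fin t → W => ¬ Function.Injective f) ≤ (t:ℝ)^2 / n := by
    intro W _ _ hW
    refine (pr_noninj t).trans ?_
    gcongr
  have h1 := b X hX
  have h2 := b Y hY
  have h3 := b Z hZ
  have h4 : 3 * ((t:ℝ)^2 / n) < ((μ ^ t) ^ t) ^ t := by
    rw [div_lt_iff₀ hm] at hn
    rw [← mul_div_assoc, div_lt_iff₀ hn0]; linarith
  linarith

def d6 {ι V : Type} [Fintype ι] [Fintype V] (f : ι → ι → ι → V → V → V → Prop) : ℝ :=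
  ex fun i => ex fun j => ex fun k => ex fun u => ex fun v => ex fun w => ind (f i j k u v w)

theorem marg {ι V N : Type} [Fintype ι] [Fintype V] [Nonempty ι] [Nonempty V] [Fintype N] [DecidableEq N]
    (f : ι → ι → ι → V → V → V → Prop) {x y z : N} (hxy : x ≠ y) (hxz : x ≠ z) (hyz : y ≠ z) :
    ex (fun F : N → ι => ex fun C : Sym2 N → V =>
      ind (f (F x) (F y) (F z) (C s(x, y)) (C s(x, z)) (C s(y, z)))) = d6 f := by
  unfold d6
  rw [← ex_coord3 hxy hxz hyz]
  congr 1; funext F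
  refine ex_coord3 (a := s(x, y)) (b := s(x, z)) (c := s(y, z)) ?_ ?_ ?_
    (fun u v w => ind (f (F x) (F y) (F z) u v w))
  · simp; tauto
  · simp; tauto
  · simp; tauto

theorem sample (t : ℕ) {μ : ℝ} (hμ : 0 < μ) : ∃ η : ℝ, 0 < η ∧ ∀ (ι V : Type) [Fintype ι] [Fintype V]
    [Nonempty ι] [Nonempty V] (main forb : ι → ι → ι → V → V → V → Prop), μ ≤ d6 main → d6 forb ≤ η →
    ∃ (F : Fin 3 × Fin t → ι) (C : Sym2 (Fin 3 × Fin t) → V),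
      (∀ a b c, main (F (0, a)) (F (1, b)) (F (2, c)) (C s((0, a), (1, b))) (C s((0, a), (2, c)))
        (C s((1, b), (2, c)))) ∧
      ∀ x y z, x ≠ y → x ≠ z → y ≠ z →
        ¬ forb (F x) (F y) (F z) (C s(x, y)) (C s(x, z)) (C s(y, z)) := by
  obtain ⟨n, hn0, hn⟩ := box3 t (half_pos hμ)
  have : Nonempty (Fin n) := ⟨⟨0, hn0⟩⟩
  have hN : (0:ℝ) < ((3 * n : ℕ):ℝ) ^ 3 := by positivity
  refine ⟨μ / 2 / ((3 * n : ℕ):ℝ) ^ 3, by positivity, ?_⟩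
  intro ι V _ _ _ _ main forb hmain hforb
  have hne01 : ∀ a b : Fin n, ((0 : Fin 3), a) ≠ (1, b) := by simp
  have hne02 : ∀ a b : Fin n, ((0 : Fin 3), a) ≠ (2, b) := by simp
  have hne12 : ∀ a b : Fin n, ((1 : Fin 3), a) ≠ (2, b) := by simp
  let N := Fin 3 × Fin n
  let T : Finset (N × N × N) := univ.filter fun p => p.1 ≠ p.2.1 ∧ p.1 ≠ p.2.2 ∧ p.2.1 ≠ p.2.2
  let g (F : N → ι) (C : Sym2 N → V) (p : N × N × N) : ℝ :=
    ind (forb (F p.1) (F p.2.1) (F p.2.2) (C s(p.1, p.2.1)) (C s(p.1, p.2.2)) (C s(p.2.1, p.2.2)))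
  let m (F : N → ι) (C : Sym2 N → V) (a b c : Fin n) : Prop :=
    main (F (0, a)) (F (1, b)) (F (2, c)) (C s((0, a), (1, b))) (C s((0, a), (2, c)))
        (C s((1, b), (2, c)))
  let X (F : N → ι) (C : Sym2 N → V) : ℝ :=
    (ex fun a => ex fun b => pr fun c => m F C a b c) - ∑ p ∈ T, g F C p
  have hX : μ / 2 ≤ ex (fun F => ex fun C => X F C) := by
    have e1 : ex (fun F => ex fun C => X F C) =
        (ex fun F => ex fun C => ex fun a => ex fun b => pr fun c => m F C a b c) -
        (ex fun F => ex fun C => ∑ p ∈ T, g F C p) := by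
      simp only [X, ex_sub]
    have e2 : (ex fun F => ex fun C => ex fun a => ex fun b => pr fun c => m F C a b c) = d6 main := by
      have : ∀ a b c, (ex fun F => ex fun C => ind (m F C a b c)) = d6 main := by
        intro a b c
        exact marg main (hne01 a b) (hne02 a c) (hne12 b c)
      calc _ = ex fun a => ex fun F => ex fun C => ex fun b => pr fun c => m F C a b c := ex_rot _
        _ = ex fun a => ex fun b => ex fun F => ex fun C => pr fun c => m F C a b c :=
            congrArg ex (funext fun a => ex_rot _)
        _ = ex fun a => ex fun b => ex fun c => ex fun F => ex fun C => ind (m F C a b c) :=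
            congrArg ex (funext fun a => congrArg ex (funext fun b => ex_rot _))
        _ = d6 main := by simp only [this, ex_const]
    have e3 : (ex fun F => ex fun C => ∑ p ∈ T, g F C p) = ∑ p ∈ T, d6 forb := by
      simp only [ex_sum]
      refine Finset.sum_congr rfl fun p hp => ?_
      have := (Finset.mem_filter.1 hp).2
      exact marg forb this.1 this.2.1 this.2.2
    rw [e1, e2, e3, Finset.sum_const, nsmul_eq_mul]
    have hT : (T.card : ℝ) ≤ ((3 * n : ℕ):ℝ) ^ 3 := by
      have : T.card ≤ Fintype.card (N × N × N) := Finset.card_le_univ T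
      have h2 : Fintype.card (N × N × N) = (3 * n) ^ 3 := by simp [N]; ring
      rw [h2] at this; exact_mod_cast this
    have : (T.card : ℝ) * d6 forb ≤ μ / 2 := by
      calc (T.card : ℝ) * d6 forb ≤ T.card * (μ / 2 / ((3 * n : ℕ):ℝ) ^ 3) := by gcongr
        _ ≤ ((3 * n : ℕ):ℝ) ^ 3 * (μ / 2 / ((3 * n : ℕ):ℝ) ^ 3) := by gcongr
        _ = μ / 2 := by field_simp
    linarith
  obtain ⟨F, hF⟩ := ex_exists_le (fun F => ex fun C => X F C)
  obtain ⟨C, hC⟩ := ex_exists_le (fun C => X F C)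
  have hXX : μ / 2 ≤ X F C := hX.trans (hF.trans hC)
  have hg : 0 ≤ ∑ p ∈ T, g F C p := Finset.sum_nonneg fun _ _ => ind_nonneg _
  have h1 : (ex fun a => ex fun b => pr fun c => m F C a b c) ≤ 1 :=
    ex_le_one fun a => ex_le_one fun b => pr_le_one _
  have hd : μ / 2 ≤ (ex fun a => ex fun b => pr fun c => m F C a b c) := by
    simp only [X] at hXX; linarith
  obtain ⟨f, gg, h, hfi, hgi, hhi, hm⟩ := hn (Fin n) (Fin n) (Fin n) (by simp) (by simp) (by simp) _ hd
  let e : Fin 3 × Fin t → N := fun p => (p.1, ![f, gg, h] p.1 p.2)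
  have he : Function.Injective e := by
    rintro ⟨i, a⟩ ⟨j, b⟩ hab
    obtain ⟨h1, hab⟩ := Prod.mk.inj hab
    dsimp only at h1 hab
    subst h1
    have : a = b := by
      fin_cases i
      · exact hfi hab
      · exact hgi hab
      · exact hhi hab
    rw [this]
  refine ⟨fun p => F (e p), fun z => C (z.map e), ?_, ?_⟩
  · intro a b c
    exact hm a b c
  · intro x y z hxy hxz hyz hb
    have hp : (e x, e y, e z) ∈ T := by
      simp only [T, Finset.mem_filter, Finset.mem_univ, true_and]
      exact ⟨he.ne hxy, he.ne hxz, he.ne hyz⟩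
    have h2 := Finset.single_le_sum (f := g F C) (s := T) (fun _ _ => ind_nonneg _) hp
    have h3 : g F C (e x, e y, e z) = 1 := ind_t hb
    simp only [X] at hXX
    linarith



def Sy {ι V : Type} (Φ : ι → ι → V → Prop) : Prop := ∀ i j u, Φ i j u → Φ j i u
def Wd {ι V : Type} [Fintype V] (Φ : ι → ι → V → Prop) (d : ℝ) : Prop :=
  ∀ i j, i ≠ j → d ≤ pr (Φ i j)

section
variable {ι V : Type} [Fintype V]
def dn (P : Pal ι V) (Φ : ι → ι → V → Prop) (i j k : ι) : ℝ := tri P i j k (Φ i j) (Φ i k) (Φ j k)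
def dens3 [Fintype ι] (P : Pal ι V) (Φ : ι → ι → V → Prop) : ℝ :=
  ex fun i => ex fun j => ex fun k => dn P Φ i j k
def bad (P : Pal ι V) (θ : ℝ) (Φ : ι → ι → V → Prop) (i j k : ι) (u v : V) : Prop :=
  Φ i j u ∧ Φ i k v ∧ θ ≤ pr (fun w => P.E i j k u v w ∧ Φ j k w)

theorem Sy.iff {Φ : ι → ι → V → Prop} (h : Sy Φ) (i j : ι) (u : V) : Φ i j u ↔ Φ j i u :=
  ⟨h _ _ _, h _ _ _⟩

theorem rot {P : Pal ι V} {i j k : ι} {u v w : V} : P.E i j k u v w ↔ P.E j k i w u v :=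
  Pal.s1i.trans Pal.s2i

theorem dn_nonneg (P : Pal ι V) (Φ : ι → ι → V → Prop) (i j k : ι) : 0 ≤ dn P Φ i j k :=
  ex_nonneg fun _ => ex_nonneg fun _ => ex_nonneg fun _ => ind_nonneg _

theorem dn_swap12 (P : Pal ι V) {Φ : ι → ι → V → Prop} (h : Sy Φ) (i j k : ι) :
    dn P Φ i j k = dn P Φ j i k := by
  unfold dn tri; congr 1; funext u; rw [ex_comm]; congr 1; funext w; congr 1; funext v
  apply ind_congr; rw [Pal.s1i, h.iff i j]; tauto
theorem dn_swap23 (P : Pal ι V) {Φ : ι → ι → V → Prop} (h : Sy Φ) (i j k : ι) :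
    dn P Φ i j k = dn P Φ i k j := by
  unfold dn tri; rw [ex_comm]; congr 1; funext v; congr 1; funext u; congr 1; funext w
  apply ind_congr; rw [Pal.s2i, h.iff j k]; tauto

theorem bad_le (P : Pal ι V) {θ : ℝ} (hθ : 0 < θ) (Φ : ι → ι → V → Prop) (i j k : ι) :
    (ex fun u => ex fun v => ind (bad P θ Φ i j k u v)) ≤ dn P Φ i j k / θ := by
  rw [le_div_iff₀ hθ, mul_comm, ← ex_mul]
  refine ex_mono fun u => ?_
  rw [← ex_mul]
  refine ex_mono fun v => ?_
  by_cases h : bad P θ Φ i j k u v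
  · rw [ind_t h, mul_one]
    refine h.2.2.trans (ex_mono fun w => ind_mono fun hw => ⟨h.1, h.2.1, hw.2, hw.1⟩)
  · rw [ind_f h, mul_zero]; exact ex_nonneg fun _ => ind_nonneg _

theorem avoid {P : Pal ι V} {θ : ℝ} {Φ : ι → ι → V → Prop} {i j k : ι} {u v : V}
    (h : ¬ bad P θ Φ i j k u v) (hu : Φ i j u) (hv : Φ i k v) :
    pr (fun w => P.E i j k u v w ∧ Φ j k w) ≤ θ := by
  by_contra hc; push Not at hc; exact h ⟨hu, hv, hc.le⟩

theorem two_avoid [Nonempty V] {P : Pal ι V} {ε θ : ℝ} (hd : P.Dense (1/3 + ε)) {i i' j k : ι}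
    (hij : i ≠ j) (hik : i ≠ k) (hij' : i' ≠ j) (hik' : i' ≠ k) (hjk : j ≠ k) {u v u' v' : V}
    {H : V → Prop} (hH : 1/3 ≤ pr H) (h1 : pr (fun w => P.E i j k u v w ∧ H w) ≤ θ)
    (h2 : pr (fun w => P.E i' j k u' v' w ∧ H w) ≤ θ) :
    2 * ε - 2 * θ ≤ pr (fun w => P.E i j k u v w ∧ P.E i' j k u' v' w) := by
  have a := hd i j k hij hik hjk u v
  have b := hd i' j k hij' hik' hjk u' v'
  have := inter3 (P.E i j k u v) (P.E i' j k u' v') H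
  linarith
end

section
variable {ι V : Type} [Fintype V] [Fintype ι]
theorem d6_mono {f g : ι → ι → ι → V → V → V → Prop} (h : ∀ i j k u v w, f i j k u v w → g i j k u v w) :
    d6 f ≤ d6 g :=
  ex_mono fun i => ex_mono fun j => ex_mono fun k => ex_mono fun u => ex_mono fun v => ex_mono fun w =>
    ind_mono (h i j k u v w)
theorem d6_or (f g : ι → ι → ι → V → V → V → Prop) :
    d6 (fun i j k u v w => f i j k u v w ∨ g i j k u v w) ≤ d6 f + d6 g := by
  unfold d6
  simp only [← ex_add]
  exact ex_mono fun i => ex_mono fun j => ex_mono fun k => ex_mono fun u => ex_mono fun v => ex_mono fun w =>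
    ind_or_le _ _
theorem d6_bad [Nonempty V] (P : Pal ι V) {θ : ℝ} (hθ : 0 < θ) (Φ : ι → ι → V → Prop) :
    d6 (fun i j k u v _ => bad P θ Φ i j k u v) ≤ dens3 P Φ / θ := by
  unfold d6 dens3
  rw [div_eq_mul_inv, ← ex_mul']
  refine ex_mono fun i => ?_
  rw [← ex_mul']
  refine ex_mono fun j => ?_
  rw [← ex_mul']
  refine ex_mono fun k => ?_
  simp only [ex_const]
  rw [← div_eq_mul_inv]; exact bad_le P hθ Φ i j k
theorem d6_idx [Nonempty V] (p : ι → ι → ι → Prop) :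
    d6 (fun i j k (_ _ _ : V) => p i j k) = ex fun i => ex fun j => ex fun k => ind (p i j k) := by
  unfold d6; simp only [ex_const]
theorem d6_eq [Nonempty V] [Nonempty ι] :
    d6 (fun (i j _ : ι) (_ _ _ : V) => i = j) = 1 / (Fintype.card ι : ℝ) := by
  rw [d6_idx]; simp only [ex_const]
  have : ∀ i : ι, ex (fun j => ind (i = j)) = 1 / (Fintype.card ι : ℝ) := fun i => pr_eq_le i
  simp only [this, ex_const]
end

theorem lemX {ε μ : ℝ} (hε : 0 < ε) (hμ : 0 < μ) : ∃ η : ℝ, 0 < η ∧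
    ∀ (ι V : Type) [Fintype ι] [Fintype V] [Nonempty ι] [Nonempty V] (P : Pal ι V),
      P.Dense (1/3 + ε) → P.Free → ∀ A B : ι → ι → V → Prop, Sy A → Sy B → Wd A (1/3) → Wd B (1/3) →
      dens3 P A ≤ η → dens3 P B ≤ η → 1 / (Fintype.card ι : ℝ) ≤ η →
      d6 (fun i j k u v w => (A i j u ∧ B i j u) ∧ A i k v ∧ B j k w ∧ P.E i j k u v w) < μ := by
  obtain ⟨s, hs⟩ := exists_nat_gt (1 / ε)
  obtain ⟨t0, ht0⟩ := exists_nat_gt (1 / ε ^ (s * s - s))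
  let t := t0 + s + 1
  obtain ⟨η0, hη0, hsam⟩ := sample t hμ
  refine ⟨min (η0 / 3) (η0 * (ε / 2) / 3), by positivity, ?_⟩
  intro ι V _ _ _ _ P hd hf A B hA hB hwA hwB hdA hdB hι
  by_contra hcon; push Not at hcon
  have hθ : 0 < ε / 2 := by positivity
  obtain ⟨F, C, hm, hfb⟩ := hsam ι V
    (fun i j k u v w => (A i j u ∧ B i j u) ∧ A i k v ∧ B j k w ∧ P.E i j k u v w)
    (fun i j k u v w => i = j ∨ (bad P (ε/2) A i j k u v ∨ bad P (ε/2) B i j k u v)) hcon (by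
      refine (d6_or _ _).trans ?_
      refine (add_le_add le_rfl (d6_or _ _)).trans ?_
      rw [d6_eq]
      have h1 := (d6_bad P hθ A)
      have h2 := (d6_bad P hθ B)
      have h3 : dens3 P A / (ε/2) ≤ η0 / 3 := by
        rw [div_le_iff₀ hθ]; have := hdA.trans (min_le_right _ _); linarith
      have h4 : dens3 P B / (ε/2) ≤ η0 / 3 := by
        rw [div_le_iff₀ hθ]; have := hdB.trans (min_le_right _ _); linarith
      have h5 := hι.trans (min_le_left _ _)
      linarith)
  have ht : 0 < t := by omega
  let c0 : Fin t := ⟨0, ht⟩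
  obtain ⟨K, -, hK⟩ := Finset.exists_subset_card_eq (s := (univ : Finset (Fin t))) (n := s)
    (by simp [t]; omega)
  have hs0 : (0:ℝ) < s := lt_trans (by positivity) hs
  have hne : ∀ x y, x ≠ y → F x ≠ F y := by
    intro x y hxy he
    obtain ⟨z, hz⟩ : ∃ z : Fin 3 × Fin t, z ≠ x ∧ z ≠ y := by
      have : ∃ i : Fin 3, i ≠ x.1 ∧ i ≠ y.1 := by
        generalize x.1 = a; generalize y.1 = b; revert a b; decide
      obtain ⟨i, h1, h2⟩ := this
      exact ⟨(i, c0), fun h => h1 (congrArg Prod.fst h), fun h => h2 (congrArg Prod.fst h)⟩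
    exact hfb x y z hxy hz.1.symm hz.2.symm (Or.inl he)
  have key := core2 hf K (univ : Finset (Fin t)) (fun a => F (0, a)) (fun b => F (1, b)) (F (2, c0))
    (fun a b => C s((0, a), (1, b))) (fun a => C s((0, a), (2, c0))) (fun b => C s((1, b), (2, c0)))
    (fun a _ b _ => (hm a b c0).2.2.2) hε.le (by
      intro a _ a' _ haa b _
      have hab := hfb (1, b) (0, a) (0, a') (by simp) (by simp) (by simp [haa])
      have hac := hfb (2, c0) (0, a) (0, a') (by simp) (by simp) (by simp [haa])
      push Not at hab hac
      have := two_avoid hd (hne (1, b) (0, a) (by simp)) (hne (1, b) (0, a') (by simp))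
        (hne (2, c0) (0, a) (by simp)) (hne (2, c0) (0, a') (by simp))
        (hne (0, a) (0, a') (by simp [haa])) (hwA _ _ (hne (0, a) (0, a') (by simp [haa])))
        (avoid hab.2.1 (hA _ _ _ (by rw [Sym2.eq_swap]; exact (hm a b c0).1.1))
          (hA _ _ _ (by rw [Sym2.eq_swap]; exact (hm a' b c0).1.1)))
        (avoid hac.2.1 (hA _ _ _ (by rw [Sym2.eq_swap]; exact (hm a b c0).2.1))
          (hA _ _ _ (by rw [Sym2.eq_swap]; exact (hm a' b c0).2.1)))
      refine (by linarith : ε ≤ _).trans (this.trans (pr_mono fun w hw => ?_))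
      rw [Sym2.eq_swap (a := (0, a)), Sym2.eq_swap (a := (0, a')), Sym2.eq_swap (a := (0, a)), Sym2.eq_swap (a := (0, a'))]
      exact ⟨rot.1 hw.1, rot.1 hw.2⟩)
    (by
      rw [Finset.offDiag_card, hK, Finset.card_univ, Fintype.card_fin]
      have hp : 0 < ε ^ (s * s - s) := by positivity
      rw [div_lt_iff₀ hp] at ht0
      have : (t0:ℝ) ≤ t := by simp only [t]; push_cast; linarith
      nlinarith)
  obtain ⟨b, _, b', _, hbb, hsum⟩ := key
  have hlow : ∀ a ∈ K, ε ≤ pr (fun v => P.E (F (0, a)) (F (1, b)) (F (1, b')) (C s((0, a), (1, b)))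
      (C s((0, a), (1, b'))) v ∧ P.E (F (1, b)) (F (1, b')) (F (2, c0)) v (C s((1, b), (2, c0)))
      (C s((1, b'), (2, c0)))) := by
    intro a _
    have hab := hfb (0, a) (1, b) (1, b') (by simp) (by simp) (by simp [hbb])
    have hac := hfb (2, c0) (1, b) (1, b') (by simp) (by simp) (by simp [hbb])
    push Not at hab hac
    have := two_avoid hd (hne (0, a) (1, b) (by simp)) (hne (0, a) (1, b') (by simp))
        (hne (2, c0) (1, b) (by simp)) (hne (2, c0) (1, b') (by simp))
        (hne (1, b) (1, b') (by simp [hbb])) (hwB _ _ (hne (1, b) (1, b') (by simp [hbb])))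
        (avoid hab.2.2 (hm a b c0).1.2 (hm a b' c0).1.2)
        (avoid hac.2.2 (hB _ _ _ (by rw [Sym2.eq_swap]; exact (hm a b c0).2.2.1))
          (hB _ _ _ (by rw [Sym2.eq_swap]; exact (hm a b' c0).2.2.1)))
    refine (by linarith : ε ≤ _).trans (this.trans (pr_mono fun w hw => ⟨hw.1, ?_⟩))
    rw [Sym2.eq_swap (a := (1, b)), Sym2.eq_swap (a := (1, b'))]
    exact rot.1 hw.2
  have := Finset.sum_le_sum hlow
  rw [Finset.sum_const, hK, nsmul_eq_mul] at this
  rw [div_lt_iff₀ hε] at hs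
  linarith



section
variable {ι V : Type} [Fintype V] [Fintype ι]

theorem d6_swap (f : ι → ι → ι → V → V → V → Prop) :
    d6 f = d6 (fun i j k u v w => f i k j v u w) := by
  unfold d6; congr 1; funext i; rw [ex_comm]; congr 1; funext j; congr 1; funext k
  rw [ex_comm]

theorem ex_dist [Nonempty ι] {g : ι → ι → ι → ℝ} {c : ℝ} (hc : 0 ≤ c) (hg : ∀ i j k, 0 ≤ g i j k)
    (h : ∀ i j k, i ≠ j → i ≠ k → j ≠ k → c ≤ g i j k) :
    c * (1 - 3 / (Fintype.card ι : ℝ)) ≤ ex fun i => ex fun j => ex fun k => g i j k := by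
  have h1 : ∀ i j k, c * (1 - ind (i = j) - ind (i = k) - ind (j = k)) ≤ g i j k := by
    intro i j k
    have a1 := ind_nonneg (i = j)
    have a2 := ind_nonneg (i = k)
    have a3 := ind_nonneg (j = k)
    by_cases e1 : i = j
    · have := ind_t e1; have := hg i j k; nlinarith
    by_cases e2 : i = k
    · have := ind_t e2; have := hg i j k; nlinarith
    by_cases e3 : j = k
    · have := ind_t e3; have := hg i j k; nlinarith
    have := h i j k e1 e2 e3
    rw [ind_f e1, ind_f e2, ind_f e3]; linarith
  refine le_trans (le_of_eq ?_) (ex_mono fun i => ex_mono fun j => ex_mono fun k => h1 i j k)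
  simp only [ex_mul, ex_sub, ex_const]
  have e : ∀ i : ι, ex (fun j => ind (i = j)) = 1 / (Fintype.card ι : ℝ) := fun i => pr_eq_le i
  simp only [e, ex_const]; ring

theorem ex_dist2 [Nonempty ι] {g : ι → ι → ℝ} {c : ℝ} (hc : 0 ≤ c) (hg : ∀ i j, 0 ≤ g i j)
    (h : ∀ i j, i ≠ j → c ≤ g i j) :
    c * (1 - 1 / (Fintype.card ι : ℝ)) ≤ ex fun i => ex fun j => g i j := by
  have h1 : ∀ i j, c * (1 - ind (i = j)) ≤ g i j := by
    intro i j
    by_cases e1 : i = j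
    · rw [ind_t e1]; have := hg i j; linarith
    rw [ind_f e1]; have := h i j e1; linarith
  refine le_trans (le_of_eq ?_) (ex_mono fun i => ex_mono fun j => h1 i j)
  simp only [ex_mul, ex_sub, ex_const]
  have e : ∀ i : ι, ex (fun j => ind (i = j)) = 1 / (Fintype.card ι : ℝ) := fun i => pr_eq_le i
  simp only [e, ex_const]

theorem ex_ind_mul {p : V → Prop} {g : V → ℝ} {c : ℝ} (h : ∀ u, p u → c ≤ g u) :
    pr p * c ≤ ex fun u => ind (p u) * g u := by
  unfold pr; rw [← ex_mul']
  refine ex_mono fun u => ?_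
  by_cases hp : p u
  · rw [ind_t hp]; linarith [h u hp]
  · rw [ind_f hp]; linarith
end

theorem ex_ge_of {V : Type} [Fintype V] {p : V → Prop} {g : V → ℝ} {c δ : ℝ} (hp : δ ≤ pr p) (hc : 0 ≤ c)
    (hg : ∀ u, 0 ≤ g u) (h : ∀ u, p u → c ≤ g u) : δ * c ≤ ex g := by
  refine (mul_le_mul_of_nonneg_right hp hc).trans ?_
  unfold pr; rw [← ex_mul']
  refine ex_mono fun u => ?_
  by_cases hp : p u
  · rw [ind_t hp]; linarith [h u hp]
  · rw [ind_f hp]; linarith [hg u]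

theorem union_ge {V : Type} [Fintype V] [Nonempty V] (A B C : V → Prop) :
    pr A + pr B + pr C - 1 - pr (fun x => B x ∧ C x) ≤ pr (fun x => A x ∧ (B x ∨ C x)) := by
  have h1 : ex (fun _ : V => (1:ℝ)) = 1 := ex_const 1
  rw [← h1]; unfold pr
  rw [← ex_add, ← ex_add, ← ex_sub, ← ex_sub]
  refine ex_mono fun x => ?_
  unfold ind
  by_cases A x <;> by_cases B x <;> by_cases C x <;> simp_all

theorem lemT {ε δ' : ℝ} (hε : 0 < ε) (hδ : 0 < δ') : ∃ η : ℝ, 0 < η ∧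
    ∀ (ι V : Type) [Fintype ι] [Fintype V] [Nonempty ι] [Nonempty V] (P : Pal ι V),
      P.Dense (1/3 + ε) → P.Free → ∀ H1 H2 H3 : ι → ι → V → Prop, Sy H1 → Sy H2 → Sy H3 →
      Wd H1 (1/3) → Wd H2 (1/3) → Wd H3 (1/3) →
      dens3 P H1 ≤ η → dens3 P H2 ≤ η → dens3 P H3 ≤ η → 1 / (Fintype.card ι : ℝ) ≤ η →
      (∀ i j, i ≠ j → δ' ≤ pr (fun u => H1 i j u ∧ H2 i j u)) →
      (∀ i j, i ≠ j → δ' ≤ pr (fun u => H2 i j u ∧ H3 i j u)) →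
      ∃ j k, j ≠ k ∧ ε / 2 ≤ pr (fun u => H1 j k u ∧ H3 j k u) := by
  have hμ : 0 < δ' * δ' * (ε / 2) / 4 := by positivity
  obtain ⟨η, hη, hX⟩ := lemX hε hμ
  refine ⟨min η (1/6), by positivity, ?_⟩
  intro ι V _ _ _ _ P hd hf H1 H2 H3 s1 s2 s3 w1 w2 w3 d1 d2 d3 hc p12 p23
  by_contra hcon; push Not at hcon
  have e1 := hX ι V P hd hf H2 H1 s2 s1 w2 w1 (d2.trans (min_le_left _ _)) (d1.trans (min_le_left _ _)) (hc.trans (min_le_left _ _))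
  have e3 := hX ι V P hd hf H2 H3 s2 s3 w2 w3 (d2.trans (min_le_left _ _)) (d3.trans (min_le_left _ _)) (hc.trans (min_le_left _ _))
  rw [d6_swap] at e3
  have hlow : δ' * (δ' * (ε / 2)) * (1 - 3 / (Fintype.card ι : ℝ)) ≤
      d6 (fun i j k u v w => (H1 i j u ∧ H2 i j u) ∧ (H2 i k v ∧ H3 i k v) ∧ (P.E i j k u v w ∧ (H1 j k w ∨ H3 j k w))) := by
    refine ex_dist (by positivity) (fun i j k => ex_nonneg fun _ => ex_nonneg fun _ => ex_nonneg fun _ => ind_nonneg _) ?_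
    intro i j k hij hik hjk
    refine ex_ge_of (p12 i j hij) (by positivity) (fun u => ex_nonneg fun _ => ex_nonneg fun _ => ind_nonneg _) fun u hu => ?_
    refine ex_ge_of (p23 i k hik) (by positivity) (fun v => ex_nonneg fun _ => ind_nonneg _) fun v hv => ?_
    have := union_ge (P.E i j k u v) (H1 j k) (H3 j k)
    have a := hd i j k hij hik hjk u v
    have b := w1 j k hjk
    have c := w3 j k hjk
    have d := hcon j k hjk
    refine le_trans (by linarith) (this.trans (ex_mono fun w => ind_mono fun hw => ⟨hu, hv, hw⟩))
  have hup := hlow.trans ((d6_mono (g := fun i j k u v w =>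
      ((H2 i j u ∧ H1 i j u) ∧ H2 i k v ∧ H1 j k w ∧ P.E i j k u v w) ∨
      ((H2 i k v ∧ H3 i k v) ∧ H2 i j u ∧ H3 k j w ∧ P.E i k j v u w)) (by
        rintro i j k u v w ⟨⟨a, b⟩, ⟨c, d⟩, e, f | f⟩
        · exact Or.inl ⟨⟨b, a⟩, c, f, e⟩
        · exact Or.inr ⟨⟨c, d⟩, b, s3 _ _ _ f, P.s2 _ _ _ _ _ _ e⟩)).trans (d6_or _ _))
  have h6 := hc.trans (min_le_right _ _)
  have : (3 / (Fintype.card ι : ℝ)) = 3 * (1 / (Fintype.card ι : ℝ)) := by ring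
  rw [this] at hup
  have : 0 < δ' * (δ' * (ε / 2)) := by positivity
  nlinarith

/-- pull back of a palette -/
def Pal.comap {ι κ V : Type} (P : Pal ι V) (f : κ → ι) : Pal κ V where
  E i j k u v w := P.E (f i) (f j) (f k) u v w
  ne i j k u v w h := by
    obtain ⟨a, b, c⟩ := P.ne _ _ _ _ _ _ h
    exact ⟨fun h => a (h ▸ rfl), fun h => b (h ▸ rfl), fun h => c (h ▸ rfl)⟩
  s1 i j k u v w h := P.s1 _ _ _ _ _ _ h
  s2 i j k u v w h := P.s2 _ _ _ _ _ _ h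

theorem comap_dense {ι κ V : Type} [Fintype V] {P : Pal ι V} {d : ℝ} (h : P.Dense d) {f : κ → ι}
    (hf : Function.Injective f) : (P.comap f).Dense d :=
  fun i j k a b c u v => h _ _ _ (hf.ne a) (hf.ne b) (hf.ne c) u v
theorem comap_free {ι κ V : Type} {P : Pal ι V} (h : P.Free) (f : κ → ι) : (P.comap f).Free := by
  intro i₁ i₂ i₃ i₄ i₅ x₁₂ x₁₃ x₁₄ x₁₅ x₂₃ x₂₄ x₂₅ x₃₄ x₃₅ x₄₅
  exact h _ _ _ _ _ x₁₂ x₁₃ x₁₄ x₁₅ x₂₃ x₂₄ x₂₅ x₃₄ x₃₅ x₄₅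
theorem dense_mono {ι V : Type} [Fintype V] {P : Pal ι V} {d d' : ℝ} (h : P.Dense d) (hd : d' ≤ d) : P.Dense d' :=
  fun i j k a b c u v => hd.trans (h i j k a b c u v)



theorem ex_out4 {α β γ ζ : Type} [Fintype α] [Fintype β] [Fintype γ] [Fintype ζ] (f : α → β → γ → ζ → ℝ) :
    (ex fun a => ex fun b => ex fun c => ex fun d => f a b c d) =
      ex fun d => ex fun a => ex fun b => ex fun c => f a b c d := by
  rw [ex_comm (fun d a => ex fun b => ex fun c => f a b c d)]
  congr 1; funext a; exact ex_rot _

section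
variable {ι V : Type} [Fintype V] [Fintype ι]

def pop (P : Pal ι V) (δ : ℝ) (Φ : ι → ι → V → Prop) (i j : ι) (w : V) : Prop :=
  δ ≤ ex fun a => ex fun u => ex fun v => ind (Φ a i u ∧ Φ a j v ∧ P.E a i j u v w)

theorem pop_sy (P : Pal ι V) (δ : ℝ) (Φ : ι → ι → V → Prop) : Sy (pop P δ Φ) := by
  intro i j w h
  refine h.trans (le_of_eq ?_)
  congr 1; funext a; rw [ex_comm]; congr 1; funext v; congr 1; funext u
  apply ind_congr; rw [Pal.s2i]; tauto

theorem pop_mono (P : Pal ι V) (δ : ℝ) {Φ Ψ : ι → ι → V → Prop} (h : ∀ i j u, Φ i j u → Ψ i j u)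
    (i j : ι) (w : V) (hw : pop P δ Φ i j w) : pop P δ Ψ i j w :=
  hw.trans (ex_mono fun a => ex_mono fun u => ex_mono fun v => ind_mono fun ⟨x, y, z⟩ => ⟨h _ _ _ x, h _ _ _ y, z⟩)

theorem pop_out [Nonempty V] (P : Pal ι V) {δ : ℝ} (hδ : 0 ≤ δ) (Φ : ι → ι → V → Prop) (i j : ι) :
    (ex fun a => ex fun u => ex fun v => ex fun w =>
      ind (Φ a i u ∧ Φ a j v ∧ P.E a i j u v w ∧ ¬ pop P δ Φ i j w)) ≤ δ := by
  rw [ex_out4]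
  refine ex_le_of fun w => ?_
  by_cases h : pop P δ Φ i j w
  · refine le_trans (le_of_eq ?_) hδ
    simp [h, ind, ex]
  · have h' := h
    unfold pop at h'; push Not at h'
    refine le_trans (ex_mono fun a => ex_mono fun u => ex_mono fun v => ind_mono ?_) h'.le
    tauto

theorem pop_wd [Nonempty V] [Nonempty ι] {P : Pal ι V} {ε δ : ℝ} (hε : 0 < ε) (hδ : 0 ≤ δ) (hδε : δ ≤ ε / 20)
    (hd : P.Dense (1/3 + ε)) {Φ : ι → ι → V → Prop} (hs : Sy Φ) (hw : Wd Φ (1/3))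
    (hc : 1 / (Fintype.card ι : ℝ) ≤ 1 / 20) : Wd (pop P δ Φ) (1/3) := by
  intro i j hij
  by_contra hcon; push Not at hcon
  have h1 := pop_out P hδ Φ i j
  have h2 : 1/9 * ε * (1 - 2 / (Fintype.card ι : ℝ)) ≤ ex fun a => ex fun u => ex fun v => ex fun w =>
      ind (Φ a i u ∧ Φ a j v ∧ P.E a i j u v w ∧ ¬ pop P δ Φ i j w) := by
    have : ∀ a, 1/9 * ε * (1 - ind (i = a) - ind (j = a)) ≤ ex fun u => ex fun v => ex fun w =>
      ind (Φ a i u ∧ Φ a j v ∧ P.E a i j u v w ∧ ¬ pop P δ Φ i j w) := by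
      intro a
      have hnn : 0 ≤ ex fun u => ex fun v => ex fun w =>
        ind (Φ a i u ∧ Φ a j v ∧ P.E a i j u v w ∧ ¬ pop P δ Φ i j w) :=
        ex_nonneg fun _ => ex_nonneg fun _ => ex_nonneg fun _ => ind_nonneg _
      have i1 := ind_nonneg (i = a)
      have i2 := ind_nonneg (j = a)
      by_cases e1 : i = a
      · refine le_trans ?_ hnn; have := ind_t e1; nlinarith
      by_cases e2 : j = a
      · refine le_trans ?_ hnn; have := ind_t e2; nlinarith
      rw [ind_f e1, ind_f e2]
      have : (1/3:ℝ) * (1/3 * ε) ≤ ex fun u => ex fun v => ex fun w =>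
        ind (Φ a i u ∧ Φ a j v ∧ P.E a i j u v w ∧ ¬ pop P δ Φ i j w) := by
        refine ex_ge_of (hw a i (Ne.symm e1)) (by positivity) (fun u => ex_nonneg fun _ => ex_nonneg fun _ => ind_nonneg _) fun u hu => ?_
        refine ex_ge_of (hw a j (Ne.symm e2)) (by positivity) (fun v => ex_nonneg fun _ => ind_nonneg _) fun v hv => ?_
        have a1 := hd a i j (Ne.symm e1) (Ne.symm e2) hij u v
        rw [pr_split _ (pop P δ Φ i j)] at a1
        have a2 : pr (fun x => P.E a i j u v x ∧ pop P δ Φ i j x) ≤ pr (pop P δ Φ i j) := pr_mono fun x h => h.2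
        refine le_trans (by linarith : ε ≤ pr (fun x => P.E a i j u v x ∧ ¬ pop P δ Φ i j x)) (ex_mono fun w => ind_mono fun h => ⟨hu, hv, h⟩)
      linarith
    refine le_trans (le_of_eq ?_) (ex_mono this)
    rw [ex_mul, ex_sub, ex_sub, ex_const]
    have e : ∀ i : ι, ex (fun j => ind (i = j)) = 1 / (Fintype.card ι : ℝ) := fun i => pr_eq_le i
    rw [e, e]; ring
  have : (2 / (Fintype.card ι : ℝ)) = 2 * (1 / (Fintype.card ι : ℝ)) := by ring
  rw [this] at h2
  nlinarith

theorem pop_ov [Nonempty V] (P : Pal ι V) {δ : ℝ} (Φ : ι → ι → V → Prop) (i j : ι) :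
    δ * pr (fun w => Φ i j w ∧ pop P δ Φ i j w) ≤ ex fun a => dn P Φ a i j := by
  unfold dn tri
  rw [ex_out4]
  unfold pr; rw [← ex_mul]
  refine ex_mono fun w => ?_
  by_cases h : Φ i j w ∧ pop P δ Φ i j w
  · rw [ind_t h, mul_one]
    exact h.2.trans (ex_mono fun a => ex_mono fun u => ex_mono fun v => ind_mono fun ⟨x, y, z⟩ => ⟨x, y, h.1, z⟩)
  · rw [ind_f h, mul_zero]
    exact ex_nonneg fun _ => ex_nonneg fun _ => ex_nonneg fun _ => ind_nonneg _

theorem pop_ov_avg [Nonempty V] (P : Pal ι V) {δ : ℝ} (Φ : ι → ι → V → Prop) :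
    δ * (ex fun i => ex fun j => pr (fun w => Φ i j w ∧ pop P δ Φ i j w)) ≤ dens3 P Φ := by
  rw [← ex_mul]
  have : dens3 P Φ = ex fun i => ex fun j => ex fun a => dn P Φ a i j := by
    unfold dens3; rw [ex_rot, ex_rot]
  rw [this]
  refine ex_mono fun i => ?_
  rw [← ex_mul]
  exact ex_mono fun j => pop_ov P Φ i j
end

theorem pr_ex_le {X γ : Type} [Fintype X] (s : Finset γ) (p : γ → X → Prop) {η : ℝ}
    (h : ∀ c ∈ s, pr (p c) ≤ η) : pr (fun x => ∃ c ∈ s, p c x) ≤ s.card * η := by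
  have h1 : pr (fun x => ∃ c ∈ s, p c x) ≤ ex fun x => ∑ c ∈ s, ind (p c x) := by
    refine ex_mono fun x => ?_
    by_cases hx : ∃ c ∈ s, p c x
    · rw [ind_t hx]; obtain ⟨c, hc, hp⟩ := hx
      rw [← ind_t hp]; exact Finset.single_le_sum (f := fun c => ind (p c x)) (fun c _ => ind_nonneg _) hc
    · rw [ind_f hx]; exact Finset.sum_nonneg fun _ _ => ind_nonneg _
  refine h1.trans ?_
  rw [ex_sum, ← nsmul_eq_mul]
  exact Finset.sum_le_card_nsmul _ _ _ h

theorem cert {ε δ : ℝ} (hε : 0 < ε) (hδ : 0 < δ) : ∃ (N : ℕ) (η : ℝ), 0 < N ∧ 0 < η ∧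
    ∀ (ι V : Type) [Fintype ι] [Fintype V] [Nonempty ι] [Nonempty V] (P : Pal ι V),
      P.Dense (1/3 + ε) → P.Free → ∀ Φ : ι → ι → V → Prop, Sy Φ → Wd Φ (1/3) →
      ∀ (kk : Fin N → ι), Function.Injective kk → ∀ (l : ι) (q : Fin N → V),
      (∀ k, pop P δ Φ (kk k) l (q k)) →
      (∀ k k', k ≠ k' → (ex fun a => dn P Φ a (kk k) (kk k')) ≤ η) →
      (∀ k, (ex fun a => ex fun b => dn P Φ (kk k) a b) ≤ η) →
      (ex fun a => ex fun b => dn P Φ l a b) ≤ η → 1 / (Fintype.card ι : ℝ) ≤ η →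
      ∃ k k', k ≠ k' ∧ ε ≤ pr (fun w => P.E (kk k) (kk k') l w (q k) (q k') ∧ Φ (kk k) (kk k') w) := by
  obtain ⟨s, hs⟩ := exists_nat_gt (4 / ε)
  obtain ⟨t, ht⟩ := exists_nat_gt (1 / ε ^ (s * s - s))
  let μ : ℝ := (δ ^ t) ^ s
  have hμ : 0 < μ := by positivity
  obtain ⟨N0, hN0⟩ := exists_nat_gt ((t:ℝ)^2 / (μ / 2))
  let N := N0 + 1
  have hs0 : (0:ℝ) < s := lt_trans (by positivity) hs
  have hs0' : 0 < s := by exact_mod_cast hs0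
  have ht0' : 0 < t := by
    have : (0:ℝ) < t := lt_trans (by positivity) ht
    exact_mod_cast this
  have hθ : 0 < ε / 4 := by positivity
  let Q : ℝ := (s * s * (N * N) : ℕ) * (1 + 3 / (ε/4))
  have hNpos : 0 < N := by omega
  have hQ : 0 < Q := by
    have : 0 < s * s * (N * N) := by positivity
    have : (0:ℝ) < (s * s * (N * N) : ℕ) := by exact_mod_cast this
    positivity
  refine ⟨N, μ / 4 / Q, by omega, by positivity, ?_⟩
  intro ι V _ _ _ _ P hd hf Φ hsy hw kk hkk l q hq g1 g2 g3 hc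
  set η := μ / 4 / Q with hη
  let Ω := ι × (Fin N → V) × V
  let good : Ω → Fin N → Prop := fun ω k => Φ ω.1 (kk k) (ω.2.1 k) ∧ Φ ω.1 l ω.2.2 ∧ P.E ω.1 (kk k) l (ω.2.1 k) ω.2.2 (q k)
  have exΩ : ∀ (k : Fin N) (G : ι → V → V → ℝ), ex (fun ω : Ω => G ω.1 (ω.2.1 k) ω.2.2) =
      ex fun a => ex fun u => ex fun v => G a u v := by
    intro k G
    rw [ex_prod]; congr 1; funext a; rw [ex_prod]
    exact ex_coord (W := fun _ : Fin N => V) k (fun u => ex fun v => G a u v)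
  have hgood : ∀ k, δ ≤ pr (fun ω : Ω => good ω k) := by
    intro k
    refine (hq k).trans (le_of_eq ?_)
    exact (exΩ k (fun a u v => ind (Φ a (kk k) u ∧ Φ a l v ∧ P.E a (kk k) l u v (q k)))).symm
  haveI : Nonempty (Fin N) := ⟨⟨0, hNpos⟩⟩
  have b1 : δ ≤ ex fun ω : Ω => pr (fun k => good ω k) := by
    unfold pr; rw [ex_comm]; exact le_ex_of hgood
  have b2 := blow good hδ.le b1 t
  have b3 : δ ^ t ≤ ex fun y : Fin t → Fin N => pr (fun ω : Ω => ∀ c, good ω (y c)) := by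
    unfold pr; rw [ex_comm]; exact b2
  have b4 := blow (fun (y : Fin t → Fin N) (ω : Ω) => ∀ c, good ω (y c)) (by positivity) b3 s
  have b5 : ∃ y : Fin t → Fin N, Function.Injective y ∧ μ / 2 ≤ pr (fun ω : Fin s → Ω => ∀ c, ∀ b, good (ω c) (y b)) := by
    by_contra hcon; push Not at hcon
    have c1 : (ex fun y : Fin t → Fin N => pr (fun ω : Fin s → Ω => ∀ c, ∀ b, good (ω c) (y b))) ≤
        ex fun y : Fin t → Fin N => (ind (¬ Function.Injective y) + μ / 2) := by
      refine ex_mono fun y => ?_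
      by_cases hy : Function.Injective y
      · rw [ind_f (not_not.2 hy)]; linarith [hcon y hy]
      · rw [ind_t hy]; have := pr_le_one (fun ω : Fin s → Ω => ∀ c, ∀ b, good (ω c) (y b)); linarith
    rw [ex_add, ex_const] at c1
    have c2 := pr_noninj (X := Fin N) t
    rw [Fintype.card_fin] at c2
    have c3 : (t:ℝ)^2 / (N:ℝ) < μ / 2 := by
      rw [div_lt_iff₀ (by positivity)] at hN0
      rw [div_lt_iff₀ (by exact_mod_cast hNpos)]
      have : (N0:ℝ) ≤ N := by simp [N]
      nlinarith
    have c4 : ex (fun y : Fin t → Fin N => ind (¬ Function.Injective y)) = pr (fun y : Fin t → Fin N => ¬ Function.Injective y) := rfl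
    have : μ ≤ _ := b4
    linarith
  obtain ⟨y, hy, b6⟩ := b5
  let bd := bad P (ε/4) Φ
  let ev : (Fin s × Fin s) × (Fin N × Fin N) → (Fin s → Ω) → Prop := fun e ω =>
    (e.1.1 ≠ e.1.2 ∧ ((ω e.1.1).1 = (ω e.1.2).1 ∨ (bd (kk e.2.1) (ω e.1.1).1 (ω e.1.2).1 ((ω e.1.1).2.1 e.2.1) ((ω e.1.2).2.1 e.2.1) ∨
      bd l (ω e.1.1).1 (ω e.1.2).1 (ω e.1.1).2.2 (ω e.1.2).2.2))) ∨
    (e.2.1 ≠ e.2.2 ∧ bd (ω e.1.1).1 (kk e.2.1) (kk e.2.2) ((ω e.1.1).2.1 e.2.1) ((ω e.1.1).2.1 e.2.2))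
  have hη0 : 0 < η := by positivity
  have hev : ∀ e ∈ (univ : Finset ((Fin s × Fin s) × (Fin N × Fin N))), pr (ev e) ≤ η * (1 + 3 / (ε/4)) := by
    rintro ⟨⟨c, c'⟩, k, k'⟩ -
    have hbd : ∀ i : ι, (ex fun a => ex fun b => dn P Φ i a b) ≤ η →
        (ex fun a => ex fun b => ex fun u => ex fun v => ind (bd i a b u v)) ≤ η / (ε/4) := by
      intro i hi
      refine le_trans ?_ (div_le_div_of_nonneg_right hi hθ.le)
      rw [div_eq_mul_inv, ← ex_mul']
      refine ex_mono fun a => ?_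
      rw [← ex_mul']
      refine ex_mono fun b => ?_
      rw [← div_eq_mul_inv]; exact bad_le P hθ Φ i a b
    have p1 : c ≠ c' → pr (fun ω : Fin s → Ω => (ω c).1 = (ω c').1) ≤ η := by
      intro hcc
      refine le_trans (le_of_eq ?_) hc
      unfold pr; rw [ex_coord2 hcc (fun x y : Ω => ind (x.1 = y.1))]
      have e2 : ∀ x : Ω, ex (fun y : Ω => ind (x.1 = y.1)) = ex fun b => ind (x.1 = b) := fun x => by
        rw [exΩ k (fun b _ _ => ind (x.1 = b))]; simp only [ex_const]
      simp only [e2]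
      have e : ∀ i : ι, ex (fun j => ind (i = j)) = 1 / (Fintype.card ι : ℝ) := fun i => pr_eq_le i
      simp only [e, ex_const]
    have p2 : c ≠ c' → pr (fun ω : Fin s → Ω => bd (kk k) (ω c).1 (ω c').1 ((ω c).2.1 k) ((ω c').2.1 k)) ≤ η / (ε/4) := by
      intro hcc
      refine le_trans (le_of_eq ?_) (hbd _ (g2 k))
      unfold pr; rw [ex_coord2 hcc (fun x y : Ω => ind (bd (kk k) x.1 y.1 (x.2.1 k) (y.2.1 k)))]
      have e2 : ∀ x : Ω, ex (fun y : Ω => ind (bd (kk k) x.1 y.1 (x.2.1 k) (y.2.1 k))) =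
          ex fun b => ex fun v => ind (bd (kk k) x.1 b (x.2.1 k) v) := fun x => by
        rw [exΩ k (fun b v _ => ind (bd (kk k) x.1 b (x.2.1 k) v))]; simp only [ex_const]
      simp only [e2]
      rw [exΩ k (fun a u _ => ex fun b => ex fun v => ind (bd (kk k) a b u v))]
      simp only [ex_const]; congr 1; funext a; rw [ex_comm]
    have p3 : c ≠ c' → pr (fun ω : Fin s → Ω => bd l (ω c).1 (ω c').1 (ω c).2.2 (ω c').2.2) ≤ η / (ε/4) := by
      intro hcc
      refine le_trans (le_of_eq ?_) (hbd _ g3)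
      unfold pr; rw [ex_coord2 hcc (fun x y : Ω => ind (bd l x.1 y.1 (x.2.2) (y.2.2)))]
      have e2 : ∀ x : Ω, ex (fun y : Ω => ind (bd l x.1 y.1 x.2.2 y.2.2)) =
          ex fun b => ex fun v => ind (bd l x.1 b x.2.2 v) := fun x => by
        rw [exΩ k (fun b _ v => ind (bd l x.1 b x.2.2 v))]; simp only [ex_const]
      simp only [e2]
      rw [exΩ k (fun a _ u => ex fun b => ex fun v => ind (bd l a b u v))]
      simp only [ex_const]; congr 1; funext a; rw [ex_comm]
    have p4 : k ≠ k' → pr (fun ω : Fin s → Ω => bd (ω c).1 (kk k) (kk k') ((ω c).2.1 k) ((ω c).2.1 k')) ≤ η / (ε/4) := by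
      intro hk
      refine le_trans ?_ (div_le_div_of_nonneg_right (g1 k k' hk) hθ.le)
      unfold pr
      rw [ex_coord (W := fun _ : Fin s => Ω) c (fun x : Ω => ind (bd x.1 (kk k) (kk k') (x.2.1 k) (x.2.1 k')))]
      rw [ex_prod, div_eq_mul_inv, ← ex_mul']
      refine ex_mono fun a => ?_
      have e2 : ex (fun p : (Fin N → V) × V => ind (bd a (kk k) (kk k') (p.1 k) (p.1 k'))) =
          ex fun u => ex fun v => ind (bd a (kk k) (kk k') u v) := by
        rw [ex_prod, ← ex_coord2 hk (fun u v => ind (bd a (kk k) (kk k') u v))]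
        congr 1; funext x; exact ex_const (ind (bd a (kk k) (kk k') (x k) (x k')))
      rw [← div_eq_mul_inv]
      exact e2.le.trans (bad_le P hθ Φ _ _ _)
    have hpos : 0 ≤ η / (ε/4) := by positivity
    refine (pr_or_le _ _).trans ?_
    have z1 : pr (fun ω : Fin s → Ω => (c ≠ c' ∧ ((ω c).1 = (ω c').1 ∨ (bd (kk k) (ω c).1 (ω c').1 ((ω c).2.1 k) ((ω c').2.1 k) ∨
      bd l (ω c).1 (ω c').1 (ω c).2.2 (ω c').2.2)))) ≤ η + (η / (ε/4) + η / (ε/4)) := by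
      by_cases hcc : c = c'
      · rw [pr_false (by simp [hcc])]; positivity
      · refine (pr_mono fun x h => h.2).trans ((pr_or_le _ _).trans (add_le_add (p1 hcc) ((pr_or_le _ _).trans (add_le_add (p2 hcc) (p3 hcc)))))
    have z2 : pr (fun ω : Fin s → Ω => k ≠ k' ∧ bd (ω c).1 (kk k) (kk k') ((ω c).2.1 k) ((ω c).2.1 k')) ≤ η / (ε/4) := by
      by_cases hk : k = k'
      · rw [pr_false (by simp [hk])]; positivity
      · exact (pr_mono fun x h => h.2).trans (p4 hk)
    refine (add_le_add z1 z2).trans (le_of_eq ?_)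
    ring
  have b7 := pr_ex_le univ ev hev
  have b8 : ((univ : Finset ((Fin s × Fin s) × (Fin N × Fin N))).card : ℝ) * (η * (1 + 3 / (ε/4))) = μ / 4 := by
    have : ((univ : Finset ((Fin s × Fin s) × (Fin N × Fin N))).card : ℝ) * (1 + 3 / (ε/4)) = Q := by
      simp [Q, Finset.card_univ]
    calc _ = η * (((univ : Finset ((Fin s × Fin s) × (Fin N × Fin N))).card : ℝ) * (1 + 3 / (ε/4))) := by ring
      _ = η * Q := by rw [this]
      _ = μ / 4 := by rw [hη]; field_simp
  rw [b8] at b7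
  obtain ⟨ω, hω1, hω2⟩ : ∃ ω : Fin s → Ω, (∀ c, ∀ b, good (ω c) (y b)) ∧ ¬ ∃ e ∈ univ, ev e ω := by
    refine pr_inter_pos (p := fun ω : Fin s → Ω => (∀ c, ∀ b, good (ω c) (y b))) (q := fun ω => ¬ ∃ e ∈ univ, ev e ω) ?_
    rw [pr_not]; linarith
  push Not at hω2
  have f1 : ∀ c c' b, c ≠ c' → (ω c).1 ≠ (ω c').1 ∧ ¬ bd (kk b) (ω c).1 (ω c').1 ((ω c).2.1 b) ((ω c').2.1 b) ∧
      ¬ bd l (ω c).1 (ω c').1 (ω c).2.2 (ω c').2.2 := by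
    intro c c' b hcc
    have := hω2 ((c, c'), (b, b)) (mem_univ _)
    simp only [ev, not_or, not_and] at this
    exact this.1 hcc
  have f2 : ∀ c b b', b ≠ b' → ¬ bd (ω c).1 (kk b) (kk b') ((ω c).2.1 b) ((ω c).2.1 b') := by
    intro c b b' hbb
    have := hω2 ((c, c), (b, b')) (mem_univ _)
    simp only [ev, not_or, not_and] at this
    exact this.2 hbb
  have key := core2 hf (univ : Finset (Fin s)) (univ : Finset (Fin t)) (fun c => (ω c).1) (fun b => kk (y b)) l
    (fun c b => (ω c).2.1 (y b)) (fun c => (ω c).2.2) (fun b => q (y b)) (fun c _ b _ => (hω1 c b).2.2) hε.le (by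
      intro a _ a' _ haa b _
      obtain ⟨n1, n2, n3⟩ := f1 a a' (y b) haa
      obtain ⟨m1, m2, -⟩ := P.ne _ _ _ _ _ _ (hω1 a b).2.2
      obtain ⟨m1', m2', -⟩ := P.ne _ _ _ _ _ _ (hω1 a' b).2.2
      have := two_avoid hd m1.symm m1'.symm m2.symm m2'.symm n1 (hw _ _ n1)
        (avoid n2 (hsy _ _ _ (hω1 a b).1) (hsy _ _ _ (hω1 a' b).1))
        (avoid n3 (hsy _ _ _ (hω1 a b).2.1) (hsy _ _ _ (hω1 a' b).2.1))
      refine (by linarith : ε ≤ _).trans (this.trans (pr_mono fun w hw => ⟨rot.1 hw.1, rot.1 hw.2⟩)))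
    (by
      rw [Finset.offDiag_card, Finset.card_univ, Fintype.card_fin, Finset.card_univ, Fintype.card_fin]
      have hp : 0 < ε ^ (s * s - s) := by positivity
      rw [div_lt_iff₀ hp] at ht
      linarith)
  obtain ⟨b, _, b', _, hbb, hsum⟩ := key
  have hyb : y b ≠ y b' := hy.ne hbb
  refine ⟨y b, y b', hyb, ?_⟩
  obtain ⟨c, hcs⟩ : ∃ c : Fin s, pr (fun v => P.E (ω c).1 (kk (y b)) (kk (y b')) ((ω c).2.1 (y b)) ((ω c).2.1 (y b')) v ∧
      P.E (kk (y b)) (kk (y b')) l v (q (y b)) (q (y b'))) ≤ ε / 4 := by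
    by_contra hcon; push Not at hcon
    have := Finset.sum_le_sum (s := univ) fun c _ => (hcon c).le
    rw [Finset.sum_const, Finset.card_univ, Fintype.card_fin, nsmul_eq_mul] at this
    rw [div_lt_iff₀ hε] at hs
    linarith
  obtain ⟨m1, m2, m3⟩ := P.ne _ _ _ _ _ _ (hω1 c b).2.2
  obtain ⟨m1', m2', m3'⟩ := P.ne _ _ _ _ _ _ (hω1 c b').2.2
  have hkb := hkk.ne hyb
  have a1 := avoid (f2 c (y b) (y b') hyb) (hω1 c b).1 (hω1 c b').1
  have a2 := inter3 (fun w => P.E (kk (y b)) (kk (y b')) l w (q (y b)) (q (y b'))) (Φ (kk (y b)) (kk (y b')))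
    (P.E (ω c).1 (kk (y b)) (kk (y b')) ((ω c).2.1 (y b)) ((ω c).2.1 (y b')))
  have a3 := hd _ _ _ m1 m1' hkb ((ω c).2.1 (y b)) ((ω c).2.1 (y b'))
  have a4 := hd _ _ _ m3.symm m3'.symm hkb (q (y b)) (q (y b'))
  have a5 : pr (P.E l (kk (y b)) (kk (y b')) (q (y b)) (q (y b'))) = pr (fun w => P.E (kk (y b)) (kk (y b')) l w (q (y b)) (q (y b'))) :=
    pr_congr fun w => rot
  have a6 : pr (fun x => P.E (kk (y b)) (kk (y b')) l x (q (y b)) (q (y b')) ∧ P.E (ω c).1 (kk (y b)) (kk (y b')) ((ω c).2.1 (y b)) ((ω c).2.1 (y b')) x)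
    ≤ ε / 4 := (pr_mono fun x h => ⟨h.2, h.1⟩).trans hcs
  have a7 : pr (fun x => Φ (kk (y b)) (kk (y b')) x ∧ P.E (ω c).1 (kk (y b)) (kk (y b')) ((ω c).2.1 (y b)) ((ω c).2.1 (y b')) x)
    ≤ ε / 4 := (pr_mono fun x h => ⟨h.2, h.1⟩).trans a1
  have a8 := hw _ _ hkb
  linarith



def lk {ι V X : Type} (P : Pal ι V) (F : X → ι) (q : X → X → V) (b x y : X) (w : V) : Prop :=
  P.E (F b) (F x) (F y) (q b x) (q b y) w

theorem lk_sy {ι V X : Type} (P : Pal ι V) (F : X → ι) (q : X → X → V) (b : X) : Sy (lk P F q b) :=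
  fun _ _ _ h => P.s2 _ _ _ _ _ _ h

theorem side {ε δ' : ℝ} (hε : 0 < ε) (hδ : 0 < δ') (n0 s p : ℕ) : ∃ (Pn N : ℕ) (η : ℝ), 0 < η ∧
    ∀ (ι V X : Type) [Fintype V] [Nonempty V] (P : Pal ι V),
      P.Dense (1/3 + ε) → P.Free → ∀ Φ : ι → ι → V → Prop, Sy Φ → Wd Φ (1/3) →
      ∀ (F : X → ι), Function.Injective F → ∀ (q : X → X → V) (K L M : Finset X),
      Disjoint K L → Disjoint K M → Disjoint L M → N ≤ K.card → L.card = Pn → M.card = Pn →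
      (∀ a ∈ K, ∀ b ∈ K, ∀ c ∈ K, a ≠ b → a ≠ c → b ≠ c → dn P Φ (F a) (F b) (F c) ≤ η) →
      (∀ b, b ∈ L ∨ b ∈ M → ∀ K0 ⊆ K, K0.card = n0 → ∃ k ∈ K0, ∃ k' ∈ K0, k ≠ k' ∧
        δ' ≤ pr (fun w => lk P F q b k k' w ∧ Φ (F k) (F k') w)) →
      ∃ K1 ⊆ K, ∃ L1 ⊆ L, ∃ M1 ⊆ M, K1.card = s ∧ L1.card = p ∧ M1.card = p ∧
        ∀ k ∈ K1, ∀ k' ∈ K1, k ≠ k' → ∀ l ∈ L1, ∀ m ∈ M1,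
          ε / 2 ≤ pr (fun w => lk P F q l k k' w ∧ lk P F q m k k' w) := by
  obtain ⟨η, hη, hT⟩ := lemT hε hδ
  obtain ⟨NT, hNT⟩ := exists_nat_gt (1 / η)
  have hNT0 : (0:ℝ) < NT := lt_trans (by positivity) hNT
  obtain ⟨R, hR⟩ := ramseyk NT s (p * p)
  obtain ⟨P0, hP0⟩ := exists_nat_gt ((R:ℝ)^3 / η)
  let Pn := P0 + p
  let t1 := R * 3 ^ ((Pn + Pn) * (Pn + Pn) - (Pn + Pn))
  obtain ⟨N, hN⟩ := ramseyk n0 t1 (Pn + Pn)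
  refine ⟨Pn, N, η, hη, ?_⟩
  intro ι V X _ _ P hd hf Φ hsy hw F hF q K L M hKL hKM hLM hK hL hM hdn hcert
  have hLMc : (L ∪ M).card = Pn + Pn := by rw [Finset.card_union_of_disjoint hLM, hL, hM]
  obtain ⟨T, hTK, hTc, hT1⟩ := hN X X K (L ∪ M) hK hLMc
    (fun b x y => pr (fun w => lk P F q b x y w ∧ Φ (F x) (F y) w) < δ')
    (by
      intro b x y h
      refine lt_of_le_of_lt (pr_mono fun w hw => ?_) h
      exact ⟨lk_sy P F q b _ _ _ hw.1, hsy _ _ _ hw.2⟩)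
    (by
      intro b hb K0 hK0 hc
      obtain ⟨k, hk, k', hk', hne, h⟩ := hcert b (Finset.mem_union.1 hb) K0 hK0 hc
      exact ⟨k, hk, k', hk', hne, not_lt.2 h⟩)
  push Not at hT1
  have hdisj : ∀ b ∈ L ∪ M, ∀ a ∈ K, b ≠ a := by
    intro b hb a ha hba
    subst hba
    rcases Finset.mem_union.1 hb with h | h
    · exact Finset.disjoint_left.1 hKL ha h
    · exact Finset.disjoint_left.1 hKM ha h
  obtain ⟨K', hK'T, hK'c, hK'⟩ := d1 hf (dense_mono hd (by linarith)) (L ∪ M) T F F hF.injOn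
    (fun b hb a ha => hF.ne (hdisj b hb a (hTK ha))) q
  have hRle : R ≤ K'.card := by
    rw [Finset.offDiag_card, hLMc, hTc] at hK'c
    have : (R:ℝ) ≤ K'.card := by
      refine le_trans (le_of_eq ?_) hK'c
      simp only [t1]; push_cast
      rw [mul_comm (R:ℝ), ← mul_assoc, ← mul_pow]; norm_num
    exact_mod_cast this
  obtain ⟨K2, hK2, hK2c⟩ := Finset.exists_subset_card_eq hRle
  let tr : X → X → X → X → ℝ := fun b a a' a'' => tri P (F a) (F a') (F a'') (lk P F q b a a') (lk P F q b a a'') (lk P F q b a' a'')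
  have trnn : ∀ b a a' a'', 0 ≤ tr b a a' a'' := fun b a a' a'' =>
    ex_nonneg fun _ => ex_nonneg fun _ => ex_nonneg fun _ => ind_nonneg _
  let Bd := (L ∪ M).filter fun b => ¬ ∀ a ∈ K2, ∀ a' ∈ K2, ∀ a'' ∈ K2, tr b a a' a'' ≤ η
  have hBd : Bd.card < P0 := by
    have h1 : (Bd.card : ℝ) * η ≤ ∑ b ∈ Bd, ∑ a ∈ K2, ∑ a' ∈ K2, ∑ a'' ∈ K2, tr b a a' a'' := by
      rw [← nsmul_eq_mul]
      refine Finset.card_nsmul_le_sum _ _ _ fun b hb => ?_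
      have := (Finset.mem_filter.1 hb).2
      push Not at this
      obtain ⟨a, ha, a', ha', a'', ha'', h⟩ := this
      refine h.le.trans ?_
      refine le_trans ?_ (Finset.single_le_sum (f := fun a => ∑ a' ∈ K2, ∑ a'' ∈ K2, tr b a a' a'') (fun _ _ => Finset.sum_nonneg fun _ _ => Finset.sum_nonneg fun _ _ => trnn _ _ _ _) ha)
      refine le_trans ?_ (Finset.single_le_sum (f := fun a' => ∑ a'' ∈ K2, tr b a a' a'') (fun _ _ => Finset.sum_nonneg fun _ _ => trnn _ _ _ _) ha')
      exact Finset.single_le_sum (f := fun a'' => tr b a a' a'') (fun _ _ => trnn _ _ _ _) ha''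
    have h2 : ∑ b ∈ Bd, ∑ a ∈ K2, ∑ a' ∈ K2, ∑ a'' ∈ K2, tr b a a' a'' ≤ (R:ℝ)^3 := by
      rw [Finset.sum_comm]
      have : (R:ℝ)^3 = ∑ a ∈ K2, ∑ a' ∈ K2, ∑ a'' ∈ K2, (1:ℝ) := by simp [hK2c]; ring
      rw [this]
      refine Finset.sum_le_sum fun a ha => ?_
      rw [Finset.sum_comm]
      refine Finset.sum_le_sum fun a' ha' => ?_
      rw [Finset.sum_comm]
      refine Finset.sum_le_sum fun a'' ha'' => ?_
      refine le_trans ?_ (hK' a (hK2 ha) a' (hK2 ha') a'' (hK2 ha''))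
      exact Finset.sum_le_sum_of_subset_of_nonneg (Finset.filter_subset _ _) fun _ _ _ => trnn _ _ _ _
    rw [div_lt_iff₀ hη] at hP0
    have : (Bd.card : ℝ) < P0 := by nlinarith
    exact_mod_cast this
  have pick : ∀ S ⊆ L ∪ M, S.card = Pn → ∃ S1 ⊆ S, S1.card = p ∧ ∀ b ∈ S1, ∀ a ∈ K2, ∀ a' ∈ K2, ∀ a'' ∈ K2, tr b a a' a'' ≤ η := by
    intro S hS hc
    have : p ≤ (S \ Bd).card := by
      have := Finset.le_card_sdiff Bd S
      simp only [Pn] at hc; omega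
    obtain ⟨S1, h1, h2⟩ := Finset.exists_subset_card_eq this
    refine ⟨S1, fun x hx => (Finset.mem_sdiff.1 (h1 hx)).1, h2, fun b hb => ?_⟩
    have h3 := Finset.mem_sdiff.1 (h1 hb)
    by_contra hcon
    exact h3.2 (Finset.mem_filter.2 ⟨hS h3.1, hcon⟩)
  obtain ⟨L1, hL1, hL1c, hL1g⟩ := pick L Finset.subset_union_left hL
  obtain ⟨M1, hM1, hM1c, hM1g⟩ := pick M Finset.subset_union_right hM
  have hK2K : K2 ⊆ K := fun x hx => hTK (hK'T (hK2 hx))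
  obtain ⟨K1, hK1, hK1c, hK1g⟩ := hR X (X × X) K2 (L1 ×ˢ M1) (by omega) (by rw [Finset.card_product, hL1c, hM1c])
    (fun b x y => pr (fun w => lk P F q b.1 x y w ∧ lk P F q b.2 x y w) < ε / 2)
    (by
      intro b x y h
      refine lt_of_le_of_lt (pr_mono fun w hw => ?_) h
      exact ⟨lk_sy P F q _ _ _ _ hw.1, lk_sy P F q _ _ _ _ hw.2⟩)
    (by
      rintro ⟨l, m⟩ hlm S0 hS0 hS0c
      obtain ⟨hl, hm⟩ := Finset.mem_product.1 hlm
      have hS0ne : Nonempty S0 := by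
        have : 0 < S0.card := by rw [hS0c]; exact_mod_cast hNT0
        obtain ⟨x, hx⟩ := Finset.card_pos.1 this
        exact ⟨⟨x, hx⟩⟩
      let G : S0 → ι := fun x => F x
      have hG : Function.Injective G := fun x y h => Subtype.ext (hF h)
      have hlU : l ∈ L ∪ M := Finset.mem_union_left _ (hL1 hl)
      have hmU : m ∈ L ∪ M := Finset.mem_union_right _ (hM1 hm)
      have wd : ∀ b ∈ L ∪ M, Wd (fun x y : S0 => lk P F q b x y) (1/3) := by
        intro b hb x y hxy
        have h1 := hdisj b hb x (hK2K (hS0 x.2))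
        have h2 := hdisj b hb y (hK2K (hS0 y.2))
        have := hd (F b) (F x) (F y) (hF.ne h1) (hF.ne h2) (hG.ne hxy) (q b x) (q b y)
        exact le_trans (by linarith) this
      have dle : ∀ g : S0 → S0 → S0 → ℝ, (∀ x y z, g x y z ≤ η) → (ex fun x => ex fun y => ex fun z => g x y z) ≤ η :=
        fun g hg => ex_le_of fun x => ex_le_of fun y => ex_le_of fun z => hg x y z
      obtain ⟨j, k, hjk, h⟩ := hT S0 V (P.comap G) (comap_dense hd hG) (comap_free hf G)
        (fun x y => lk P F q l x y) (fun x y => Φ (F x) (F y)) (fun x y => lk P F q m x y)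
        (fun x y w h => lk_sy P F q l _ _ _ h) (fun x y w h => hsy _ _ _ h) (fun x y w h => lk_sy P F q m _ _ _ h)
        (wd l hlU) (fun x y hxy => hw _ _ (hG.ne hxy)) (wd m hmU)
        (dle _ fun x y z => hL1g l hl x (hS0 x.2) y (hS0 y.2) z (hS0 z.2))
        (dle _ fun x y z => by
          by_cases hne : x ≠ y ∧ x ≠ z ∧ y ≠ z
          · exact hdn x (hK2K (hS0 x.2)) y (hK2K (hS0 y.2)) z (hK2K (hS0 z.2)) (fun h => hne.1 (Subtype.ext h)) (fun h => hne.2.1 (Subtype.ext h)) (fun h => hne.2.2 (Subtype.ext h))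
          · refine le_trans (le_of_eq ?_) hη.le
            unfold dn; rw [tri_eq_pr]
            exact pr_false fun u hu => hne ((P.comap G).ne _ _ _ _ _ _ hu.2.2.2))
        (dle _ fun x y z => hM1g m hm x (hS0 x.2) y (hS0 y.2) z (hS0 z.2))
        (by
          rw [Fintype.card_coe, hS0c]
          rw [div_lt_iff₀ hη] at hNT
          rw [div_le_iff₀ hNT0]; linarith)
        (fun x y hxy => hT1 x (hK'T (hK2 (hS0 x.2))) y (hK'T (hK2 (hS0 y.2))) (fun h => hxy (Subtype.ext h)) l hlU)
        (fun x y hxy => (hT1 x (hK'T (hK2 (hS0 x.2))) y (hK'T (hK2 (hS0 y.2))) (fun h => hxy (Subtype.ext h)) m hmU).trans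
          (pr_mono fun w h => ⟨h.2, h.1⟩))
      exact ⟨j, j.2, k, k.2, fun h => hjk (Subtype.ext h), not_lt.2 h⟩)
  refine ⟨K1, fun x hx => hK2K (hK1 hx), L1, hL1, M1, hM1, hK1c, hL1c, hM1c, ?_⟩
  intro k hk k' hk' hne l hl m hm
  exact not_lt.1 (hK1g k hk k' hk' hne (l, m) (Finset.mem_product.2 ⟨hl, hm⟩))



theorem ind_markov {f θ : ℝ} (hf : 0 ≤ f) (hθ : 0 < θ) : ind (θ ≤ f) ≤ f * θ⁻¹ := by
  by_cases h : θ ≤ f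
  · rw [ind_t h, ← div_eq_mul_inv, le_div_iff₀ hθ]; linarith
  · rw [ind_f h]; positivity

theorem lemU {ε δ μ : ℝ} (hε : 0 < ε) (hδ : 0 < δ) (hμ : 0 < μ) : ∃ η : ℝ, 0 < η ∧
    ∀ (ι V : Type) [Fintype ι] [Fintype V] [Nonempty ι] [Nonempty V] (P : Pal ι V),
      P.Dense (1/3 + ε) → P.Free → ∀ Φ Ω : ι → ι → V → Prop, Sy Φ → Wd Φ (1/3) → dens3 P Φ ≤ η →
      Sy Ω → dens3 P Ω ≤ η → ((∀ i j u, ¬ Ω i j u) ∨ Wd Ω (1/3)) →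
      (ex fun i => ex fun j => pr (fun w => Φ i j w ∧ Ω i j w)) ≤ η → 1 / (Fintype.card ι : ℝ) ≤ η →
      dens3 P (fun i j u => Ω i j u ∨ pop P δ Φ i j u) ≤ μ := by
  obtain ⟨sA, hsA⟩ := exists_nat_gt (2 / ε)
  obtain ⟨sB, hsB⟩ := exists_nat_gt (1 / (ε/2) ^ (sA * sA - sA))
  obtain ⟨Nc, ηc, hNc, hηc, hC⟩ := cert hε hδ
  obtain ⟨P2, N2, η2, hη2, hS2⟩ := side hε (half_pos hε) (Nc + 1) sB sA
  obtain ⟨P1, N1, η1, hη1, hS1⟩ := side hε (half_pos hε) (Nc + 1) P2 (N2 + P2)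
  let t := N1 + P1 + 1
  obtain ⟨η0, hη0, hsam⟩ := sample t hμ
  let ηT := min η1 η2
  have hηT : 0 < ηT := lt_min hη1 hη2
  have hθ : 0 < ε / 8 := by positivity
  let m0 := min 1 (min ηT (min ηc (ε/8)))
  have hm0 : 0 < m0 := lt_min one_pos (lt_min hηT (lt_min hηc hθ))
  have m1 : m0 ≤ 1 := min_le_left _ _
  have m2 : m0 ≤ ηT := (min_le_right _ _).trans (min_le_left _ _)
  have m3 : m0 ≤ ηc := (min_le_right _ _).trans ((min_le_right _ _).trans (min_le_left _ _))
  have m4 : m0 ≤ ε/8 := (min_le_right _ _).trans ((min_le_right _ _).trans (min_le_right _ _))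
  refine ⟨min ηc (η0 / 6 * m0), by positivity, ?_⟩
  intro ι V _ _ _ _ P hd hf Φ Ω hΦs hΦw hΦd hΩs hΩd hΩw hov hc
  by_contra hcon; push Not at hcon
  have q1 := hΦd.trans (min_le_right _ _)
  have q2 := hΩd.trans (min_le_right _ _)
  have q3 := hov.trans (min_le_right _ _)
  have q4 := hc.trans (min_le_right _ _)
  have hrate : ∀ {x θ : ℝ}, x ≤ η0 / 6 * m0 → m0 ≤ θ → x * θ⁻¹ ≤ η0 / 6 := by
    intro x θ hx hm
    have : 0 < θ := lt_of_lt_of_le hm0 hm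
    rw [← div_eq_mul_inv, div_le_iff₀ this]
    refine hx.trans ?_
    gcongr
  set Ψ : ι → ι → V → Prop := fun i j u => Ω i j u ∨ pop P δ Φ i j u with hΨdef
  have hΨs : Sy Ψ := by
    rintro i j u (h | h)
    · exact Or.inl (hΩs _ _ _ h)
    · exact Or.inr (pop_sy P δ Φ _ _ _ h)
  obtain ⟨F, C, hm, hfb⟩ := hsam ι V
    (fun i j k u v w => Ψ i j u ∧ Ψ i k v ∧ Ψ j k w ∧ P.E i j k u v w)
    (fun i j k u v w => i = j ∨ bad P (ε/8) Ω i j k u v ∨ ηT ≤ dn P Φ i j k ∨ ηc ≤ (ex fun a => dn P Φ a i j) ∨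
      ηc ≤ (ex fun a => ex fun b => dn P Φ i a b) ∨ ε/8 ≤ pr (fun w => Φ i j w ∧ Ω i j w)) hcon.le (by
      refine (d6_or _ _).trans ?_
      refine (add_le_add le_rfl (d6_or _ _)).trans ?_
      refine (add_le_add le_rfl (add_le_add le_rfl (d6_or _ _))).trans ?_
      refine (add_le_add le_rfl (add_le_add le_rfl (add_le_add le_rfl (d6_or _ _)))).trans ?_
      refine (add_le_add le_rfl (add_le_add le_rfl (add_le_add le_rfl (add_le_add le_rfl (d6_or _ _))))).trans ?_
      rw [d6_eq]
      have e1 : 1 / (Fintype.card ι : ℝ) ≤ η0 / 6 := by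
        refine q4.trans ?_
        have : 0 < η0 / 6 := by positivity
        nlinarith
      have e2 := (d6_bad P hθ Ω)
      rw [div_eq_mul_inv] at e2
      have e2' := e2.trans (hrate q2 m4)
      have e3 : d6 (fun i j k (_ _ _ : V) => ηT ≤ dn P Φ i j k) ≤ η0 / 6 := by
        rw [d6_idx]
        refine le_trans ?_ (hrate q1 m2)
        unfold dens3
        simp only [← ex_mul']
        exact ex_mono fun i => ex_mono fun j => ex_mono fun k => ind_markov (dn_nonneg _ _ _ _ _) hηT
      have e4 : d6 (fun i j (_ : ι) (_ _ _ : V) => ηc ≤ (ex fun a => dn P Φ a i j)) ≤ η0 / 6 := by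
        rw [d6_idx]
        refine le_trans ?_ (hrate q1 m3)
        have : dens3 P Φ = ex fun i => ex fun j => ex fun a => dn P Φ a i j := by
          unfold dens3; rw [ex_rot, ex_rot]
        rw [this]
        simp only [ex_const]
        rw [← ex_mul']
        refine ex_mono fun i => ?_
        rw [← ex_mul']
        exact ex_mono fun j => ind_markov (ex_nonneg fun _ => dn_nonneg _ _ _ _ _) hηc
      have e5 : d6 (fun i (_ _ : ι) (_ _ _ : V) => ηc ≤ (ex fun a => ex fun b => dn P Φ i a b)) ≤ η0 / 6 := by
        rw [d6_idx]
        refine le_trans ?_ (hrate q1 m3)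
        unfold dens3
        simp only [ex_const]
        rw [← ex_mul']
        exact ex_mono fun i => ind_markov (ex_nonneg fun _ => ex_nonneg fun _ => dn_nonneg _ _ _ _ _) hηc
      have e6 : d6 (fun i j (_ : ι) (_ _ _ : V) => ε/8 ≤ pr (fun w => Φ i j w ∧ Ω i j w)) ≤ η0 / 6 := by
        rw [d6_idx]
        refine le_trans ?_ (hrate q3 m4)
        simp only [ex_const]
        rw [← ex_mul']
        refine ex_mono fun i => ?_
        rw [← ex_mul']
        exact ex_mono fun j => ind_markov (pr_nonneg _) hθ
      refine (add_le_add e1 (add_le_add e2' (add_le_add e3 (add_le_add e4 (add_le_add e5 e6))))).trans ?_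
      linarith)
  let X := Fin 3 × Fin t
  have ht : 0 < t := by omega
  let c0 : Fin t := ⟨0, ht⟩
  have third : ∀ x y : X, ∃ z : X, z ≠ x ∧ z ≠ y := by
    intro x y
    have : ∃ i : Fin 3, i ≠ x.1 ∧ i ≠ y.1 := by
      generalize x.1 = a; generalize y.1 = b; revert a b; decide
    obtain ⟨i, h1, h2⟩ := this
    exact ⟨(i, c0), fun h => h1 (congrArg Prod.fst h), fun h => h2 (congrArg Prod.fst h)⟩
  have hF : Function.Injective F := by
    intro x y he
    by_contra hxy
    obtain ⟨z, h1, h2⟩ := third x y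
    exact hfb x y z hxy h1.symm h2.symm (Or.inl he)
  have g1 : ∀ x y : X, x ≠ y → (ex fun a => dn P Φ a (F x) (F y)) ≤ ηc ∧ (ex fun a => ex fun b => dn P Φ (F x) a b) ≤ ηc ∧
      pr (fun w => Φ (F x) (F y) w ∧ Ω (F x) (F y) w) ≤ ε/8 := by
    intro x y hxy
    obtain ⟨z, h1, h2⟩ := third x y
    have := hfb x y z hxy h1.symm h2.symm
    simp only [not_or, not_le] at this
    exact ⟨this.2.2.2.1.le, this.2.2.2.2.1.le, this.2.2.2.2.2.le⟩
  have g2 : ∀ x y z : X, x ≠ y → x ≠ z → y ≠ z → dn P Φ (F x) (F y) (F z) ≤ ηT ∧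
      ¬ bad P (ε/8) Ω (F x) (F y) (F z) (C s(x, y)) (C s(x, z)) := by
    intro x y z h1 h2 h3
    have := hfb x y z h1 h2 h3
    simp only [not_or, not_le] at this
    exact ⟨this.2.2.1.le, this.2.1⟩
  have g3 : ∀ x y : X, x.1 ≠ y.1 → Ψ (F x) (F y) (C s(x, y)) := by
    rintro ⟨i, a⟩ ⟨j, b⟩ hij
    fin_cases i <;> fin_cases j <;> simp at hij
    · exact (hm a b c0).1
    · exact (hm a c0 b).2.1
    · rw [Sym2.eq_swap]; exact hΨs _ _ _ (hm b a c0).1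
    · exact (hm c0 a b).2.2.1
    · rw [Sym2.eq_swap]; exact hΨs _ _ _ (hm b c0 a).2.1
    · rw [Sym2.eq_swap]; exact hΨs _ _ _ (hm c0 b a).2.2.1
  let q : X → X → V := fun b k => C s(b, k)
  have hcert : ∀ (b : X) (K0 : Finset X), (∀ k ∈ K0, b.1 ≠ k.1) → K0.card = Nc + 1 → ∃ k ∈ K0, ∃ k' ∈ K0, k ≠ k' ∧
        ε / 2 ≤ pr (fun w => lk P F q b k k' w ∧ Φ (F k) (F k') w) := by
    intro b K0 hb hK0
    have hbk : ∀ k ∈ K0, b ≠ k := fun k hk h => hb k hk (congrArg Prod.fst h)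
    by_cases htwo : ∃ k ∈ K0, ∃ k' ∈ K0, k ≠ k' ∧ Ω (F b) (F k) (C s(b, k)) ∧ Ω (F b) (F k') (C s(b, k'))
    · obtain ⟨k, hk, k', hk', hne, o1, o2⟩ := htwo
      refine ⟨k, hk, k', hk', hne, ?_⟩
      have hΩw' : Wd Ω (1/3) := by
        rcases hΩw with h | h
        · exact absurd o1 (h _ _ _)
        · exact h
      have a1 := avoid (g2 b k k' (hbk k hk) (hbk k' hk') hne).2 o1 o2
      have a2 := (g1 k k' hne).2.2
      have a3 := inter3 (lk P F q b k k') (Φ (F k) (F k')) (Ω (F k) (F k'))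
      have a4 : 1/3 + ε ≤ pr (lk P F q b k k') := hd _ _ _ (hF.ne (hbk k hk)) (hF.ne (hbk k' hk')) (hF.ne hne) _ _
      have a5 := hΦw _ _ (hF.ne hne)
      have a6 := hΩw' _ _ (hF.ne hne)
      have a1' : pr (fun x => lk P F q b k k' x ∧ Ω (F k) (F k') x) ≤ ε/8 := a1
      linarith
    · have hle : Nc ≤ (K0.filter fun k => pop P δ Φ (F k) (F b) (C s(b, k))).card := by
        have h1 : (K0.filter fun k => ¬ pop P δ Φ (F k) (F b) (C s(b, k))).card ≤ 1 := by
          rw [Finset.card_le_one]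
          intro x hx y hy
          by_contra hxy
          obtain ⟨hx1, hx2⟩ := Finset.mem_filter.1 hx
          obtain ⟨hy1, hy2⟩ := Finset.mem_filter.1 hy
          refine htwo ⟨x, hx1, y, hy1, hxy, ?_, ?_⟩
          · rcases g3 b x (hb x hx1) with h | h
            · exact h
            · exact absurd (pop_sy P δ Φ _ _ _ h) hx2
          · rcases g3 b y (hb y hy1) with h | h
            · exact h
            · exact absurd (pop_sy P δ Φ _ _ _ h) hy2
        have := Finset.card_filter_add_card_filter_not (s := K0) (fun k => pop P δ Φ (F k) (F b) (C s(b, k)))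
        rw [hK0] at this
        have h1' : _ ≤ 1 := le_trans (le_of_eq (by congr)) h1
        exact Nat.le_of_add_le_add_right (this.symm.le.trans (Nat.add_le_add_left h1' _))
      obtain ⟨K3, hK3, hK3c⟩ := Finset.exists_subset_card_eq hle
      let e := (K3.equivFinOfCardEq hK3c).symm
      have he : Function.Injective (fun i => (e i : X)) := fun i j h => e.injective (Subtype.ext h)
      have hmem : ∀ i, (e i : X) ∈ K0 := fun i => (Finset.mem_filter.1 (hK3 (e i).2)).1
      obtain ⟨i, j, hij, h⟩ := hC ι V P hd hf Φ hΦs hΦw (fun i => F (e i)) (hF.comp he) (F b) (fun i => C s(b, (e i : X)))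
        (fun i => (Finset.mem_filter.1 (hK3 (e i).2)).2)
        (fun i j hij => (g1 _ _ (he.ne hij)).1)
        (fun i => (g1 _ _ (hbk _ (hmem i)).symm).2.1)
        ((g1 _ _ (hbk _ (hmem ⟨0, hNc⟩))).2.1) (hc.trans (min_le_left _ _))
      refine ⟨e i, hmem i, e j, hmem j, he.ne hij, (by linarith : ε / 2 ≤ ε).trans (h.trans (pr_mono fun w hw => ⟨?_, hw.2⟩))⟩
      exact rot.2 hw.1
  let pt : Fin 3 → Fin t → X := fun i a => (i, a)
  have hpt : ∀ i, Function.Injective (pt i) := fun i a b h => congrArg Prod.snd h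
  let pos : Fin 3 → Finset X := fun i => univ.image (pt i)
  have hposc : ∀ i, (pos i).card = t := fun i => by
    rw [Finset.card_image_of_injective _ (hpt i), Finset.card_univ, Fintype.card_fin]
  have hpos1 : ∀ i x, x ∈ pos i → x.1 = i := by
    intro i x hx
    obtain ⟨a, -, rfl⟩ := Finset.mem_image.1 hx; rfl
  obtain ⟨L, hLs, hLc⟩ := Finset.exists_subset_card_eq (s := pos 1) (n := P1) (by rw [hposc]; omega)
  obtain ⟨M, hMs, hMc⟩ := Finset.exists_subset_card_eq (s := pos 2) (n := P1) (by rw [hposc]; omega)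
  have dj : ∀ (i j : Fin 3) (A B : Finset X), i ≠ j → (∀ x ∈ A, x.1 = i) → (∀ x ∈ B, x.1 = j) → Disjoint A B := by
    intro i j A B hij hA hB
    rw [Finset.disjoint_left]; intro x h1 h2; exact hij ((hA x h1).symm.trans (hB x h2))
  have hK1 := hpos1 0
  have hL1 : ∀ x ∈ L, x.1 = 1 := fun x hx => hpos1 1 x (hLs hx)
  have hM1 : ∀ x ∈ M, x.1 = 2 := fun x hx => hpos1 2 x (hMs hx)
  obtain ⟨Ka, hKa, La, hLa, Ma, hMa, hKac, hLac, hMac, S1⟩ := hS1 ι V X P hd hf Φ hΦs hΦw F hF q (pos 0) L M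
    (dj 0 1 _ _ (by decide) hK1 hL1) (dj 0 2 _ _ (by decide) hK1 hM1) (dj 1 2 _ _ (by decide) hL1 hM1)
    (by rw [hposc]; omega) hLc hMc
    (fun a _ b _ c _ h1 h2 h3 => (g2 a b c h1 h2 h3).1.trans (min_le_left _ _))
    (by
      intro b hb K0 hK0 hc0
      refine hcert b K0 (fun k hk => ?_) hc0
      rw [hK1 k (hK0 hk)]
      rcases hb with h | h
      · rw [hL1 b h]; decide
      · rw [hM1 b h]; decide)
  obtain ⟨Mb, hMb, hMbc⟩ := Finset.exists_subset_card_eq (s := Ma) (n := P2) (by omega)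
  have hKa1 : ∀ x ∈ Ka, x.1 = 0 := fun x hx => hK1 x (hKa hx)
  have hLa1 : ∀ x ∈ La, x.1 = 1 := fun x hx => hL1 x (hLa hx)
  have hMb1 : ∀ x ∈ Mb, x.1 = 2 := fun x hx => hM1 x (hMa (hMb hx))
  obtain ⟨Lb, hLb, Kb, hKb, Mc, hMc2, hLbc, hKbc, hMcc, S2⟩ := hS2 ι V X P hd hf Φ hΦs hΦw F hF q La Ka Mb
    (dj 1 0 _ _ (by decide) hLa1 hKa1) (dj 1 2 _ _ (by decide) hLa1 hMb1) (dj 0 2 _ _ (by decide) hKa1 hMb1)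
    (by omega) hKac hMbc
    (fun a _ b _ c _ h1 h2 h3 => (g2 a b c h1 h2 h3).1.trans (min_le_right _ _))
    (by
      intro b hb K0 hK0 hc0
      refine hcert b K0 (fun k hk => ?_) hc0
      rw [hLa1 k (hK0 hk)]
      rcases hb with h | h
      · rw [hKa1 b h]; decide
      · rw [hMb1 b h]; decide)
  have hsA0 : (0:ℝ) < sA := lt_trans (by positivity) hsA
  obtain ⟨m, hm'⟩ : Mc.Nonempty := by
    rw [← Finset.card_pos, hMcc]; exact_mod_cast hsA0
  have hmMa : m ∈ Ma := hMb (hMc2 hm')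
  have form : ∀ x : X, ∀ i, x.1 = i → x = (i, x.2) := fun x i h => by rw [← h]
  obtain ⟨l, hl, l', hl', hll, hsum⟩ := core2 hf Kb Lb F F (F m) (fun k l => C s(k, l)) (fun k => C s(k, m)) (fun l => C s(l, m))
    (by
      intro k hk l hl
      have e1 := form k 0 (hKa1 k (hKb hk))
      have e2 := form l 1 (hLa1 l (hLb hl))
      have e3 := form m 2 (hM1 m (hMa hmMa))
      rw [e1, e2, e3]; exact (hm _ _ _).2.2.2) (half_pos hε).le
    (by
      intro k hk k' hk' hne l hl
      refine (S1 k (hKb hk) k' (hKb hk') hne l (hLb hl) m hmMa).trans (pr_mono fun w hw => ?_)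
      have h1 := rot.1 hw.1
      have h2 := rot.1 hw.2
      simp only [q] at h1 h2
      rw [Sym2.eq_swap (a := k), Sym2.eq_swap (a := k'), Sym2.eq_swap (a := k), Sym2.eq_swap (a := k')]
      exact ⟨h1, h2⟩)
    (by
      rw [Finset.offDiag_card, hKbc, hLbc]
      have hp : 0 < (ε/2) ^ (sA * sA - sA) := by positivity
      rw [div_lt_iff₀ hp] at hsB
      linarith)
  have hlow : ∀ k ∈ Kb, ε / 2 ≤ pr (fun v => P.E (F k) (F l) (F l') (C s(k, l)) (C s(k, l')) v ∧
      P.E (F l) (F l') (F m) v (C s(l, m)) (C s(l', m))) := by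
    intro k hk
    refine (S2 l hl l' hl' hll k hk m hm').trans (pr_mono fun w hw => ⟨hw.1, ?_⟩)
    have h2 := rot.1 hw.2
    simp only [q] at h2
    rw [Sym2.eq_swap (a := l), Sym2.eq_swap (a := l')]
    exact h2
  have := Finset.sum_le_sum hlow
  rw [Finset.sum_const, hKbc, nsmul_eq_mul] at this
  rw [div_lt_iff₀ hε] at hsA
  linarith



theorem init_hole {ε η : ℝ} (hε : 0 < ε) (hη : 0 < η) (t : ℕ) : ∃ N : ℕ,
    ∀ (ι V : Type) [Fintype ι] [Fintype V] [Nonempty V] (P : Pal ι V),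
      P.Dense (1/3 + ε) → P.Free → N ≤ Fintype.card ι →
      ∃ f : Fin t → ι, Function.Injective f ∧ ∃ Φ : Fin t → Fin t → V → Prop, Sy Φ ∧ Wd Φ (1/3) ∧
        ∀ i j k, dn (P.comap f) Φ i j k ≤ η := by
  obtain ⟨S, hS⟩ := exists_nat_gt ((t:ℝ)^3 / η)
  have hS0 : (0:ℝ) < S := lt_of_le_of_lt (by positivity) hS
  refine ⟨S + t * 3 ^ (S * S - S), ?_⟩
  intro ι V _ _ _ P hd hf hN
  obtain ⟨L, -, hL⟩ := Finset.exists_subset_card_eq (s := (univ : Finset ι)) (n := S) (by rw [Finset.card_univ]; omega)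
  let v0 : V := Classical.arbitrary V
  have hLK : ∀ b ∈ L, ∀ a ∈ Lᶜ, b ≠ a := by
    intro b hb a ha h; subst h; exact (Finset.mem_compl.1 ha) hb
  obtain ⟨K', hK's, hK'c, hK'⟩ := d1 hf (dense_mono hd (by linarith)) L Lᶜ id id (fun x _ y _ h => h) hLK (fun _ _ => v0)
  have ht : t ≤ K'.card := by
    have h1 : t * 3 ^ (S * S - S) ≤ (Lᶜ).card := by rw [Finset.card_compl, hL]; omega
    have h1' : (t:ℝ) * 3 ^ (S * S - S) ≤ (Lᶜ).card := by exact_mod_cast h1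
    rw [Finset.offDiag_card, hL] at hK'c
    have : (t:ℝ) ≤ K'.card := by
      refine le_trans ?_ hK'c
      refine le_trans (le_of_eq ?_) (mul_le_mul_of_nonneg_left h1' (by positivity))
      rw [mul_comm (t:ℝ), ← mul_assoc, ← mul_pow]; norm_num
    exact_mod_cast this
  obtain ⟨K2, hK2, hK2c⟩ := Finset.exists_subset_card_eq ht
  let e := (K2.equivFinOfCardEq hK2c).symm
  let f : Fin t → ι := fun i => e i
  have hfi : Function.Injective f := fun i j h => e.injective (Subtype.ext h)
  have hfK : ∀ i, f i ∈ K' := fun i => hK2 (e i).2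
  let tr : ι → Fin t → Fin t → Fin t → ℝ := fun b i j k => dn (P.comap f) (fun x y => P.E b (f x) (f y) v0 v0) i j k
  have trnn : ∀ b i j k, 0 ≤ tr b i j k := fun b i j k => dn_nonneg _ _ _ _ _
  have hsum : ∑ b ∈ L, ∑ i, ∑ j, ∑ k, tr b i j k ≤ (t:ℝ)^3 := by
    rw [Finset.sum_comm]
    have : (t:ℝ)^3 = ∑ i : Fin t, ∑ j : Fin t, ∑ k : Fin t, (1:ℝ) := by simp; ring
    rw [this]
    refine Finset.sum_le_sum fun i _ => ?_
    rw [Finset.sum_comm]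
    refine Finset.sum_le_sum fun j _ => ?_
    rw [Finset.sum_comm]
    refine Finset.sum_le_sum fun k _ => ?_
    exact hK' (f i) (hfK i) (f j) (hfK j) (f k) (hfK k)
  obtain ⟨b, hb, hbs⟩ : ∃ b ∈ L, ∑ i, ∑ j, ∑ k, tr b i j k ≤ η := by
    by_contra hcon; push Not at hcon
    have := Finset.card_nsmul_le_sum L (fun b => ∑ i, ∑ j, ∑ k, tr b i j k) η fun b hb => (hcon b hb).le
    rw [hL, nsmul_eq_mul] at this
    rw [div_lt_iff₀ hη] at hS
    linarith
  refine ⟨f, hfi, fun x y => P.E b (f x) (f y) v0 v0, fun x y u h => P.s2 _ _ _ _ _ _ h, ?_, ?_⟩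
  · intro x y hxy
    exact le_trans (by linarith) (hd b (f x) (f y) (hLK b hb _ (hK's (hfK x))) (hLK b hb _ (hK's (hfK y))) (hfi.ne hxy) v0 v0)
  · intro i j k
    refine le_trans ?_ hbs
    refine le_trans ?_ (Finset.single_le_sum (f := fun a => ∑ a', ∑ a'', tr b a a' a'') (fun _ _ => Finset.sum_nonneg fun _ _ => Finset.sum_nonneg fun _ _ => trnn _ _ _ _) (mem_univ i))
    refine le_trans ?_ (Finset.single_le_sum (f := fun a' => ∑ a'', tr b i a' a'') (fun _ _ => Finset.sum_nonneg fun _ _ => trnn _ _ _ _) (mem_univ j))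
    exact Finset.single_le_sum (f := fun a'' => tr b i j a'') (fun _ _ => trnn _ _ _ _) (mem_univ k)

section
variable {ι V : Type} [Fintype V] [Fintype ι]

def itr (P : Pal ι V) (δ : ℝ) (Φ : ι → ι → V → Prop) : ℕ → ι → ι → V → Prop
  | 0 => Φ
  | s + 1 => fun i j u => Φ i j u ∨ pop P δ (pop P δ (itr P δ Φ s)) i j u

theorem itr_sub (P : Pal ι V) (δ : ℝ) (Φ : ι → ι → V → Prop) (s : ℕ) (i j : ι) (u : V) (h : Φ i j u) :
    itr P δ Φ s i j u := by
  cases s with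
  | zero => exact h
  | succ s => exact Or.inl h

theorem itr_sy (P : Pal ι V) (δ : ℝ) {Φ : ι → ι → V → Prop} (hΦ : Sy Φ) (s : ℕ) : Sy (itr P δ Φ s) := by
  cases s with
  | zero => exact hΦ
  | succ s =>
    rintro i j u (h | h)
    · exact Or.inl (hΦ _ _ _ h)
    · exact Or.inr (pop_sy _ _ _ _ _ _ h)

theorem itr_mono (P : Pal ι V) (δ : ℝ) (Φ : ι → ι → V → Prop) (s : ℕ) : ∀ (i j : ι) (u : V)
    (_ : itr P δ Φ s i j u), itr P δ Φ (s+1) i j u := by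
  induction s with
  | zero => intro i j u h; exact Or.inl h
  | succ s ih =>
    rintro i j u (h | h)
    · exact Or.inl h
    · exact Or.inr (pop_mono P δ (pop_mono P δ ih) i j u h)

theorem itr_wd (P : Pal ι V) (δ : ℝ) {Φ : ι → ι → V → Prop} {d : ℝ} (hΦ : Wd Φ d) (s : ℕ) : Wd (itr P δ Φ s) d :=
  fun i j hij => (hΦ i j hij).trans (pr_mono fun u h => itr_sub P δ Φ s i j u h)
end

theorem pop_dens {ε δ μ : ℝ} (hε : 0 < ε) (hδ : 0 < δ) (hμ : 0 < μ) : ∃ η : ℝ, 0 < η ∧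
    ∀ (ι V : Type) [Fintype ι] [Fintype V] [Nonempty ι] [Nonempty V] (P : Pal ι V),
      P.Dense (1/3 + ε) → P.Free → ∀ Φ : ι → ι → V → Prop, Sy Φ → Wd Φ (1/3) → dens3 P Φ ≤ η →
      1 / (Fintype.card ι : ℝ) ≤ η → dens3 P (pop P δ Φ) ≤ μ := by
  obtain ⟨η, hη, hU⟩ := lemU hε hδ hμ
  refine ⟨η, hη, fun ι V _ _ _ _ P hd hf Φ hs hw hde hc => ?_⟩
  have z : ∀ {X : Type} [Fintype X] (f : X → ℝ), (∀ x, f x = 0) → ex f = 0 := by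
    intro X _ f h; simp [ex, h]
  have := hU ι V P hd hf Φ (fun _ _ _ => False) hs hw hde (fun _ _ _ h => h)
    (le_trans (le_of_eq (z _ fun _ => z _ fun _ => z _ fun _ => z _ fun _ => z _ fun _ => z _ fun _ => ind_f (by tauto))) hη.le) (Or.inl fun _ _ _ h => h)
    (le_trans (le_of_eq (z _ fun _ => z _ fun _ => z _ fun _ => ind_f (by tauto))) hη.le) hc
  simpa using this

theorem itr_dens {ε δ : ℝ} (hε : 0 < ε) (hδ : 0 < δ) (hδε : δ ≤ ε / 20) (M : ℕ) : ∀ μ : ℝ, 0 < μ → ∃ η : ℝ, 0 < η ∧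
    ∀ (ι V : Type) [Fintype ι] [Fintype V] [Nonempty ι] [Nonempty V] (P : Pal ι V),
      P.Dense (1/3 + ε) → P.Free → ∀ Φ : ι → ι → V → Prop, Sy Φ → Wd Φ (1/3) → dens3 P Φ ≤ η →
      1 / (Fintype.card ι : ℝ) ≤ η → ∀ s ≤ M, dens3 P (itr P δ Φ s) ≤ μ ∧ dens3 P (pop P δ (itr P δ Φ s)) ≤ μ := by
  induction M with
  | zero =>
    intro μ hμ
    obtain ⟨η, hη, h⟩ := pop_dens hε hδ hμ
    refine ⟨min η μ, lt_min hη hμ, fun ι V _ _ _ _ P hd hf Φ hs hw hde hc s hsM => ?_⟩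
    obtain rfl : s = 0 := by omega
    exact ⟨hde.trans (min_le_right _ _), h ι V P hd hf Φ hs hw (hde.trans (min_le_left _ _)) (hc.trans (min_le_left _ _))⟩
  | succ M ih =>
    intro μ hμ
    obtain ⟨ηb, hηb, hb⟩ := pop_dens hε hδ hμ
    obtain ⟨ηa, hηa, ha⟩ := lemU hε hδ (lt_min hμ hηb)
    obtain ⟨η, hη, hih⟩ := ih (min μ (min ηa (δ * ηa))) (by positivity)
    refine ⟨min η (min ηb (min ηa (1/20))), by positivity, fun ι V _ _ _ _ P hd hf Φ hs hw hde hc s hsM => ?_⟩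
    have c1 := hc.trans (min_le_left _ _)
    have c2 := hc.trans ((min_le_right _ _).trans (min_le_left _ _))
    have c3 := hc.trans ((min_le_right _ _).trans ((min_le_right _ _).trans (min_le_left _ _)))
    have c4 := hc.trans ((min_le_right _ _).trans ((min_le_right _ _).trans (min_le_right _ _)))
    have hI := hih ι V P hd hf Φ hs hw (hde.trans (min_le_left _ _)) c1
    rcases Nat.lt_or_ge s (M + 1) with h | h
    · obtain ⟨h1, h2⟩ := hI s (by omega)
      exact ⟨h1.trans (min_le_left _ _), h2.trans (min_le_left _ _)⟩
    · obtain rfl : s = M + 1 := by omega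
      obtain ⟨h1, h2⟩ := hI M le_rfl
      have d1 : dens3 P (itr P δ Φ (M+1)) ≤ min μ ηb := by
        refine ha ι V P hd hf (pop P δ (itr P δ Φ M)) Φ (pop_sy _ _ _) (pop_wd hε hδ.le hδε hd (itr_sy P δ hs M) (itr_wd P δ hw M) c4)
          (h2.trans ((min_le_right _ _).trans (min_le_left _ _))) hs
          (hde.trans ((min_le_right _ _).trans ((min_le_right _ _).trans (min_le_left _ _)))) (Or.inr hw) ?_ c3
        have o := pop_ov_avg P (δ := δ) (itr P δ Φ M)
        have o2 := h1.trans ((min_le_right _ _).trans (min_le_right _ _))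
        have o3 := le_of_mul_le_mul_left (o.trans o2) hδ
        refine le_trans (ex_mono fun i => ex_mono fun j => pr_mono fun w hw => ?_) o3
        exact ⟨itr_sub P δ Φ M i j w hw.2, hw.1⟩
      exact ⟨d1.trans (min_le_left _ _), hb ι V P hd hf _ (itr_sy P δ hs _) (itr_wd P δ hw _) (d1.trans (min_le_right _ _)) c2⟩

theorem select {ι : Type} [Fintype ι] [Nonempty ι] (n : ℕ) (g : ι → ι → ι → ℝ) (hg : ∀ i j k, 0 ≤ g i j k) {κ : ℝ}
    (hκ : 0 < κ) (h : (n:ℝ)^3 * (ex fun i => ex fun j => ex fun k => g i j k) < κ) :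
    ∃ f : Fin n → ι, ∀ x y z, x ≠ y → x ≠ z → y ≠ z → g (f x) (f y) (f z) < κ := by
  have h1 := pr_ex_le (X := Fin n → ι) (univ : Finset (Fin n × Fin n × Fin n))
    (fun e f => (e.1 ≠ e.2.1 ∧ e.1 ≠ e.2.2 ∧ e.2.1 ≠ e.2.2) ∧ κ ≤ g (f e.1) (f e.2.1) (f e.2.2))
    (η := (ex fun i => ex fun j => ex fun k => g i j k) * κ⁻¹) (by
      rintro ⟨x, y, z⟩ -
      by_cases hne : x ≠ y ∧ x ≠ z ∧ y ≠ z
      · refine (pr_mono fun f hf => hf.2).trans ?_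
        unfold pr
        rw [ex_coord3 hne.1 hne.2.1 hne.2.2 (fun i j k => ind (κ ≤ g i j k))]
        simp only [← ex_mul']
        exact ex_mono fun i => ex_mono fun j => ex_mono fun k => ind_markov (hg i j k) hκ
      · rw [pr_false (fun f hf => hne hf.1)]
        have : 0 ≤ ex fun i => ex fun j => ex fun k => g i j k := ex_nonneg fun _ => ex_nonneg fun _ => ex_nonneg fun _ => hg _ _ _
        positivity)
  have h2 : ((univ : Finset (Fin n × Fin n × Fin n)).card : ℝ) = (n:ℝ)^3 := by
    simp [Finset.card_univ]; ring
  rw [h2] at h1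
  have h3 : (n:ℝ)^3 * ((ex fun i => ex fun j => ex fun k => g i j k) * κ⁻¹) < 1 := by
    rw [← mul_assoc, ← div_eq_mul_inv, div_lt_one hκ]; exact h
  obtain ⟨f, hf⟩ := pr_exists (p := fun f : Fin n → ι => ¬ ∃ e ∈ (univ : Finset (Fin n × Fin n × Fin n)), (e.1 ≠ e.2.1 ∧ e.1 ≠ e.2.2 ∧ e.2.1 ≠ e.2.2) ∧ κ ≤ g (f e.1) (f e.2.1) (f e.2.2)) (by
    rw [pr_not]; linarith)
  push Not at hf
  exact ⟨f, fun x y z a b c => hf (x, y, z) (mem_univ _) ⟨a, b, c⟩⟩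



def outc {ι V : Type} [Fintype V] (P : Pal ι V) (A B : ι → ι → V → Prop) (i j k : ι) : ℝ :=
  ex fun u => ex fun v => ex fun w => ind (A i j u ∧ A i k v ∧ P.E i j k u v w ∧ ¬ B j k w)

theorem outc_nonneg {ι V : Type} [Fintype V] (P : Pal ι V) (A B : ι → ι → V → Prop) (i j k : ι) :
    0 ≤ outc P A B i j k := ex_nonneg fun _ => ex_nonneg fun _ => ex_nonneg fun _ => ind_nonneg _

theorem ex_rot' {α β γ : Type} [Fintype α] [Fintype β] [Fintype γ] (f : α → β → γ → ℝ) :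
    (ex fun a => ex fun b => ex fun c => f a b c) = ex fun b => ex fun c => ex fun a => f a b c := by
  rw [ex_rot, ex_rot]

theorem outc_pop {ι V : Type} [Fintype V] [Fintype ι] [Nonempty ι] [Nonempty V] (P : Pal ι V) {δ : ℝ} (hδ : 0 ≤ δ)
    (A : ι → ι → V → Prop) : (ex fun i => ex fun j => ex fun k => outc P A (pop P δ A) i j k) ≤ δ := by
  rw [ex_rot']
  exact ex_le_of fun j => ex_le_of fun k => pop_out P hδ A j k

theorem holes_avg {ε μ : ℝ} (hε : 0 < ε) (hμ : 0 < μ) : ∃ η : ℝ, 0 < η ∧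
    ∀ (ι V : Type) [Fintype ι] [Fintype V] [Nonempty ι] [Nonempty V] (P : Pal ι V),
      P.Dense (1/3 + ε) → P.Free → ∀ Φ : ι → ι → V → Prop, Sy Φ → Wd Φ (1/3) → dens3 P Φ ≤ η →
      1 / (Fintype.card ι : ℝ) ≤ η → ∃ R G : ι → ι → V → Prop, Sy R ∧ Sy G ∧ Wd R (1/3) ∧ Wd G (1/3) ∧
        dens3 P R ≤ μ ∧ dens3 P G ≤ μ ∧ (ex fun i => ex fun j => ex fun k => outc P R G i j k) ≤ μ ∧
        (ex fun i => ex fun j => ex fun k => outc P G R i j k) ≤ μ ∧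
        (ex fun i => ex fun j => pr (fun w => R i j w ∧ G i j w)) ≤ μ := by
  obtain ⟨δ, hδ, hδε, hδμ⟩ : ∃ δ : ℝ, 0 < δ ∧ δ ≤ ε / 20 ∧ δ ≤ μ / 2 :=
    ⟨min (ε/20) (μ/2), by positivity, min_le_left _ _, min_le_right _ _⟩
  obtain ⟨M, hM⟩ := exists_nat_gt (2/μ)
  obtain ⟨η, hη, hI⟩ := itr_dens hε hδ hδε M (min μ (δ * μ)) (by positivity)
  refine ⟨min η (1/20), by positivity, fun ι V _ _ _ _ P hd hf Φ hs hw hde hc => ?_⟩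
  have hD := hI ι V P hd hf Φ hs hw (hde.trans (min_le_left _ _)) (hc.trans (min_le_left _ _))
  have hc' := hc.trans (min_le_right _ _)
  let a : ℕ → ℝ := fun s => ex fun i => ex fun j => pr (itr P δ Φ s i j)
  obtain ⟨s, hsM, hgap⟩ : ∃ s < M, a (s+1) - a s ≤ μ/2 := by
    by_contra hcon; push Not at hcon
    have h1 : ∀ s ≤ M, s * (μ/2) ≤ a s := by
      intro s
      induction s with
      | zero => intro _; simp only [Nat.cast_zero, zero_mul]; exact ex_nonneg fun _ => ex_nonneg fun _ => pr_nonneg _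
      | succ s ih => intro h; have := hcon s (by omega); have := ih (by omega); push_cast; linarith
    have h2 := h1 M le_rfl
    have h3 : a M ≤ 1 := ex_le_one fun _ => ex_le_one fun _ => pr_le_one _
    rw [div_lt_iff₀ hμ] at hM
    linarith
  obtain ⟨e1, e2⟩ := hD s hsM.le
  refine ⟨itr P δ Φ s, pop P δ (itr P δ Φ s), itr_sy P δ hs s, pop_sy _ _ _, itr_wd P δ hw s,
    pop_wd hε hδ.le hδε hd (itr_sy P δ hs s) (itr_wd P δ hw s) hc', e1.trans (min_le_left _ _),
    e2.trans (min_le_left _ _), (outc_pop P hδ.le _).trans (by linarith), ?_, ?_⟩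
  · have h1 := outc_pop P hδ.le (pop P δ (itr P δ Φ s))
    have h2 : (ex fun i => ex fun j => ex fun k => outc P (pop P δ (itr P δ Φ s)) (itr P δ Φ s) i j k) ≤
      (ex fun i => ex fun j => ex fun k => outc P (pop P δ (itr P δ Φ s)) (pop P δ (pop P δ (itr P δ Φ s))) i j k)
       + (ex fun _ : ι => ex fun j => ex fun k => (pr (itr P δ Φ (s+1) j k) - pr (itr P δ Φ s j k))) := by
      simp only [← ex_add]
      refine ex_mono fun i => ex_mono fun j => ex_mono fun k => ?_
      unfold outc pr
      have : ∀ g : V → ℝ, ex g = ex fun _ : V => ex fun _ : V => ex g := fun g => by rw [ex_const, ex_const]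
      rw [this (fun x => ind (itr P δ Φ (s+1) j k x)), this (fun x => ind (itr P δ Φ s j k x))]
      simp only [← ex_add, ← ex_sub]
      refine ex_mono fun u => ex_mono fun v => ex_mono fun w => ?_
      have hm := itr_mono P δ Φ s j k w
      have hm2 : pop P δ (pop P δ (itr P δ Φ s)) j k w → itr P δ Φ (s+1) j k w := Or.inr
      by_cases q1 : itr P δ Φ s j k w
      · rw [ind_f (p := _ ∧ _ ∧ _ ∧ _) (by tauto), ind_t q1, ind_t (hm q1)]
        have := ind_nonneg (pop P δ (itr P δ Φ s) i j u ∧ pop P δ (itr P δ Φ s) i k v ∧ P.E i j k u v w ∧ ¬pop P δ (pop P δ (itr P δ Φ s)) j k w)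
        linarith
      · rw [ind_f q1]
        by_cases q2 : pop P δ (pop P δ (itr P δ Φ s)) j k w
        · rw [ind_t (hm2 q2)]
          linarith [ind_le_one (pop P δ (itr P δ Φ s) i j u ∧ pop P δ (itr P δ Φ s) i k v ∧ P.E i j k u v w ∧ ¬itr P δ Φ s j k w), ind_nonneg (pop P δ (itr P δ Φ s) i j u ∧ pop P δ (itr P δ Φ s) i k v ∧ P.E i j k u v w ∧ ¬pop P δ (pop P δ (itr P δ Φ s)) j k w)]
        · have := ind_nonneg (itr P δ Φ (s+1) j k w)
          refine le_trans (ind_mono (q := pop P δ (itr P δ Φ s) i j u ∧ pop P δ (itr P δ Φ s) i k v ∧ P.E i j k u v w ∧ ¬pop P δ (pop P δ (itr P δ Φ s)) j k w) (by tauto)) (by linarith)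
    have h3 : (ex fun _ : ι => ex fun j => ex fun k => (pr (itr P δ Φ (s+1) j k) - pr (itr P δ Φ s j k))) = a (s+1) - a s := by
      rw [ex_const]; simp only [ex_sub]; rfl
    linarith
  · have o := pop_ov_avg P (δ := δ) (itr P δ Φ s)
    exact le_of_mul_le_mul_left (o.trans (e1.trans (min_le_right _ _))) hδ

theorem holes {ε κ : ℝ} (hε : 0 < ε) (hκ : 0 < κ) (hκ1 : κ ≤ 1) (n : ℕ) (hn : 3 ≤ n) : ∃ N : ℕ,
    ∀ (ι V : Type) [Fintype ι] [Fintype V] [Nonempty V] (P : Pal ι V),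
      P.Dense (1/3 + ε) → P.Free → N ≤ Fintype.card ι →
      ∃ f : Fin n → ι, Function.Injective f ∧ ∃ R G : Fin n → Fin n → V → Prop, Sy R ∧ Sy G ∧ Wd R (1/3) ∧ Wd G (1/3) ∧
        ∀ i j k, i ≠ j → i ≠ k → j ≠ k → dn (P.comap f) R i j k ≤ κ ∧ dn (P.comap f) G i j k ≤ κ ∧
          outc (P.comap f) R G i j k ≤ κ ∧ outc (P.comap f) G R i j k ≤ κ ∧ pr (fun w => R i j w ∧ G i j w) ≤ κ := by
  obtain ⟨μ, hμ, hμκ⟩ : ∃ μ : ℝ, 0 < μ ∧ (n:ℝ)^3 * (6*μ) < κ := by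
    have hn' : (0:ℝ) < n := by exact_mod_cast (by omega : 0 < n)
    refine ⟨κ / (12 * n^3), by positivity, ?_⟩
    have : (n:ℝ)^3 * (6 * (κ / (12 * n^3))) = κ / 2 := by field_simp; norm_num
    linarith
  obtain ⟨η, hη, hH⟩ := holes_avg hε hμ
  obtain ⟨t, ht⟩ := exists_nat_gt (1 / min η μ)
  have hm : 0 < min η μ := lt_min hη hμ
  have ht0 : (0:ℝ) < t := lt_of_le_of_lt (by positivity) ht
  have ht1 : 1 / (t:ℝ) ≤ min η μ := by
    rw [div_lt_iff₀ hm] at ht; rw [div_le_iff₀ ht0]; linarith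
  obtain ⟨N, hN⟩ := init_hole hε hη t
  refine ⟨N, fun ι V _ _ _ P hd hf hc => ?_⟩
  obtain ⟨f, hfi, Φ, hs, hw, hdn⟩ := hN ι V P hd hf hc
  haveI : Nonempty (Fin t) := ⟨⟨0, by exact_mod_cast ht0⟩⟩
  obtain ⟨R, G, sR, sG, wR, wG, dR, dG, o1, o2, ov⟩ := hH (Fin t) V (P.comap f) (comap_dense hd hfi) (comap_free hf f) Φ hs hw
    (ex_le_of fun i => ex_le_of fun j => ex_le_of fun k => hdn i j k) (by rw [Fintype.card_fin]; exact ht1.trans (min_le_left _ _))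
  obtain ⟨f', hf'⟩ := select (ι := Fin t) n (fun i j k => ind (i = j) + dn (P.comap f) R i j k + dn (P.comap f) G i j k
     + outc (P.comap f) R G i j k + outc (P.comap f) G R i j k + pr (fun w => R i j w ∧ G i j w))
    (fun i j k => by
      have := ind_nonneg (i = j); have := dn_nonneg (P.comap f) R i j k; have := dn_nonneg (P.comap f) G i j k
      have := outc_nonneg (P.comap f) R G i j k; have := outc_nonneg (P.comap f) G R i j k
      have := pr_nonneg (fun w => R i j w ∧ G i j w)
      linarith) hκ (by
      refine lt_of_le_of_lt (mul_le_mul_of_nonneg_left ?_ (by positivity)) hμκ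
      simp only [ex_add]
      have h1 : (ex fun i : Fin t => ex fun j => ex fun _ : Fin t => ind (i = j)) ≤ μ := by
        refine ex_le_of fun i => ?_
        have e : (fun j : Fin t => ex fun _ : Fin t => ind (i = j)) = fun j => ind (i = j) := by
          funext j; exact ex_const _
        rw [e]
        have := pr_eq_le i
        unfold pr at this
        rw [Fintype.card_fin] at this
        exact this.le.trans (ht1.trans (min_le_right _ _))
      have h2 : (ex fun i : Fin t => ex fun j => ex fun _ : Fin t => pr (fun w => R i j w ∧ G i j w)) ≤ μ := by
        refine le_trans (le_of_eq ?_) ov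
        congr 1; funext i; congr 1; funext j; exact ex_const _
      unfold dens3 at dR dG
      linarith)
  have hinj : Function.Injective f' := by
    intro x y hxy
    by_contra hne
    obtain ⟨z, hz⟩ : ∃ z : Fin n, z ∉ ({x, y} : Finset (Fin n)) := by
      by_contra hcon; push Not at hcon
      have h1 : (univ : Finset (Fin n)).card ≤ ({x, y} : Finset (Fin n)).card := Finset.card_le_card fun z _ => hcon z
      have h2 := Finset.card_le_two (a := x) (b := y)
      rw [Finset.card_univ, Fintype.card_fin] at h1
      omega
    simp only [Finset.mem_insert, Finset.mem_singleton, not_or] at hz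
    have := hf' x y z hne (Ne.symm hz.1) (Ne.symm hz.2)
    rw [ind_t hxy] at this
    have := dn_nonneg (P.comap f) R (f' x) (f' y) (f' z); have := dn_nonneg (P.comap f) G (f' x) (f' y) (f' z)
    have := outc_nonneg (P.comap f) R G (f' x) (f' y) (f' z); have := outc_nonneg (P.comap f) G R (f' x) (f' y) (f' z)
    have := pr_nonneg (fun w => R (f' x) (f' y) w ∧ G (f' x) (f' y) w)
    linarith
  refine ⟨f ∘ f', hfi.comp hinj, fun i j => R (f' i) (f' j), fun i j => G (f' i) (f' j), fun _ _ _ h => sR _ _ _ h, fun _ _ _ h => sG _ _ _ h,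
    fun i j h => wR _ _ (hinj.ne h), fun i j h => wG _ _ (hinj.ne h), fun i j k a b c => ?_⟩
  have := hf' i j k a b c
  have := ind_nonneg (f' i = f' j)
  have := dn_nonneg (P.comap f) R (f' i) (f' j) (f' k); have := dn_nonneg (P.comap f) G (f' i) (f' j) (f' k)
  have := outc_nonneg (P.comap f) R G (f' i) (f' j) (f' k); have := outc_nonneg (P.comap f) G R (f' i) (f' j) (f' k)
  have := pr_nonneg (fun w => R (f' i) (f' j) w ∧ G (f' i) (f' j) w)
  refine ⟨?_, ?_, ?_, ?_, ?_⟩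
  · change dn (P.comap f) R (f' i) (f' j) (f' k) ≤ κ; linarith
  · change dn (P.comap f) G (f' i) (f' j) (f' k) ≤ κ; linarith
  · change outc (P.comap f) R G (f' i) (f' j) (f' k) ≤ κ; linarith
  · change outc (P.comap f) G R (f' i) (f' j) (f' k) ≤ κ; linarith
  · linarith



theorem quad_pos {a b u : ℝ} (ha : 0 ≤ a) (hab : a ≤ b) (hb : b < 1/2) (h : a * (2 - 3*b) < 1 - 2*b) (hu : 0 < u) :
    0 < (1-b)*u^2 - a*(1+b)*u + a*b*(1-b) := by
  rcases ha.eq_or_lt with rfl | ha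
  · have : 0 < (1-b)*u^2 := by have : 0 < 1 - b := by linarith
                               positivity
    linarith
  have hb0 : 0 < b := lt_of_lt_of_le ha hab
  have hD : a*(1+b)^2 - 4*b*(1-b)^2 < 0 := by
    rcases lt_or_ge b (1/3) with h3 | h3
    · have h1 : a*(1+b)^2 ≤ b*(1+b)^2 := mul_le_mul_of_nonneg_right hab (by positivity)
      have h2 : 0 < b * (1-3*b) * (3-b) := by
        have : 0 < 1 - 3*b := by linarith
        have : 0 < 3 - b := by linarith
        positivity
      nlinarith
    · have h0 : 0 < 2 - 3*b := by linarith
      have h1 : a * (2-3*b) * (1+b)^2 < (1-2*b)*(1+b)^2 := mul_lt_mul_of_pos_right h (by positivity)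
      have h2 : 0 ≤ -4*b^3+10*b^2-5*b+1 := by nlinarith [sq_nonneg (b - 1/3), mul_nonneg (sq_nonneg b) (by linarith : 0 ≤ 1/2 - b)]
      have h3' : 0 ≤ (3*b-1)*(-4*b^3+10*b^2-5*b+1) := mul_nonneg (by linarith) h2
      have h4 : (2-3*b) * (a*(1+b)^2 - 4*b*(1-b)^2) < 0 := by nlinarith
      by_contra hc; push Not at hc
      have := mul_nonneg h0.le hc
      linarith
  have hb1 : 0 < 1 - b := by linarith
  have h5 : a * (a*(1+b)^2 - 4*b*(1-b)^2) < 0 := mul_neg_of_pos_of_neg ha hD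
  have h6 : 0 < (4*(1-b)) * ((1-b)*u^2 - a*(1+b)*u + a*b*(1-b)) := by
    nlinarith [sq_nonneg (2*(1-b)*u - a*(1+b))]
  exact (mul_pos_iff_of_pos_left (by linarith)).1 h6

theorem ex_lin {α : Type} [Fintype α] [Nonempty α] {Z : α → Prop} {p : α → ℝ} {c₁ c₂ β : ℝ} (hc : c₂ ≤ c₁)
    (h1 : ∀ x, Z x → c₁ ≤ p x) (h2 : ∀ x, c₂ ≤ p x) (hZ : β ≤ pr Z) : β * c₁ + (1-β) * c₂ ≤ ex p := by
  have h : ∀ x, c₂ + ind (Z x) * (c₁ - c₂) ≤ p x := by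
    intro x
    by_cases hx : Z x
    · rw [ind_t hx]; linarith [h1 x hx]
    · rw [ind_f hx]; linarith [h2 x]
  have h3 := ex_mono h
  rw [ex_add, ex_const, ex_mul'] at h3
  have h4 : β * (c₁ - c₂) ≤ pr Z * (c₁ - c₂) := mul_le_mul_of_nonneg_right hZ (by linarith)
  unfold pr at h4
  linarith

theorem ex_good {α : Type} [Fintype α] [Nonempty α] {B : α → Prop} {f : α → ℝ} {c κ m : ℝ}
    (hB : pr B ≤ κ) (hm : 0 ≤ m) (hf : ∀ x, f x ≤ c + m) (h : c + m * κ < ex f) : ∃ x, ¬ B x ∧ c < f x := by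
  by_contra hcon; push Not at hcon
  have h1 : ex f ≤ ex (fun x => c + m * ind (B x)) := ex_mono fun x => by
    by_cases hx : B x
    · rw [ind_t hx]; linarith [hf x]
    · rw [ind_f hx]; linarith [hcon x hx]
  rw [ex_add, ex_const, ex_mul] at h1
  have : m * pr B ≤ m * κ := mul_le_mul_of_nonneg_left hB hm
  unfold pr at this
  linarith

theorem game {X1 X2 X4 Y A1 A2 A3 E F : Type} [Fintype X1] [Fintype X2] [Fintype X4] [Fintype Y] [Fintype A1] [Fintype A2]
    [Fintype A3] [Fintype E] [Fintype F] [Nonempty X1] [Nonempty X2] [Nonempty X4] [Nonempty Y] [Nonempty A1] [Nonempty A2]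
    [Nonempty A3] [Nonempty E] [Nonempty F]
    (T123 : X1 → A1 → X2 → Prop) (T124 : X1 → E → A2 → Prop) (T125 : X1 → Y → F → Prop) (T134 : A1 → E → Prop)
    (T135 : A1 → Y → A3 → Prop) (T145 : E → Y → X4 → Prop) (T234 : X2 → A2 → Prop) (T235 : X2 → F → A3 → Prop)
    (T245 : A2 → F → X4 → Prop) (T345 : A3 → X4 → Prop) {α β κ t : ℝ} (hκ : 0 < κ) (hκα : 2 * κ < α) (hα1 : α ≤ 1)
    (hβ0 : 0 ≤ β) (hβα : β ≤ α) (h3 : α + β < 3 * α * β) (ht0 : 0 ≤ t) (ht1 : t ≤ 1)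
    (h345 : pr (fun x4 => ¬ ∃ a3, T345 a3 x4) ≤ κ)
    (h235 : ∀ a3, α + 2 * κ ≤ ex fun x2 => pr fun f => T235 x2 f a3)
    (h245 : ∀ a2, α + 2 * κ ≤ ex fun x4 => pr fun f => T245 a2 f x4)
    (h234 : pr (fun x2 => ¬ (β ≤ pr fun a2 => T234 x2 a2)) ≤ κ)
    (h123 : ∀ x2, pr (fun x1 => ¬ (β + 2 * κ ≤ pr fun a1 => T123 x1 a1 x2)) ≤ κ)
    (h124 : ∀ a2, α + 2 * κ ≤ ex fun x1 => pr fun e => T124 x1 e a2)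
    (h134 : 1 - β ≤ pr fun a1 => t ≤ pr fun e => T134 a1 e)
    (hmax : ∀ x1, pr (fun a2 => t < pr fun e => T124 x1 e a2) ≤ 1 - β)
    (h135 : ∀ a3, pr (fun a1 => ¬ (α ≤ pr fun y => T135 a1 y a3)) ≤ κ)
    (h145 : ∀ x4, pr (fun y => ¬ (β ≤ pr fun e => T145 e y x4)) ≤ κ)
    (h125 : ∀ x1, pr (fun y => ¬ (β ≤ pr fun f => T125 x1 y f)) ≤ κ) :
    ∃ x1 x2 x4 y a1 a2 a3 e f, T123 x1 a1 x2 ∧ T124 x1 e a2 ∧ T125 x1 y f ∧ T134 a1 e ∧ T135 a1 y a3 ∧ T145 e y x4 ∧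
      T234 x2 a2 ∧ T235 x2 f a3 ∧ T245 a2 f x4 ∧ T345 a3 x4 := by
  have hβ1 : β ≤ 1 := hβα.trans hα1
  have hα0 : 0 ≤ α := hβ0.trans hβα
  have hα23 : 2/3 < α := by
    by_contra hc; push Not at hc
    nlinarith [mul_nonneg hα0 (by linarith : 0 ≤ α - β)]
  have hβ12 : 1/2 < β := by nlinarith
  have hw : 2 < 2 * α + β := by
    have h1 : 0 < (3*α-2)*(2*α-1) := mul_pos (by linarith) (by linarith)
    have h2 : 0 < 3*α-1 := by linarith
    by_contra hc; push Not at hc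
    nlinarith
  have hs : 4/3 < α + β := by nlinarith [sq_nonneg (α-β)]
  choose! a3 ha3 using (fun x4 (h : ∃ a3, T345 a3 x4) => h)
  -- choose x2
  obtain ⟨x2, hx2, hx2f⟩ : ∃ x2, ¬ ¬ (β ≤ pr fun a2 => T234 x2 a2) ∧ α < ex fun x4 => pr fun f => T235 x2 f (a3 x4) := by
    refine ex_good (m := 1) h234 (by norm_num) (fun x => ?_) ?_
    · have : (ex fun x4 => pr fun f => T235 x f (a3 x4)) ≤ 1 := ex_le_one fun _ => pr_le_one _
      linarith
    · rw [ex_comm]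
      refine lt_of_lt_of_le ?_ (le_ex_of fun x4 => h235 (a3 x4))
      linarith
  rw [not_not] at hx2
  by_cases hZ : ∃ a2, T234 x2 a2 ∧ κ < pr fun x1 => 2 - β - t < pr fun e => T124 x1 e a2
  · obtain ⟨a2, ha2, hp⟩ := hZ
    obtain ⟨x4, hx4, hx4f⟩ : ∃ x4, ¬ ¬ (∃ a3, T345 a3 x4) ∧
        2 - β < (pr fun f => T235 x2 f (a3 x4)) + pr fun f => T245 a2 f x4 := by
      refine ex_good (m := 1) h345 (by norm_num) (fun x => ?_) ?_
      · linarith [pr_le_one (fun f => T235 x2 f (a3 x)), pr_le_one (fun f => T245 a2 f x)]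
      · rw [ex_add]; have := h245 a2; linarith
    rw [not_not] at hx4
    obtain ⟨x1, hx1, hx1f⟩ : ∃ x1, (2 - β - t < pr fun e => T124 x1 e a2) ∧ (β + 2 * κ ≤ pr fun a1 => T123 x1 a1 x2) := by
      apply pr_inter_pos
      have := h123 x2
      rw [pr_not] at this
      linarith
    obtain ⟨a1, ha1, ha1t, ha1y⟩ : ∃ a1, T123 x1 a1 x2 ∧ (t ≤ pr fun e => T134 a1 e) ∧ (α ≤ pr fun y => T135 a1 y (a3 x4)) := by
      apply pr_inter_pos3
      have := h135 (a3 x4)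
      rw [pr_not] at this
      linarith
    obtain ⟨y, hy, hye, hyf⟩ : ∃ y, T135 a1 y (a3 x4) ∧ (β ≤ pr fun e => T145 e y x4) ∧ (β ≤ pr fun f => T125 x1 y f) := by
      apply pr_inter_pos3
      have h1 := h145 x4
      have h2 := h125 x1
      rw [pr_not] at h1 h2
      linarith
    obtain ⟨e, he1, he2, he3⟩ : ∃ e, T124 x1 e a2 ∧ T134 a1 e ∧ T145 e y x4 := by
      apply pr_inter_pos3; linarith
    obtain ⟨f, hf1, hf2, hf3⟩ : ∃ f, T235 x2 f (a3 x4) ∧ T245 a2 f x4 ∧ T125 x1 y f := by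
      apply pr_inter_pos3; linarith
    exact ⟨x1, x2, x4, y, a1, a2, a3 x4, e, f, ha1, he1, hf3, he2, hy, he3, ha2, hf1, hf2, ha3 x4 hx4⟩
  · exfalso
    push Not at hZ
    let p : A2 → ℝ := fun a2 => pr fun x1 => t < pr fun e => T124 x1 e a2
    have hEp : ex p ≤ 1 - β := by
      have : ex p = ex fun x1 => pr fun a2 => t < pr fun e => T124 x1 e a2 := ex_comm _
      rw [this]; exact ex_le_of hmax
    have k1 : ∀ a2, T234 x2 a2 → α ≤ t + (2 - β - 2*t) * p a2 := by
      intro a2 ha2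
      have h1 := h124 a2
      have h2 : (ex fun x1 => pr fun e => T124 x1 e a2) ≤ ex fun x1 => (t + (2-β-2*t) * ind (t < pr fun e => T124 x1 e a2)
          + ind (2 - β - t < pr fun e => T124 x1 e a2)) := by
        refine ex_mono fun x1 => ?_
        have h1 : (pr fun e => T124 x1 e a2) ≤ 1 := pr_le_one _
        unfold ind
        split_ifs <;> linarith
      rw [ex_add, ex_add, ex_const, ex_mul] at h2
      have h3 := hZ a2 ha2
      unfold pr at h3
      change _ ≤ t + (2 - β - 2*t) * p a2 + _ at h2
      unfold pr at h2 h1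
      linarith
    have k2 : ∀ a2, α ≤ t + (1 - t) * p a2 := by
      intro a2
      have h1 := h124 a2
      have h2 : (ex fun x1 => pr fun e => T124 x1 e a2) ≤ ex fun x1 => (t + (1-t) * ind (t < pr fun e => T124 x1 e a2)) := by
        refine ex_mono fun x1 => ?_
        have h1 : (pr fun e => T124 x1 e a2) ≤ 1 := pr_le_one _
        unfold ind
        split_ifs <;> linarith
      rw [ex_add, ex_const, ex_mul] at h2
      change _ ≤ t + (1-t) * p a2 at h2
      linarith
    have k3 : α ≤ 2 - β - t := by
      obtain ⟨a2, ha2⟩ := pr_exists (lt_of_lt_of_le (by linarith) hx2)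
      have h1 := h124 a2
      have h2 : (ex fun x1 => pr fun e => T124 x1 e a2) ≤ ex fun x1 => ((2-β-t) + ind (2 - β - t < pr fun e => T124 x1 e a2)) := by
        refine ex_mono fun x1 => ?_
        have h1 : (pr fun e => T124 x1 e a2) ≤ 1 := pr_le_one _
        unfold ind
        split_ifs <;> linarith
      rw [ex_add, ex_const] at h2
      have h3 := hZ a2 ha2
      unfold pr at h3 h2 h1
      linarith
    have w1 : 0 < 2 - β - 2*t := by linarith
    have w2 : 0 < 1 - t := by linarith
    have w3 : 0 < α - t := by linarith
    have q1 : ∀ a2, T234 x2 a2 → (α - t)/(2 - β - 2*t) ≤ p a2 := fun a2 h => by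
      rw [div_le_iff₀ w1]; linarith [k1 a2 h]
    have q2 : ∀ a2, (α - t)/(1-t) ≤ p a2 := fun a2 => by
      rw [div_le_iff₀ w2]; linarith [k2 a2]
    rcases lt_or_ge t (1-β) with htb | htb
    · have h1 := le_ex_of q2
      have h2 : 1 - β < (α - t)/(1-t) := by
        rw [lt_div_iff₀ w2]; nlinarith [sq_nonneg (β - 1/2)]
      linarith
    · have h1 := ex_lin (div_le_div_of_nonneg_left w3.le w1 (by linarith : 2 - β - 2*t ≤ 1 - t)) q1 q2 hx2
      have h2 : 1 - β < β * ((α - t)/(2 - β - 2*t)) + (1-β) * ((α - t)/(1-t)) := by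
        have hq := quad_pos (a := 1 - α) (b := 1 - β) (u := 1 - t) (by linarith) (by linarith) (by linarith) (by nlinarith) w2
        rw [← mul_div_assoc, ← mul_div_assoc, div_add_div _ _ w1.ne' w2.ne', lt_div_iff₀ (mul_pos w1 w2)]
        nlinarith
      linarith



def prS {V : Type} [Fintype V] (Q p : V → Prop) : ℝ := pr fun v : {v // Q v} => p v.1
def exS {V : Type} [Fintype V] (Q : V → Prop) (f : V → ℝ) : ℝ := ex fun v : {v // Q v} => f v.1

theorem rev_eq {ι V : Type} (P : Pal ι V) (i j k : ι) (u v w : V) : P.E i j k u v w = P.E k j i w v u :=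
  propext (by rw [P.s1i, P.s2i, P.s1i])
theorem rot2_eq {ι V : Type} (P : Pal ι V) (i j k : ι) (u v w : V) : P.E i j k u v w = P.E k i j v w u :=
  propext (by rw [P.s2i, P.s1i])
theorem s1_eq {ι V : Type} (P : Pal ι V) (i j k : ι) (u v w : V) : P.E i j k u v w = P.E j i k u w v :=
  propext (by rw [P.s1i])

theorem max_t {V : Type} [Fintype V] [Nonempty V] (P : Pal (Fin 5) V) (R G : Fin 5 → Fin 5 → V → Prop)
    (nR : ∀ i j, i ≠ j → ∃ u, R i j u) (nG : ∀ i j, i ≠ j → ∃ u, G i j u) {β : ℝ} (hβ : 0 ≤ β) (hβ1 : β ≤ 1) :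
    ∃ t : ℝ, 0 ≤ t ∧ t ≤ 1 ∧ (∃ i j k x, i ≠ j ∧ i ≠ k ∧ j ≠ k ∧ G i j x ∧
      1 - β ≤ prS (R j k) fun a => t ≤ prS (R i k) fun e => P.E i j k x e a) ∧
      ∀ i j k x, i ≠ j → i ≠ k → j ≠ k → G i j x →
        (prS (R j k) fun a => t < prS (R i k) fun e => P.E i j k x e a) ≤ 1 - β := by
  let f : Fin 5 → Fin 5 → Fin 5 → V → V → ℝ := fun i j k x a => prS (R i k) fun e => P.E i j k x e a
  let good : ℝ → Prop := fun t => 0 ≤ t ∧ t ≤ 1 ∧ (∃ i j k x, i ≠ j ∧ i ≠ k ∧ j ≠ k ∧ G i j x ∧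
      1 - β ≤ prS (R j k) fun a => t ≤ f i j k x a)
  let C : Finset ℝ := (insert 0 (univ.image fun q : Fin 5 × Fin 5 × Fin 5 × V × V => f q.1 q.2.1 q.2.2.1 q.2.2.2.1 q.2.2.2.2)).filter good
  have hf0 : ∀ i j k x a, 0 ≤ f i j k x a := fun i j k x a => pr_nonneg _
  have hC : C.Nonempty := by
    refine ⟨0, Finset.mem_filter.2 ⟨Finset.mem_insert_self _ _, le_rfl, zero_le_one, ?_⟩⟩
    obtain ⟨x, hx⟩ := nG 0 1 (by decide)
    refine ⟨0, 1, 2, x, by decide, by decide, by decide, hx, ?_⟩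
    obtain ⟨r, hr⟩ := nR 1 2 (by decide)
    haveI : Nonempty {v // R 1 2 v} := ⟨⟨r, hr⟩⟩
    unfold prS
    rw [pr_true fun a => hf0 _ _ _ _ _]
    linarith
  have hm := Finset.max'_mem C hC
  have hg := (Finset.mem_filter.1 hm).2
  refine ⟨C.max' hC, hg.1, hg.2.1, hg.2.2, fun i j k x hij hik hjk hx => ?_⟩
  by_contra hcon
  push Not at hcon
  obtain ⟨r, hr⟩ := nR j k hjk
  haveI : Nonempty {v // R j k v} := ⟨⟨r, hr⟩⟩
  obtain ⟨r', hr'⟩ := nR i k hik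
  haveI : Nonempty {v // R i k v} := ⟨⟨r', hr'⟩⟩
  let D : Finset ℝ := ((univ : Finset {v // R j k v}).image fun a => f i j k x a.1).filter fun s => C.max' hC < s
  have hD : D.Nonempty := by
    by_contra hD
    rw [Finset.not_nonempty_iff_eq_empty] at hD
    have hall : ∀ a : {v // R j k v}, ¬ C.max' hC < f i j k x a.1 := fun a ha => by
      have : f i j k x a.1 ∈ D := Finset.mem_filter.2 ⟨Finset.mem_image_of_mem _ (mem_univ _), ha⟩
      rw [hD] at this; exact absurd this (Finset.notMem_empty _)
    have h0 : (prS (R j k) fun a => C.max' hC < prS (R i k) fun e => P.E i j k x e a) = 0 := pr_false hall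
    rw [h0] at hcon
    linarith
  have hs := Finset.mem_filter.1 (Finset.min'_mem D hD)
  obtain ⟨a, -, ha⟩ := Finset.mem_image.1 hs.1
  have hin : D.min' hD ∈ C := by
    refine Finset.mem_filter.2 ⟨Finset.mem_insert_of_mem (Finset.mem_image.2 ⟨(i, j, k, x, a.1), mem_univ _, ha⟩), ?_, ?_, i, j, k, x, hij, hik, hjk, hx, ?_⟩
    · rw [← ha]; exact hf0 _ _ _ _ _
    · rw [← ha]; exact pr_le_one _
    · refine hcon.le.trans (pr_mono fun b hb => ?_)
      exact Finset.min'_le D _ (Finset.mem_filter.2 ⟨Finset.mem_image_of_mem _ (mem_univ _), hb⟩)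
  exact absurd (Finset.le_max' C _ hin) (not_le.2 hs.2)

theorem final_game {V : Type} [Fintype V] [Nonempty V] (P : Pal (Fin 5) V) (hf : P.Free) (R G : Fin 5 → Fin 5 → V → Prop)
    (sR : Sy R) (sG : Sy G)
    (nR : ∀ i j, i ≠ j → ∃ u, R i j u) (nG : ∀ i j, i ≠ j → ∃ u, G i j u) {α β κ : ℝ} (hκ : 0 < κ) (hκ1 : κ < 1) (hκα : 2 * κ < α)
    (hβ0 : 0 ≤ β) (hβα : β ≤ α) (h3 : α + β < 3 * α * β)
    (c1 : ∀ i j k u, i ≠ j → i ≠ k → j ≠ k → R i j u → (prS (R i k) fun v => ¬ (α + 3 * κ ≤ prS (G j k) fun w => P.E i j k u v w)) ≤ κ)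
    (c2 : ∀ i j k u, i ≠ j → i ≠ k → j ≠ k → G i j u → (prS (G i k) fun v => ¬ (β + 2 * κ ≤ prS (R j k) fun w => P.E i j k u v w)) ≤ κ) :
    False := by
  have hR : ∀ i j, R i j = R j i := fun i j => funext fun u => propext (sR.iff i j u)
  have hG : ∀ i j, G i j = G j i := fun i j => funext fun u => propext (sG.iff i j u)
  have NR : ∀ i j, i ≠ j → Nonempty {v // R i j v} := fun i j h => let ⟨u, hu⟩ := nR i j h; ⟨⟨u, hu⟩⟩
  have NG : ∀ i j, i ≠ j → Nonempty {v // G i j v} := fun i j h => let ⟨u, hu⟩ := nG i j h; ⟨⟨u, hu⟩⟩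
  have hα1 : α + 3 * κ ≤ 1 := by
    obtain ⟨u, hu⟩ := nR 0 1 (by decide)
    haveI := NR 0 2 (by decide)
    haveI := NG 1 2 (by decide)
    have h := c1 0 1 2 u (by decide) (by decide) (by decide) hu
    unfold prS at h
    rw [pr_not] at h
    obtain ⟨v, hv⟩ := pr_exists (p := fun v : {v // R 0 2 v} => α + 3 * κ ≤ pr fun w : {w // G 1 2 w} => P.E 0 1 2 u v.1 w.1) (by linarith)
    exact hv.trans (pr_le_one _)
  have avg : ∀ i j k u, i ≠ j → i ≠ k → j ≠ k → R i j u → α + 2 * κ ≤ exS (R i k) fun v => prS (G j k) fun w => P.E i j k u v w := by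
    intro i j k u hij hik hjk hu
    haveI := NR i k hik
    have h := c1 i j k u hij hik hjk hu
    unfold prS at h
    rw [pr_not] at h
    have h2 : (α + 3 * κ) * (pr fun v : {v // R i k v} => α + 3 * κ ≤ pr fun w : {w // G j k w} => P.E i j k u v.1 w.1) ≤
        exS (R i k) fun v => prS (G j k) fun w => P.E i j k u v w := by
      unfold exS prS
      rw [pr, ← ex_mul]
      refine ex_mono fun v => ?_
      unfold ind
      split_ifs with hh
      · rw [mul_one]; exact hh
      · rw [mul_zero]; exact pr_nonneg _
    refine le_trans ?_ h2
    have h4 : (α + 3 * κ) * (1 - κ) ≤ (α + 3 * κ) * (pr fun v : {v // R i k v} => α + 3 * κ ≤ pr fun w : {w // G j k w} => P.E i j k u v.1 w.1) :=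
      mul_le_mul_of_nonneg_left (by linarith) (by linarith)
    refine le_trans ?_ h4
    nlinarith
  have avg' : ∀ i j k u, i ≠ j → i ≠ k → j ≠ k → R i j u → α + 2 * κ ≤ exS (G j k) fun w => prS (R i k) fun v => P.E i j k u v w := by
    intro i j k u hij hik hjk hu
    refine (avg i j k u hij hik hjk hu).trans (le_of_eq ?_)
    unfold exS prS pr
    exact ex_comm _
  obtain ⟨t, ht0, ht1, ⟨i4, i3, i1, q, h43, h41, h31, hq, ht⟩, hmax⟩ := max_t P R G nR nG hβ0 (by linarith : β ≤ 1)
  obtain ⟨i2, i5, h21, h23, h24, h25, h51, h53, h54⟩ : ∃ i2 i5 : Fin 5, i2 ≠ i1 ∧ i2 ≠ i3 ∧ i2 ≠ i4 ∧ i2 ≠ i5 ∧ i5 ≠ i1 ∧ i5 ≠ i3 ∧ i5 ≠ i4 := by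
    clear ht hq
    revert i4 i3 i1; decide
  have hq' := sG _ _ _ hq
  haveI := NG i1 i2 h21.symm
  haveI := NG i2 i3 h23
  haveI := NG i4 i5 h54.symm
  haveI := NG i1 i5 h51.symm
  haveI := NR i1 i3 h31.symm
  haveI := NR i2 i4 h24
  haveI := NR i3 i5 h53.symm
  haveI := NR i1 i4 h41.symm
  haveI := NR i2 i5 h25
  have weak : ∀ {a b : ℝ} {X : Type} [Fintype X] {g : X → ℝ}, a ≤ b → pr (fun x => ¬ (b ≤ g x)) ≤ κ → pr (fun x => ¬ (a ≤ g x)) ≤ κ :=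
    fun hab h => (pr_mono fun x hx hb => hx (hab.trans hb)).trans h
  obtain ⟨x1, x2, x4, y, a1, a2, a3, e, f, g1, g2, g3, g4, g5, g6, g7, g8, g9, g10⟩ := game (X1 := {v // G i1 i2 v}) (X2 := {v // G i2 i3 v})
    (X4 := {v // G i4 i5 v}) (Y := {v // G i1 i5 v}) (A1 := {v // R i1 i3 v}) (A2 := {v // R i2 i4 v}) (A3 := {v // R i3 i5 v})
    (E := {v // R i1 i4 v}) (F := {v // R i2 i5 v})
    (fun x1 a1 x2 => P.E i1 i2 i3 x1 a1 x2) (fun x1 e a2 => P.E i1 i2 i4 x1 e a2) (fun x1 y f => P.E i1 i2 i5 x1 y f)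
    (fun a1 e => P.E i1 i3 i4 a1 e q) (fun a1 y a3 => P.E i1 i3 i5 a1 y a3) (fun e y x4 => P.E i1 i4 i5 e y x4)
    (fun x2 a2 => P.E i2 i3 i4 x2 a2 q) (fun x2 f a3 => P.E i2 i3 i5 x2 f a3) (fun a2 f x4 => P.E i2 i4 i5 a2 f x4)
    (fun a3 x4 => P.E i3 i4 i5 q a3 x4) hκ hκα (by linarith) hβ0 hβα h3 ht0 ht1
    (by
      have := c2 i4 i3 i5 q h43 h54.symm h53.symm hq
      simp only [s1_eq P i4 i3 i5] at this
      refine (pr_mono fun x hx hb => hx ?_).trans this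
      exact pr_exists (lt_of_lt_of_le (by linarith) hb))
    (by
      intro a3
      have := avg' i5 i3 i2 a3 h53 h25.symm h23.symm (sR _ _ _ a3.2)
      simp only [rev_eq P i5 i3 i2, hR i5 i2, hG i3 i2] at this
      exact this)
    (fun a2 => avg' i2 i4 i5 a2 h24 h25 h54.symm a2.2)
    (by
      have := c2 i3 i4 i2 q h43.symm h23.symm h24.symm hq'
      simp only [rot2_eq P i3 i4 i2, hR i4 i2, hG i3 i2] at this
      exact weak (by linarith) this)
    (by
      intro x2
      have := c2 i2 i3 i1 x2 h23 h21 h31 x2.2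
      simp only [rot2_eq P i2 i3 i1, hR i3 i1, hG i2 i1] at this
      exact this)
    (by
      intro a2
      have := avg' i4 i2 i1 a2 h24.symm h41 h21 (sR _ _ _ a2.2)
      simp only [rev_eq P i4 i2 i1, hR i4 i1, hG i2 i1] at this
      exact this)
    (by
      simp only [rev_eq P i4 i3 i1, hR i3 i1, hR i4 i1] at ht
      exact ht)
    (fun x1 => hmax i1 i2 i4 x1 h21.symm h41.symm h24 x1.2)
    (by
      intro a3
      have := c1 i3 i5 i1 a3 h53.symm h31 h51 a3.2
      simp only [rot2_eq P i3 i5 i1, hR i3 i1, hG i5 i1] at this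
      exact weak (by linarith) this)
    (by
      intro x4
      have := c2 i5 i4 i1 x4 h54 h51 h41 (sG _ _ _ x4.2)
      simp only [rev_eq P i5 i4 i1, hR i4 i1, hG i5 i1] at this
      exact weak (by linarith) this)
    (fun x1 => weak (by linarith) (c2 i1 i2 i5 x1 h21.symm h51.symm h25 x1.2))
  exact hf _ _ _ _ _ _ _ _ _ _ _ _ _ _ _ g1 g2 g3 g4 g5 g6 g7 g8 g9 g10



section
variable {V : Type} [Fintype V] [Nonempty V]

def badp {ι : Type} (P : Pal ι V) (θ : ℝ) (B : ι → ι → V → Prop) (i j k : ι) (u v : V) : Prop :=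
  θ ≤ pr fun w => P.E i j k u v w ∧ ¬ B j k w

def cl {ι : Type} (P : Pal ι V) (θ θ' : ℝ) (A B : ι → ι → V → Prop) (i j : ι) (u : V) : Prop :=
  A i j u ∧ ∀ k, k ≠ i → k ≠ j → (pr fun v => A i k v ∧ badp P θ B i j k u v) < θ' ∧ (pr fun v => A j k v ∧ badp P θ B j i k u v) < θ'

theorem cl_sy {ι : Type} (P : Pal ι V) (θ θ' : ℝ) {A B : ι → ι → V → Prop} (hA : Sy A) : Sy (cl P θ θ' A B) :=
  fun i j u h => ⟨hA _ _ _ h.1, fun k hi hj => ⟨(h.2 k hj hi).2, (h.2 k hj hi).1⟩⟩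

theorem cl_one {ι : Type} (P : Pal ι V) {θ θ' : ℝ} (hθ : 0 < θ) (hθ' : 0 < θ') (A B : ι → ι → V → Prop) (i j k : ι) :
    (pr fun u => A i j u ∧ θ' ≤ pr fun v => A i k v ∧ badp P θ B i j k u v) ≤ outc P A B i j k * θ⁻¹ * θ'⁻¹ := by
  unfold outc
  rw [← ex_mul', ← ex_mul']
  refine ex_mono fun u => ?_
  by_cases hu : A i j u
  · refine (ind_mono fun h => h.2).trans ((ind_markov (pr_nonneg _) hθ').trans ?_)
    refine mul_le_mul_of_nonneg_right ?_ (by positivity)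
    rw [← ex_mul']
    refine ex_mono fun v => ?_
    by_cases hv : A i k v
    · refine (ind_mono fun h => h.2).trans ((ind_markov (pr_nonneg _) hθ).trans ?_)
      refine mul_le_mul_of_nonneg_right ?_ (by positivity)
      exact ex_mono fun w => ind_mono fun h => ⟨hu, hv, h⟩
    · rw [ind_f fun h => hv h.1]
      exact mul_nonneg (ex_nonneg fun _ => ind_nonneg _) (by positivity)
  · rw [ind_f fun h => hu h.1]
    exact mul_nonneg (mul_nonneg (ex_nonneg fun _ => ex_nonneg fun _ => ind_nonneg _) (by positivity)) (by positivity)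

theorem cl_rem (P : Pal (Fin 5) V) {θ θ' κ : ℝ} (hθ : 0 < θ) (hθ' : 0 < θ') (hκ : 0 ≤ κ) {A B : Fin 5 → Fin 5 → V → Prop} (hA : Sy A)
    (h : ∀ i j k, i ≠ j → i ≠ k → j ≠ k → outc P A B i j k ≤ κ) (i j : Fin 5) (hij : i ≠ j) :
    (pr fun u => A i j u ∧ ¬ cl P θ θ' A B i j u) ≤ 10 * (κ * θ⁻¹ * θ'⁻¹) := by
  have h1 := pr_ex_le (X := V) (univ : Finset (Fin 5)) (fun k u => (k ≠ i ∧ k ≠ j) ∧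
    ((A i j u ∧ θ' ≤ pr fun v => A i k v ∧ badp P θ B i j k u v) ∨ (A j i u ∧ θ' ≤ pr fun v => A j k v ∧ badp P θ B j i k u v)))
    (η := 2 * (κ * θ⁻¹ * θ'⁻¹)) (by
      intro k _
      by_cases hk : k ≠ i ∧ k ≠ j
      · refine (pr_mono fun u hu => hu.2).trans ((pr_or_le _ _).trans ?_)
        have b : ∀ x, x ≤ κ → x * θ⁻¹ * θ'⁻¹ ≤ κ * θ⁻¹ * θ'⁻¹ := fun x hx => by gcongr
        have := (cl_one P hθ hθ' A B i j k).trans (b _ (h i j k hij hk.1.symm hk.2.symm))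
        have := (cl_one P hθ hθ' A B j i k).trans (b _ (h j i k hij.symm hk.2.symm hk.1.symm))
        linarith
      · rw [pr_false fun u hu => hk hu.1]; positivity)
  have h2 : ((univ : Finset (Fin 5)).card : ℝ) * (2 * (κ * θ⁻¹ * θ'⁻¹)) = 10 * (κ * θ⁻¹ * θ'⁻¹) := by
    simp; ring
  rw [h2] at h1
  refine (pr_mono fun u hu => ?_).trans h1
  obtain ⟨ha, hn⟩ := hu
  unfold cl at hn
  by_contra hcon
  push Not at hcon
  refine hn ⟨ha, fun k hi hj => ?_⟩
  obtain ⟨q1, q2⟩ := hcon k (mem_univ _) ⟨hi, hj⟩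
  exact ⟨q1 ha, q2 (hA _ _ _ ha)⟩

theorem sum_sub (Q : V → Prop) (g : V → ℝ) : ∑ v : {v // Q v}, g v.1 = ∑ v, ind (Q v) * g v := by
  rw [← Finset.sum_subtype (univ.filter Q) (by simp) g, Finset.sum_filter]
  refine Finset.sum_congr rfl fun v _ => ?_
  unfold ind; split_ifs <;> simp

theorem prS_eq {Q : V → Prop} (hQ : ∃ v, Q v) (p : V → Prop) : prS Q p * pr Q = pr fun v => Q v ∧ p v := by
  have h1 := sum_sub Q (fun v => ind (p v))
  have h2 := sum_sub Q (fun _ => 1)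
  simp only [mul_one, Finset.sum_const, Finset.card_univ, nsmul_eq_mul] at h2
  haveI : Nonempty {v // Q v} := let ⟨v, hv⟩ := hQ; ⟨⟨v, hv⟩⟩
  have c := card_pos' {v // Q v}
  unfold prS pr ex
  rw [h1, ← h2]
  simp only [ind_and]
  field_simp

theorem cl_deg (P : Pal (Fin 5) V) {ε θ θ' κ s g τ : ℝ} (hd : P.Dense (1/3 + ε)) (A B : Fin 5 → Fin 5 → V → Prop)
    (B' : Fin 5 → Fin 5 → V → Prop) (hB' : ∀ i j u, B' i j u → B i j u)
    (hrA : ∀ i j, i ≠ j → 1/4 ≤ pr (cl P θ θ' A B i j))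
    (hrB : ∀ i j, i ≠ j → (pr fun u => B i j u ∧ ¬ B' i j u) ≤ s)
    (hB0' : ∀ i j, i ≠ j → 1/4 ≤ pr (B' i j))
    (hg : ∀ i j, i ≠ j → pr (B i j) ≤ g) (hκ : 4 * θ' ≤ κ) (hτ : τ * g ≤ 1/3 + ε - θ - s) (i j k : Fin 5) (u : V)
    (hij : i ≠ j) (hik : i ≠ k) (hjk : j ≠ k) (hu : cl P θ θ' A B i j u) :
    (prS (cl P θ θ' A B i k) fun v => ¬ (τ ≤ prS (B' j k) fun w => P.E i j k u v w)) ≤ κ := by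
  have hpos := hrA i k hik
  have hB0 : ∀ i j, i ≠ j → ∃ u, B' i j u := fun i j h => pr_exists (lt_of_lt_of_le (by norm_num) (hB0' i j h))
  have hne : ∃ v, cl P θ θ' A B i k v := pr_exists (lt_of_lt_of_le (by norm_num) hpos)
  have h1 := prS_eq hne fun v => ¬ (τ ≤ prS (B' j k) fun w => P.E i j k u v w)
  have h2 : (pr fun v => cl P θ θ' A B i k v ∧ ¬ (τ ≤ prS (B' j k) fun w => P.E i j k u v w)) ≤ θ' := by
    refine (pr_mono fun v hv => ?_).trans ((hu.2 k hik.symm hjk.symm).1).le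
    refine ⟨hv.1.1, ?_⟩
    by_contra hb
    apply hv.2
    unfold badp at hb
    push Not at hb
    have e1 := hd i j k hij hik hjk u v
    have e2 := prS_eq (hB0 j k hjk) fun w => P.E i j k u v w
    have e3 : pr (P.E i j k u v) ≤ (pr fun w => B' j k w ∧ P.E i j k u v w) + (pr fun w => P.E i j k u v w ∧ ¬ B j k w) + (pr fun u => B j k u ∧ ¬ B' j k u) := by
      refine le_trans ?_ ((pr_or_le _ _).trans (add_le_add_left (pr_or_le _ _) _))
      exact pr_mono fun w hw => by tauto
    have e4 := hrB j k hjk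
    have e5 : pr (B' j k) ≤ g := (pr_mono fun w hw => hB' _ _ _ hw).trans (hg j k hjk)
    have e6 : 0 < pr (B' j k) := lt_of_lt_of_le (by norm_num) (hB0' j k hjk)
    have e7 : τ * g ≤ prS (B' j k) (fun w => P.E i j k u v w) * pr (B' j k) := by rw [e2]; linarith
    by_contra hc; push Not at hc
    have := pr_nonneg (fun w : {w // B' j k w} => P.E i j k u v w.1)
    have e8 : prS (B' j k) (fun w => P.E i j k u v w) * pr (B' j k) < τ * pr (B' j k) := mul_lt_mul_of_pos_right hc e6
    have e9 : 0 ≤ τ := le_trans this hc.le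
    have := mul_le_mul_of_nonneg_left e5 e9
    linarith
  have h3 := pr_nonneg (fun v : {v // cl P θ θ' A B i k v} => ¬ (τ ≤ prS (B' j k) fun w => P.E i j k u v.1 w))
  change 0 ≤ prS (cl P θ θ' A B i k) fun v => ¬ (τ ≤ prS (B' j k) fun w => P.E i j k u v w) at h3
  nlinarith
end



theorem clean_false {V : Type} [Fintype V] [Nonempty V] {ε r g κ0 : ℝ} (hε : 0 < ε) (hε1 : ε ≤ 1/10) (P : Pal (Fin 5) V)
    (hd : P.Dense (1/3 + ε)) (hf : P.Free) {R G : Fin 5 → Fin 5 → V → Prop} (sR : Sy R) (sG : Sy G) (wR : Wd R (1/3)) (wG : Wd G (1/3))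
    (hκ0 : κ0 = (ε/8) * (ε/192) * ε / 80)
    (oR : ∀ i j k, i ≠ j → i ≠ k → j ≠ k → outc P R G i j k ≤ κ0)
    (oG : ∀ i j k, i ≠ j → i ≠ k → j ≠ k → outc P G R i j k ≤ κ0)
    (hr : ∀ i j, i ≠ j → pr (R i j) ≤ r) (hg : ∀ i j, i ≠ j → pr (G i j) ≤ g) (hgr : g ≤ r) (hr1 : r ≤ 1) (hrg : r + g ≤ 1 + ε) : False := by
  have hs : 10 * (κ0 * (ε/8)⁻¹ * (ε/192)⁻¹) = ε/8 := by rw [hκ0]; field_simp; norm_num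
  have hκ0' : 0 ≤ κ0 := by rw [hκ0]; positivity
  have hg0 : 1/3 ≤ g := (wG 0 1 (by decide)).trans (hg 0 1 (by decide))
  have q : ∀ (A B : Fin 5 → Fin 5 → V → Prop), Sy A → Wd A (1/3) → (∀ i j k, i ≠ j → i ≠ k → j ≠ k → outc P A B i j k ≤ κ0) →
      (∀ i j, i ≠ j → (pr fun u => A i j u ∧ ¬ cl P (ε/8) (ε/192) A B i j u) ≤ ε/8) ∧
      (∀ i j, i ≠ j → 1/4 ≤ pr (cl P (ε/8) (ε/192) A B i j)) := by
    intro A B sA wA o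
    have h1 : ∀ i j, i ≠ j → (pr fun u => A i j u ∧ ¬ cl P (ε/8) (ε/192) A B i j u) ≤ ε/8 := fun i j hij => by
      have := cl_rem P (θ := ε/8) (θ' := ε/192) (by positivity) (by positivity) hκ0' sA o i j hij
      rwa [hs] at this
    refine ⟨h1, fun i j hij => ?_⟩
    have h2 := h1 i j hij
    have h3 := wA i j hij
    rw [pr_split _ (cl P (ε/8) (ε/192) A B i j)] at h3
    have h4 : (pr fun x => A i j x ∧ cl P (ε/8) (ε/192) A B i j x) ≤ pr (cl P (ε/8) (ε/192) A B i j) := pr_mono fun _ h => h.2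
    linarith
  obtain ⟨r1, r2⟩ := q R G sR wR oR
  obtain ⟨g1, g2⟩ := q G R sG wG oG
  have hr0 : 0 < r := by linarith
  have hg0' : 0 < g := by linarith
  refine final_game P hf (cl P (ε/8) (ε/192) R G) (cl P (ε/8) (ε/192) G R) (cl_sy P _ _ sR) (cl_sy P _ _ sG)
    (fun i j h => pr_exists (lt_of_lt_of_le (by norm_num) (r2 i j h))) (fun i j h => pr_exists (lt_of_lt_of_le (by norm_num) (g2 i j h)))
    (α := (1/3 + ε/2) / g) (β := (1/3 + ε/2) / r) (κ := ε/48) (by positivity) (by linarith) ?_ (by positivity) ?_ ?_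
    (fun i j k u a b c hu => cl_deg P hd R G _ (fun i j u h => h.1) r2 g1 g2 hg (by linarith) ?_ i j k u a b c hu)
    (fun i j k u a b c hu => cl_deg P hd G R _ (fun i j u h => h.1) g2 r1 r2 hr (by linarith) ?_ i j k u a b c hu)
  · rw [lt_div_iff₀ hg0']; nlinarith
  · exact div_le_div_of_nonneg_left (by positivity) hg0' hgr
  · have e : 3 * ((1/3 + ε/2) / g) * ((1/3 + ε/2) / r) - ((1/3 + ε/2) / g + (1/3 + ε/2) / r) = (1/3+ε/2) * (3 * (1/3+ε/2) - (r+g)) / (g*r) := by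
      field_simp
    have : 0 < (1/3+ε/2) * (3 * (1/3+ε/2) - (r+g)) / (g*r) := by
      apply div_pos (mul_pos (by linarith) (by linarith)) (by positivity)
    linarith
  · rw [add_mul, div_mul_cancel₀ _ hg0'.ne']; nlinarith
  · rw [add_mul, div_mul_cancel₀ _ hr0.ne']; nlinarith

theorem no_free {ε : ℝ} (hε : 0 < ε) (hε1 : ε ≤ 1/10) : ∃ N : ℕ, ∀ (ι V : Type) [Fintype ι] [Fintype V] [Nonempty V] (P : Pal ι V),
      P.Dense (1/3 + ε) → N ≤ Fintype.card ι → ¬ P.Free := by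
  obtain ⟨κ0, hκ0⟩ : ∃ κ0 : ℝ, κ0 = (ε/8) * (ε/192) * ε / 80 := ⟨_, rfl⟩
  have hκpos : 0 < κ0 := by rw [hκ0]; positivity
  have hκe : κ0 ≤ ε/2 := by rw [hκ0]; nlinarith [mul_pos hε hε]
  obtain ⟨K, hK⟩ := exists_nat_gt (2/ε)
  obtain ⟨n, hn⟩ := ramseyk 5 2 (K+1)
  obtain ⟨N, hN⟩ := holes hε hκpos (by linarith) (max n 3) (le_max_right _ _)
  refine ⟨N, fun ι V _ _ _ P hd hc hf => ?_⟩
  obtain ⟨f, hfi, R, G, sR, sG, wR, wG, h⟩ := hN ι V P hd hf hc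
  have hK0 : (0:ℝ) < K := lt_of_le_of_lt (by positivity) hK
  let col : Fin (max n 3) → Fin (max n 3) → ℕ := fun i j => ⌊pr (R i j) * K⌋₊
  have hR : ∀ i j, R i j = R j i := fun i j => funext fun u => propext (sR.iff i j u)
  have hcs : ∀ i j, col i j = col j i := fun i j => by simp only [col]; rw [hR i j]
  have hcl : ∀ i j, col i j < K + 1 := fun i j => by
    have : col i j ≤ K := by
      apply Nat.floor_le_of_le
      have := pr_le_one (R i j)
      nlinarith
    omega
  obtain ⟨b, S0, hS0, hb⟩ : ∃ b : ℕ, ∃ S0 : Finset (Fin (max n 3)), S0.card = 5 ∧ ∀ x ∈ S0, ∀ y ∈ S0, x ≠ y → col x y = b := by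
    by_contra hcon
    push Not at hcon
    obtain ⟨T, -, hT, hT2⟩ := hn (Fin (max n 3)) ℕ univ (Finset.range (K+1)) (by simp) (by simp) (fun b x y => col x y = b)
      (fun b x y h => (hcs y x).trans h) (fun b _ S0 _ h5 => by
        obtain ⟨x, hx, y, hy, hxy, hh⟩ := hcon b S0 h5
        exact ⟨x, hx, y, hy, hxy, hh⟩)
    obtain ⟨x, y, hxy, rfl⟩ := Finset.card_eq_two.1 hT
    exact hT2 x (by simp) y (by simp) hxy (col x y) (Finset.mem_range.2 (hcl x y)) rfl
  let e := (S0.equivFinOfCardEq hS0).symm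
  let f' : Fin 5 → Fin (max n 3) := fun i => e i
  have hi' : Function.Injective f' := fun i j h => e.injective (Subtype.ext h)
  have hcol : ∀ i j, i ≠ j → col (f' i) (f' j) = b := fun i j hij => hb _ (e i).2 _ (e j).2 (hi'.ne hij)
  have hlow : ∀ i j, i ≠ j → (b:ℝ) / K ≤ pr (R (f' i) (f' j)) := fun i j hij => by
    rw [div_le_iff₀ hK0, ← hcol i j hij]
    exact Nat.floor_le (mul_nonneg (pr_nonneg _) hK0.le)
  have hup : ∀ i j, i ≠ j → pr (R (f' i) (f' j)) ≤ ((b:ℝ) + 1) / K := fun i j hij => by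
    rw [le_div_iff₀ hK0, ← hcol i j hij]
    exact (Nat.lt_floor_add_one _).le
  have hthird : ∀ i j : Fin 5, i ≠ j → ∃ k : Fin 5, i ≠ k ∧ j ≠ k := by decide
  have hupG : ∀ i j, i ≠ j → pr (G (f' i) (f' j)) ≤ 1 + κ0 - b / K := fun i j hij => by
    obtain ⟨k, hik, hjk⟩ := hthird i j hij
    have h1 := (h (f' i) (f' j) (f' k) (hi'.ne hij) (hi'.ne hik) (hi'.ne hjk)).2.2.2.2
    have h2 := hlow i j hij
    have h3 := pr_split (G (f' i) (f' j)) (R (f' i) (f' j))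
    have h4 : (pr fun x => G (f' i) (f' j) x ∧ R (f' i) (f' j) x) ≤ κ0 := (pr_mono fun x hx => And.symm hx).trans h1
    have h5 : (pr fun x => G (f' i) (f' j) x ∧ ¬ R (f' i) (f' j) x) ≤ 1 - pr (R (f' i) (f' j)) := by
      rw [← pr_not]; exact pr_mono fun x hx => hx.2
    linarith
  have hinv : 1 / (K:ℝ) ≤ ε / 2 := by
    rw [div_lt_iff₀ hε] at hK; rw [div_le_iff₀ hK0]; linarith
  have hsum : ((b:ℝ) + 1) / K + (1 + κ0 - b / K) ≤ 1 + ε := by rw [add_div]; linarith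
  have r3 : 1/3 ≤ ((b:ℝ) + 1) / K := (wR (f' 0) (f' 1) (hi'.ne (by decide))).trans (hup 0 1 (by decide))
  have g3 : 1/3 ≤ 1 + κ0 - (b:ℝ) / K := (wG (f' 0) (f' 1) (hi'.ne (by decide))).trans (hupG 0 1 (by decide))
  have oR : ∀ i j k, i ≠ j → i ≠ k → j ≠ k → outc ((P.comap f).comap f') (fun i j => R (f' i) (f' j)) (fun i j => G (f' i) (f' j)) i j k ≤ κ0 :=
    fun i j k a b c => (h (f' i) (f' j) (f' k) (hi'.ne a) (hi'.ne b) (hi'.ne c)).2.2.1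
  have oG : ∀ i j k, i ≠ j → i ≠ k → j ≠ k → outc ((P.comap f).comap f') (fun i j => G (f' i) (f' j)) (fun i j => R (f' i) (f' j)) i j k ≤ κ0 :=
    fun i j k a b c => (h (f' i) (f' j) (f' k) (hi'.ne a) (hi'.ne b) (hi'.ne c)).2.2.2.1
  have d1 := comap_dense (comap_dense hd hfi) hi'
  have f1 := comap_free (comap_free hf f) f'
  rcases le_total (1 + κ0 - (b:ℝ) / K) (((b:ℝ) + 1) / K) with hle | hle
  · exact clean_false (R := fun i j => R (f' i) (f' j)) (G := fun i j => G (f' i) (f' j)) hε hε1 ((P.comap f).comap f') d1 f1 (fun _ _ _ h => sR _ _ _ h) (fun _ _ _ h => sG _ _ _ h) (fun i j h => wR _ _ (hi'.ne h))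
      (fun i j h => wG _ _ (hi'.ne h)) hκ0 oR oG hup hupG hle (by linarith) (by linarith)
  · exact clean_false (R := fun i j => G (f' i) (f' j)) (G := fun i j => R (f' i) (f' j)) hε hε1 ((P.comap f).comap f') d1 f1 (fun _ _ _ h => sG _ _ _ h) (fun _ _ _ h => sR _ _ _ h) (fun i j h => wG _ _ (hi'.ne h))
      (fun i j h => wR _ _ (hi'.ne h)) hκ0 oG oR hupG hup hle (by linarith) (by linarith)

theorem pr_sub (S : Finset ℕ) (p : ℕ → Prop) :
    pr (fun x : {x // x ∈ S} => p x.1) = ((S.filter p).card : ℝ) / (S.card : ℝ) := by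
  unfold pr ex
  rw [Fintype.card_of_subtype S (fun x => Iff.rfl)]
  congr 1
  rw [Finset.card_filter]
  push_cast
  rw [← Finset.sum_subtype S (fun x => Iff.rfl) (fun x => ind (p x))]
  refine Finset.sum_congr rfl fun x _ => ?_
  unfold ind; split_ifs <;> simp

namespace ReducedHG

abbrev Ix (A : ReducedHG) : Type := {i : ℕ // i ∈ A.I}
def Q (A : ReducedHG) (p : A.Ix × A.Ix) : Finset ℕ := if p.1 = p.2 then {0} else A.P p.1.1 p.2.1
abbrev W (A : ReducedHG) (p : A.Ix × A.Ix) : Type := {x : ℕ // x ∈ A.Q p}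
abbrev VV (A : ReducedHG) : Type := ∀ p : A.Ix × A.Ix, A.W p

theorem Q_ne (A : ReducedHG) (p : A.Ix × A.Ix) : (A.Q p).Nonempty := by
  unfold Q; split_ifs with h
  · simp
  · exact A.Pnonempty _ _ p.1.2 p.2.2 (fun hh => h (Subtype.ext hh))

instance W_ne (A : ReducedHG) (p : A.Ix × A.Ix) : Nonempty (A.W p) := (A.Q_ne p).to_subtype

def od (A : ReducedHG) (i j : A.Ix) : A.Ix × A.Ix := if i.1 ≤ j.1 then (i, j) else (j, i)

theorem od_symm (A : ReducedHG) (i j : A.Ix) : A.od i j = A.od j i := by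
  unfold od
  rcases lt_trichotomy i.1 j.1 with h | h | h
  · rw [if_pos h.le, if_neg (by omega)]
  · have : i = j := Subtype.ext h
    rw [this]
  · rw [if_neg (by omega), if_pos h.le]

theorem Q_od (A : ReducedHG) {i j : A.Ix} (h : i ≠ j) : A.Q (A.od i j) = A.P i.1 j.1 := by
  unfold od Q
  by_cases h1 : i.1 ≤ j.1
  · rw [if_pos h1, if_neg h]
  · rw [if_neg h1, if_neg (fun hh => h hh.symm)]
    exact A.Psymm _ _

def atv (A : ReducedHG) (u : A.VV) (i j : A.Ix) : ℕ := (u (A.od i j)).1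

theorem at_symm (A : ReducedHG) (u : A.VV) (i j : A.Ix) : A.atv u i j = A.atv u j i := by
  unfold atv; rw [A.od_symm]

theorem at_mem (A : ReducedHG) (u : A.VV) {i j : A.Ix} (h : i ≠ j) : A.atv u i j ∈ A.P i.1 j.1 := by
  rw [← A.Q_od h]; exact (u (A.od i j)).2

def toPal (A : ReducedHG) : Pal A.Ix A.VV where
  E i j k u v w := (i ≠ j ∧ i ≠ k ∧ j ≠ k) ∧ A.Edge (A.atv u i j) (A.atv v i k) (A.atv w j k)
  ne _ _ _ _ _ _ h := h.1
  s1 i j k u v w h := ⟨⟨h.1.1.symm, h.1.2.2, h.1.2.1⟩, by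
    rw [A.at_symm u j i]; exact A.EdgeSymm' _ _ _ h.2⟩
  s2 i j k u v w h := ⟨⟨h.1.2.1, h.1.1, h.1.2.2.symm⟩, by
    rw [A.at_symm w k j]; exact A.EdgeSymm _ _ _ h.2⟩

theorem toPal_dense (A : ReducedHG) {d : ℝ} (h : A.EEDense d) : A.toPal.Dense d := by
  intro i j k hij hik hjk u v
  have hv : ∀ {a b : A.Ix}, a ≠ b → a.1 ≠ b.1 := fun hh h2 => hh (Subtype.ext h2)
  have h1 := h i.1 j.1 k.1 i.2 j.2 k.2 (hv hij) (hv hik) (hv hjk) _ (A.at_mem u hij) _ (A.at_mem v hik)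
  have h2 : pr (A.toPal.E i j k u v) =
      pr (fun w : A.VV => A.Edge (A.atv u i j) (A.atv v i k) (A.atv w j k)) :=
    pr_congr fun w => ⟨fun hh => hh.2, fun hh => ⟨⟨hij, hik, hjk⟩, hh⟩⟩
  have h3 := ex_coord (W := A.W) (A.od j k)
    (fun x => ind (A.Edge (A.atv u i j) (A.atv v i k) x.1))
  have h4 := pr_sub (A.Q (A.od j k)) (fun x => A.Edge (A.atv u i j) (A.atv v i k) x)
  have hc : (0:ℝ) < ((A.Q (A.od j k)).card : ℝ) := by
    exact_mod_cast Finset.card_pos.2 (A.Q_ne _)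
  have h5 : pr (A.toPal.E i j k u v) = (((A.Q (A.od j k)).filter fun x => A.Edge (A.atv u i j) (A.atv v i k) x).card : ℝ) / ((A.Q (A.od j k)).card : ℝ) := by
    rw [h2, ← h4]; exact h3
  rw [h5, le_div_iff₀ hc, A.Q_od hjk]
  exact h1

theorem toPal_supp (A : ReducedHG) (h : ¬ A.toPal.Free) : A.SupportsK5 := by
  unfold Pal.Free at h
  push Not at h
  obtain ⟨i1, i2, i3, i4, i5, a12, a13, a14, a15, a23, a24, a25, a34, a35, a45,
    e123, e124, e125, e134, e135, e145, e234, e235, e245, e345, -⟩ := h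
  let L : Fin 5 → A.Ix := ![i1, i2, i3, i4, i5]
  let M : Fin 5 → Fin 5 → A.VV := ![![a12, a12, a13, a14, a15], ![a12, a12, a23, a24, a25],
    ![a13, a23, a12, a34, a35], ![a14, a24, a34, a12, a45], ![a15, a25, a35, a45, a12]]
  have hM : ∀ p q, M p q = M q p := by
    intro p q; fin_cases p <;> fin_cases q <;> rfl
  have hlt : ∀ p q r : Fin 5, p < q → q < r →
      A.toPal.E (L p) (L q) (L r) (M p q) (M p r) (M q r) := by
    intro p q r hpq hqr
    fin_cases p <;> fin_cases q <;>
      first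
      | exact absurd hpq (by decide)
      | (fin_cases r <;> first | exact absurd hqr (by decide) | assumption)
  have hall : ∀ p q r : Fin 5, p ≠ q → p ≠ r → q ≠ r →
      A.toPal.E (L p) (L q) (L r) (M p q) (M p r) (M q r) := by
    intro p q r hpq hpr hqr
    rcases lt_or_gt_of_ne hpq with h1 | h1 <;> rcases lt_or_gt_of_ne hpr with h2 | h2 <;>
      rcases lt_or_gt_of_ne hqr with h3 | h3
    · exact hlt _ _ _ h1 h3
    · rw [Pal.s2i, hM q r]; exact hlt _ _ _ h2 h3
    · exact absurd (h1.trans h3) (not_lt.2 h2.le)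
    · rw [rot2_eq, hM p r, hM q r]; exact hlt _ _ _ h2 h1
    · rw [Pal.s1i, hM p q]; exact hlt _ _ _ h1 h2
    · exact absurd (h3.trans h1) (not_lt.2 h2.le)
    · rw [rot, hM p q, hM p r]; exact hlt _ _ _ h3 h2
    · rw [rev_eq, hM p q, hM p r, hM q r]; exact hlt _ _ _ h3 h1
  have hthird : ∀ i j : Fin 5, i ≠ j → ∃ k : Fin 5, i ≠ k ∧ j ≠ k := by decide
  have hL : ∀ p q, p ≠ q → L p ≠ L q := by
    intro p q hpq
    obtain ⟨r, h1, h2⟩ := hthird p q hpq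
    exact (A.toPal.ne _ _ _ _ _ _ (hall p q r hpq h1 h2)).1
  let g : Fin 5 → ℕ := fun p => (L p).1
  have hg : Function.Injective g := fun p q hpq => by
    by_contra hne
    exact hL p q hne (Subtype.ext hpq)
  have hidx : ∀ p, Function.invFun g (g p) = p := fun p => Function.leftInverse_invFun hg p
  refine ⟨univ.image g, ?_, ?_, fun a b => A.atv (M (Function.invFun g a) (Function.invFun g b))
    (L (Function.invFun g a)) (L (Function.invFun g b)), ?_, ?_, ?_⟩
  · intro x hx
    obtain ⟨p, -, rfl⟩ := Finset.mem_image.1 hx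
    exact (L p).2
  · rw [Finset.card_image_of_injective _ hg]; simp
  · intro a _ b _
    simp only []
    rw [A.at_symm, hM]
  · intro a ha b hb hab
    obtain ⟨p, -, rfl⟩ := Finset.mem_image.1 ha
    obtain ⟨q, -, rfl⟩ := Finset.mem_image.1 hb
    simp only [hidx]
    exact A.at_mem _ (hL _ _ fun hh => hab (by rw [hh]))
  · intro a ha b hb c hc hab hac hbc
    obtain ⟨p, -, rfl⟩ := Finset.mem_image.1 ha
    obtain ⟨q, -, rfl⟩ := Finset.mem_image.1 hb
    obtain ⟨r, -, rfl⟩ := Finset.mem_image.1 hc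
    simp only [hidx]
    exact (hall p q r (fun hh => hab (by rw [hh])) (fun hh => hac (by rw [hh]))
      (fun hh => hbc (by rw [hh]))).2

end ReducedHG

/-- Proposition 4 (`prop:K5reduced`): for every `ε > 0`, every sufficiently large
`(1/3 + ε, ee)`-dense reduced hypergraph supports a `K₅⁽³⁾`. -/
theorem reduced_K5 :
    ∀ ε : ℝ, 0 < ε → ∃ n₀ : ℕ, ∀ A : ReducedHG,
      n₀ ≤ A.I.card → A.EEDense (1/3 + ε) → A.SupportsK5 := by
  intro ε hε
  obtain ⟨N, hN⟩ := no_free (ε := min ε (1/10)) (by positivity) (min_le_right _ _)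
  refine ⟨N, fun A hA hd => A.toPal_supp (hN _ _ A.toPal (dense_mono (A.toPal_dense hd) ?_) ?_)⟩
  · have := min_le_left ε (1/10)
    linarith
  · simpa using hA
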